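/- The space of second Neumann eigenfunctions of a triangle T has dimension at most two: if u₁, u₂, u₃ are three second Neumann eigenfunctions of T, then there exist real numbers a, b, c, not all zero, such that a·u₁(z) + b·u₂(z) + c·u₃(z) = 0 for all z ∈ T. -/

import Mathlib

open Set

noncomputable section

abbrev E2 : Type := EuclideanSpace ℝ (Fin 2)

/-- The closed triangle: convex hull of the three vertices. -/
def Tri (v₁ v₂ v₃ : E2) : Set E2 := convexHull ℝ {v₁, v₂, v₃}

/-- The vertex set of the triangle. -/
def Vtx (v₁ v₂ v₃ : E2) : Set E2 := {v₁, v₂, v₃}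

/-- The triangle minus its vertices. -/
def TriDom (v₁ v₂ v₃ : E2) : Set E2 := Tri v₁ v₂ v₃ \ Vtx v₁ v₂ v₃

/-- Second (mixed) directional derivative of `u` at `p`: first in direction `v`, then `w`. -/
def mixedDeriv (u : E2 → ℝ) (p v w : E2) : ℝ :=
  fderiv ℝ (fun y => fderiv ℝ u y v) p w

/-- The (geometers') Laplacian `−(∂ₓ² + ∂_y²) u` at `p`. -/
def negLap (u : E2 → ℝ) (p : E2) : ℝ :=
  -(mixedDeriv u p (EuclideanSpace.single 0 1) (EuclideanSpace.single 0 1)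
    + mixedDeriv u p (EuclideanSpace.single 1 1) (EuclideanSpace.single 1 1))

/-- `u` satisfies Neumann conditions along the segment `[a,b]`: at every non-endpoint
point of the segment, the derivative of `u` (within `S`) annihilates every vector
orthogonal to the direction of the side; equivalently the normal derivative vanishes. -/
def NeumannOn (S : Set E2) (a b : E2) (u : E2 → ℝ) : Prop :=
  ∀ p ∈ segment ℝ a b, p ≠ a → p ≠ b →
    ∀ w : E2, @inner ℝ _ _ w (b - a) = 0 → fderivWithin ℝ u S p w = 0

/-- `u` is a Neumann eigenfunction of the triangle with vertices `v₁ v₂ v₃`,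
with eigenvalue `μ > 0`. -/
structure IsNeumannEigenfun (v₁ v₂ v₃ : E2) (μ : ℝ) (u : E2 → ℝ) : Prop where
  pos : 0 < μ
  nonconst : ¬ ∃ c : ℝ, ∀ z ∈ Tri v₁ v₂ v₃, u z = c
  cont : ContinuousOn u (Tri v₁ v₂ v₃)
  smooth : ContDiffOn ℝ (⊤ : ℕ∞) u (TriDom v₁ v₂ v₃)
  eqn : ∀ p ∈ interior (Tri v₁ v₂ v₃), negLap u p = μ * u p
  neumann₁₂ : NeumannOn (TriDom v₁ v₂ v₃) v₁ v₂ u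
  neumann₂₃ : NeumannOn (TriDom v₁ v₂ v₃) v₂ v₃ u
  neumann₃₁ : NeumannOn (TriDom v₁ v₂ v₃) v₃ v₁ u

/-- `u` is a second Neumann eigenfunction: a Neumann eigenfunction whose eigenvalue is
the least `μ > 0` admitting a Neumann eigenfunction. -/
def IsSecondNeumannEigenfun (v₁ v₂ v₃ : E2) (u : E2 → ℝ) : Prop :=
  ∃ μ : ℝ, IsNeumannEigenfun v₁ v₂ v₃ μ u ∧
    ∀ (μ' : ℝ) (u' : E2 → ℝ), IsNeumannEigenfun v₁ v₂ v₃ μ' u' → μ ≤ μ'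

/-- `p` is a critical point of `u`: a non-vertex point of the triangle at which the
derivative (within the triangle minus vertices) vanishes. -/
def IsCritPt (v₁ v₂ v₃ : E2) (u : E2 → ℝ) (p : E2) : Prop :=
  p ∈ TriDom v₁ v₂ v₃ ∧ fderivWithin ℝ u (TriDom v₁ v₂ v₃) p = 0

/-- `(a, b)` is (an ordering of) a side of the triangle `v₁ v₂ v₃`. -/
def IsSide (v₁ v₂ v₃ a b : E2) : Prop :=
  (a = v₁ ∧ b = v₂) ∨ (a = v₂ ∧ b = v₃) ∨ (a = v₃ ∧ b = v₁)

/-- Reflection of `z` across the line through `a` and `b`. -/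
def lineReflect (a b z : E2) : E2 :=
  (2 : ℝ) • (a + ((@inner ℝ _ _ (z - a) (b - a)) / (@inner ℝ _ _ (b - a) (b - a))) • (b - a)) - z

/-- Determinant of the Hessian of `w` at `p` (in the standard coordinates). -/
def hessDet (w : E2 → ℝ) (p : E2) : ℝ :=
  mixedDeriv w p (EuclideanSpace.single 0 1) (EuclideanSpace.single 0 1) *
      mixedDeriv w p (EuclideanSpace.single 1 1) (EuclideanSpace.single 1 1) -
    mixedDeriv w p (EuclideanSpace.single 0 1) (EuclideanSpace.single 1 1) *
      mixedDeriv w p (EuclideanSpace.single 1 1) (EuclideanSpace.single 0 1)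

/-- The Hessian at `p` of the extension of `u` by reflection across the side `[a,b]`
satisfies the predicate `P`: there is a smooth local extension `w` of `u` near `p`,
invariant under the reflection across the line through `a, b`, with `P (hessDet w p)`. -/
def ReflHessAt (v₁ v₂ v₃ a b : E2) (u : E2 → ℝ) (p : E2) (P : ℝ → Prop) : Prop :=
  ∃ (U : Set E2) (w : E2 → ℝ), IsOpen U ∧ p ∈ U ∧ ContDiffOn ℝ (⊤ : ℕ∞) w U ∧
    (∀ z ∈ U ∩ Tri v₁ v₂ v₃, w z = u z) ∧
    (∀ z ∈ U, lineReflect a b z ∈ U → w (lineReflect a b z) = w z) ∧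
    P (hessDet w p)

/-- `p` is an isolated local extremum of `u` on the triangle: the connected component
of the level set `{z ∈ T : u z = u p}` containing `p` is `{p}`. -/
def IsIsolatedExtremum (v₁ v₂ v₃ : E2) (u : E2 → ℝ) (p : E2) : Prop :=
  connectedComponentIn {z ∈ Tri v₁ v₂ v₃ | u z = u p} p = {p}

namespace NT
open MeasureTheory Filter Topology

lemma poinc1_zero {a b : ℝ} (hab : a < b) {g g' : ℝ → ℝ} {S : Set ℝ} (hS : S.Countable)
    (hc : ContinuousOn g (Icc a b)) (hd : ∀ x ∈ Ioo a b \ S, HasDerivAt g (g' x) x)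
    (hm : AEStronglyMeasurable g' (volume.restrict (Ioc a b)))
    (hi : IntervalIntegrable (fun x => (g' x) ^ 2) volume a b)
    (h0 : ∫ x in a..b, g x = 0) :
    ∫ x in a..b, (g x) ^ 2 ≤ (b - a) ^ 2 / (961 / 100) * ∫ x in a..b, (g' x) ^ 2 := by
  have hba : 0 < b - a := sub_pos.2 hab
  set κ : ℝ := (31 / 10) / (b - a) with hκ
  have hκ0 : 0 < κ := by positivity
  have hκab : κ * (b - a) = 31 / 10 := by rw [hκ]; field_simp
  set G : ℝ → ℝ := fun x => ∫ t in a..x, g t with hG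
  have hcu : ContinuousOn g (uIcc a b) := by rwa [uIcc_of_le hab.le]
  have hgi : IntervalIntegrable g volume a b := hcu.intervalIntegrable
  have hGc : ContinuousOn G (Icc a b) := by
    have := intervalIntegral.continuousOn_primitive_interval' hgi left_mem_uIcc
    rwa [uIcc_of_le hab.le] at this
  have hGd : ∀ x ∈ Ioo a b, HasDerivAt G (g x) x := by
    intro x hx
    have hgx : ContinuousAt g x := hc.continuousAt (Icc_mem_nhds hx.1 hx.2)
    apply intervalIntegral.integral_hasDerivAt_right
    · exact hgi.mono_set (by
        rw [uIcc_of_le hab.le, uIcc_of_le hx.1.le]; exact Icc_subset_Icc_right hx.2.le)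
    · exact (hc.mono Ioo_subset_Icc_self).stronglyMeasurableAtFilter isOpen_Ioo x hx
    · exact hgx
  have hGa : G a = 0 := by simp [hG]
  have hGb : G b = 0 := h0
  set t : ℝ → ℝ := fun x => Real.tan (κ * (x - (a + b) / 2)) with ht
  have hcos : ∀ x ∈ Icc a b, 0 < Real.cos (κ * (x - (a + b) / 2)) := by
    intro x hx
    have hpi := Real.pi_gt_d2
    apply Real.cos_pos_of_mem_Ioo
    constructor
    · have : κ * (x - (a + b) / 2) ≥ κ * (-(b - a) / 2) := by
        apply mul_le_mul_of_nonneg_left _ hκ0.le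
        linarith [hx.1]
      nlinarith
    · have : κ * (x - (a + b) / 2) ≤ κ * ((b - a) / 2) := by
        apply mul_le_mul_of_nonneg_left _ hκ0.le
        linarith [hx.2]
      nlinarith
  have htd : ∀ x ∈ Icc a b, HasDerivAt t (κ * (1 + t x ^ 2)) x := by
    intro x hx
    have h1 := Real.hasDerivAt_tan (hcos x hx).ne'
    have h2 : HasDerivAt (fun x => κ * (x - (a + b) / 2)) κ x := by
      simpa using ((hasDerivAt_id x).sub_const ((a + b) / 2)).const_mul κ
    have h3 := h1.comp x h2
    refine h3.congr_deriv ?_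
    rw [ht]
    simp only [Real.tan_eq_sin_div_cos]
    have hne := (hcos x hx).ne'
    have := Real.sin_sq_add_cos_sq (κ * (x - (a + b) / 2))
    generalize κ * (x - (a + b) / 2) = y at *
    field_simp
    linarith
  have htc : ContinuousOn t (Icc a b) := fun x hx => (htd x hx).continuousAt.continuousWithinAt
  -- first identity
  have hint : ∀ f : ℝ → ℝ, ContinuousOn f (Icc a b) → IntervalIntegrable f volume a b := by
    intro f hf
    exact ContinuousOn.intervalIntegrable (by rwa [uIcc_of_le hab.le])
  have e1 : ∫ x in a..b, (κ * (κ * (1 + t x ^ 2)) * G x ^ 2 + κ * t x * (2 * G x * g x)) = 0 := by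
    have := integral_eq_of_hasDerivAt_off_countable_of_le
      (fun x => κ * t x * G x ^ 2)
      (fun x => κ * (κ * (1 + t x ^ 2)) * G x ^ 2 + κ * t x * (2 * G x * g x)) hab.le
      (s := ∅) countable_empty (by fun_prop) ?_ (hint _ (by fun_prop))
    · rw [this]; simp [hGa, hGb]
    · intro x hx
      have h1 := (htd x (Ioo_subset_Icc_self hx.1)).const_mul κ
      have h2 := (hGd x hx.1).pow 2
      have h3 := h1.mul h2
      refine h3.congr_deriv ?_
      simp
  have e2 : κ ^ 2 * ∫ x in a..b, G x ^ 2 ≤ ∫ x in a..b, g x ^ 2 := by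
    have h1 : 0 ≤ ∫ x in a..b, (g x + κ * t x * G x) ^ 2 :=
      intervalIntegral.integral_nonneg hab.le (fun x _ => sq_nonneg _)
    have h2 : ∫ x in a..b, (g x + κ * t x * G x) ^ 2 =
        (∫ x in a..b, g x ^ 2) - κ ^ 2 * (∫ x in a..b, G x ^ 2) +
        ∫ x in a..b, (κ * (κ * (1 + t x ^ 2)) * G x ^ 2 + κ * t x * (2 * G x * g x)) := by
      rw [← intervalIntegral.integral_const_mul, ← intervalIntegral.integral_sub,
        ← intervalIntegral.integral_add]
      · congr 1; ext x; ring
      · exact hint _ (by fun_prop)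
      · exact hint _ (by fun_prop)
      · exact hint _ (by fun_prop)
      · exact hint _ (by fun_prop)
    rw [e1] at h2
    linarith
  -- second identity
  have hg'i : IntervalIntegrable g' volume a b := by
    rw [intervalIntegrable_iff_integrableOn_Ioc_of_le hab.le] at hi ⊢
    have : MemLp g' 2 (volume.restrict (Ioc a b)) := (memLp_two_iff_integrable_sq hm).2 hi
    exact this.integrable (by norm_num)
  have hGg' : IntervalIntegrable (fun x => G x * g' x) volume a b :=
    hg'i.continuousOn_mul (by rwa [uIcc_of_le hab.le])
  have e3 : ∫ x in a..b, (g x * g x + G x * g' x) = 0 := by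
    have := integral_eq_of_hasDerivAt_off_countable_of_le
      (fun x => G x * g x) (fun x => g x * g x + G x * g' x) hab.le hS (by fun_prop) ?_
      ((hint _ (by fun_prop)).add hGg')
    · rw [this]; simp [hGa, hGb]
    · intro x hx
      exact (hGd x hx.1).mul (hd x hx)
  have e4 : 0 ≤ ∫ x in a..b, (κ * G x + κ⁻¹ * g' x) ^ 2 :=
      intervalIntegral.integral_nonneg hab.le (fun x _ => sq_nonneg _)
  have e5 : ∫ x in a..b, (κ * G x + κ⁻¹ * g' x) ^ 2 =
      κ ^ 2 * (∫ x in a..b, G x ^ 2) + κ⁻¹ ^ 2 * (∫ x in a..b, g' x ^ 2)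
      + 2 * (∫ x in a..b, (g x * g x + G x * g' x)) - 2 * ∫ x in a..b, g x ^ 2 := by
    simp only [← intervalIntegral.integral_const_mul]
    rw [← intervalIntegral.integral_add, ← intervalIntegral.integral_add,
      ← intervalIntegral.integral_sub]
    · congr 1; ext x; field_simp; ring
    · exact (((hint _ (by fun_prop)).add (hi.const_mul _))).add
        (((hint _ (by fun_prop)).add hGg').const_mul _)
    · exact hint _ (by fun_prop)
    · exact (hint _ (by fun_prop)).add (hi.const_mul _)
    · exact ((hint _ (by fun_prop)).add hGg').const_mul _
    · exact hint _ (by fun_prop)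
    · exact hi.const_mul _
  rw [e3] at e5
  have e6 : (b - a) ^ 2 / (961 / 100) = κ⁻¹ ^ 2 := by
    rw [hκ]; field_simp; norm_num
  rw [e6]
  linarith

lemma poinc1 {a b : ℝ} (hab : a < b) {g g' : ℝ → ℝ} {S : Set ℝ} (hS : S.Countable)
    (hc : ContinuousOn g (Icc a b)) (hd : ∀ x ∈ Ioo a b \ S, HasDerivAt g (g' x) x)
    (hm : AEStronglyMeasurable g' (volume.restrict (Ioc a b)))
    (hi : IntervalIntegrable (fun x => (g' x) ^ 2) volume a b) :
    ∫ x in a..b, (g x - (∫ t in a..b, g t) / (b - a)) ^ 2 ≤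
      (b - a) ^ 2 / (961 / 100) * ∫ x in a..b, (g' x) ^ 2 := by
  have hba : 0 < b - a := sub_pos.2 hab
  refine poinc1_zero (g := fun x => g x - (∫ t in a..b, g t) / (b - a)) hab hS
    (by fun_prop) (fun x hx => (hd x hx).sub_const _) hm hi ?_
  rw [intervalIntegral.integral_sub]
  · simp; field_simp; simp
  · exact ContinuousOn.intervalIntegrable (by rwa [uIcc_of_le hab.le])
  · simp
end NT

namespace NT
open MeasureTheory Filter Topology

lemma efron {a b c d s : ℝ} (hs : 0 < s) (hab : b - a = s) (hcd : d - c = s) {F : ℝ × ℝ → ℝ}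
    (hF : Continuous F) :
    (∫ p in Ioc a b ×ˢ Ioc c d, F p ^ 2) - (∫ p in Ioc a b ×ˢ Ioc c d, F p) ^ 2 / s ^ 2 ≤
      (∫ p in Ioc a b ×ˢ Ioc c d, (F p - (∫ x in a..b, F (x, p.2)) / s) ^ 2) +
      ∫ p in Ioc a b ×ˢ Ioc c d, (F p - (∫ y in c..d, F (p.1, y)) / s) ^ 2 := by
  set A : ℝ → ℝ := fun y => (∫ x in a..b, F (x, y)) / s with hA
  set B : ℝ → ℝ := fun x => (∫ y in c..d, F (x, y)) / s with hB
  have hle1 : a ≤ b := by linarith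
  have hle2 : c ≤ d := by linarith
  have cA : Continuous A := by
    apply Continuous.div_const
    exact intervalIntegral.continuous_parametric_intervalIntegral_of_continuous' (by fun_prop) _ _
  have cB : Continuous B := by
    apply Continuous.div_const
    exact intervalIntegral.continuous_parametric_intervalIntegral_of_continuous' (by fun_prop) _ _
  set μ : Measure ℝ := volume.restrict (Ioc a b) with hμ
  set ν : Measure ℝ := volume.restrict (Ioc c d) with hν
  have hP : (volume.restrict (Ioc a b ×ˢ Ioc c d) : Measure (ℝ × ℝ)) = μ.prod ν := by
    rw [Measure.volume_eq_prod, ← Measure.prod_restrict]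
  have hμu : μ.real univ = s := by simp [hμ, Measure.real, hab, hs.le]
  have hνu : ν.real univ = s := by simp [hν, Measure.real, hcd, hs.le]
  rw [hP]
  have hint : ∀ f : ℝ × ℝ → ℝ, Continuous f → Integrable f (μ.prod ν) := by
    intro f hf
    rw [← hP]
    exact (hf.continuousOn.integrableOn_compact (isCompact_Icc.prod isCompact_Icc)).mono_set
      (prod_mono Ioc_subset_Icc_self Ioc_subset_Icc_self)
  have hAs : ∀ y, ∫ x, F (x, y) ∂μ = s * A y := by
    intro y
    simp only [hA, intervalIntegral.integral_of_le hle1]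
    field_simp
    rfl
  have hBs : ∀ x, ∫ y, F (x, y) ∂ν = s * B x := by
    intro x
    simp only [hB, intervalIntegral.integral_of_le hle2]
    field_simp
    rfl
  have i1 : ∫ p, F p * A p.2 ∂(μ.prod ν) = s * ∫ y, A y ^ 2 ∂ν := by
    rw [integral_prod_symm _ (hint _ (by fun_prop)), ← integral_const_mul]
    congr 1; ext y
    simp only
    rw [integral_mul_const, hAs]; ring
  have i2 : ∫ p, F p * B p.1 ∂(μ.prod ν) = s * ∫ x, B x ^ 2 ∂μ := by
    rw [integral_prod _ (hint _ (by fun_prop)), ← integral_const_mul]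
    congr 1; ext y
    simp only
    rw [integral_mul_const, hBs]; ring
  have i3 : ∫ p, A p.2 ^ 2 ∂(μ.prod ν) = s * ∫ y, A y ^ 2 ∂ν := by
    rw [integral_prod_symm _ (hint _ (by fun_prop)), ← integral_const_mul]
    congr 1; ext y
    simp [hμu]
  have i4 : ∫ p, B p.1 ^ 2 ∂(μ.prod ν) = s * ∫ x, B x ^ 2 ∂μ := by
    rw [integral_prod _ (hint _ (by fun_prop)), ← integral_const_mul]
    congr 1; ext y
    simp [hνu]
  have i5 : ∫ p, F p ∂(μ.prod ν) = s * ∫ y, A y ∂ν := by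
    rw [integral_prod_symm _ (hint _ (by fun_prop)), ← integral_const_mul]
    congr 1; ext y
    rw [hAs]
  have i6 : ∫ p, F p ∂(μ.prod ν) = s * ∫ x, B x ∂μ := by
    rw [integral_prod _ (hint _ (by fun_prop)), ← integral_const_mul]
    congr 1; ext y
    rw [hBs]
  have i7 : ∫ p, B p.1 * A p.2 ∂(μ.prod ν) = (∫ x, B x ∂μ) * ∫ y, A y ∂ν :=
    integral_prod_mul B A
  have i8 : ∫ p, A p.2 ∂(μ.prod ν) = s * ∫ y, A y ∂ν := by
    rw [integral_prod_symm _ (hint _ (by fun_prop)), ← integral_const_mul]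
    congr 1; ext y
    simp [hμu]
  have i9 : ∫ p, B p.1 ∂(μ.prod ν) = s * ∫ y, B y ∂μ := by
    rw [integral_prod _ (hint _ (by fun_prop)), ← integral_const_mul]
    congr 1; ext y
    simp [hνu]
  set I := ∫ p, F p ∂(μ.prod ν) with hI
  set I2 := ∫ p, F p ^ 2 ∂(μ.prod ν) with hI2
  set m : ℝ := I / s ^ 2 with hm
  have i10 : ∫ p : ℝ × ℝ, m ^ 2 ∂(μ.prod ν) = s ^ 2 * m ^ 2 := by
    rw [integral_const, measureReal_def, ← Set.univ_prod_univ, Measure.prod_prod]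
    simp only [measureReal_def] at hμu hνu
    rw [smul_eq_mul, ENNReal.toReal_mul, hμu, hνu]; ring
  have e1 : ∫ p, (F p - A p.2) ^ 2 ∂(μ.prod ν) = I2 - s * ∫ y, A y ^ 2 ∂ν := by
    have : ∀ p : ℝ × ℝ, (F p - A p.2) ^ 2 = F p ^ 2 - 2 * (F p * A p.2) + A p.2 ^ 2 := by
      intro p; ring
    simp_rw [this]
    rw [integral_add (hint _ (by fun_prop)) (hint _ (by fun_prop)),
      integral_sub (hint _ (by fun_prop)) (hint _ (by fun_prop)), integral_const_mul, i1, i3]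
    ring
  have e2 : ∫ p, (F p - B p.1) ^ 2 ∂(μ.prod ν) = I2 - s * ∫ y, B y ^ 2 ∂μ := by
    have : ∀ p : ℝ × ℝ, (F p - B p.1) ^ 2 = F p ^ 2 - 2 * (F p * B p.1) + B p.1 ^ 2 := by
      intro p; ring
    simp_rw [this]
    rw [integral_add (hint _ (by fun_prop)) (hint _ (by fun_prop)),
      integral_sub (hint _ (by fun_prop)) (hint _ (by fun_prop)), integral_const_mul, i2, i4]
    ring
  have e3 : 0 ≤ ∫ p, (F p - A p.2 - B p.1 + m) ^ 2 ∂(μ.prod ν) :=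
    integral_nonneg (fun p => sq_nonneg _)
  have e4 : ∫ p, (F p - A p.2 - B p.1 + m) ^ 2 ∂(μ.prod ν) =
      I2 - s * (∫ y, A y ^ 2 ∂ν) - s * (∫ y, B y ^ 2 ∂μ) + I ^ 2 / s ^ 2 := by
    have : ∀ p : ℝ × ℝ, (F p - A p.2 - B p.1 + m) ^ 2 = (F p - A p.2) ^ 2 + (F p - B p.1) ^ 2
      + (-1) * F p ^ 2 + 2 * (B p.1 * A p.2) + m ^ 2 + (2 * m) * F p + (-2 * m) * A p.2
      + (-2 * m) * B p.1 := by
      intro p; ring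
    simp_rw [this]
    rw [integral_add (hint _ (by fun_prop)) (hint _ (by fun_prop)),
      integral_add (hint _ (by fun_prop)) (hint _ (by fun_prop)),
      integral_add (hint _ (by fun_prop)) (hint _ (by fun_prop)),
      integral_add (hint _ (by fun_prop)) (hint _ (by fun_prop)),
      integral_add (hint _ (by fun_prop)) (hint _ (by fun_prop)),
      integral_add (hint _ (by fun_prop)) (hint _ (by fun_prop)),
      integral_add (hint _ (by fun_prop)) (hint _ (by fun_prop))]
    simp only [integral_const_mul]
    rw [e1, e2, i7, i8, i9, i10, ← i5, ← i6, ← hI, ← hI2]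
    have h5 : ∫ y, A y ∂ν = I / s := by rw [i5]; field_simp
    have h6 : ∫ y, B y ∂μ = I / s := by rw [i6]; field_simp
    rw [h5, h6, hm]
    field_simp
    ring
  rw [e1, e2]
  linarith

lemma sqPoinc {a b c d s : ℝ} (hs : 0 < s) (hab : b - a = s) (hcd : d - c = s)
    {F D1 D2 : ℝ × ℝ → ℝ}
    (hF : ContinuousOn F (Icc a b ×ˢ Icc c d)) (hD1 : Measurable D1) (hD2 : Measurable D2)
    (h1 : ∀ y ∈ Ioo c d, ∃ S : Set ℝ, S.Countable ∧ ∀ x ∈ Ioo a b \ S,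
      HasDerivAt (fun x => F (x, y)) (D1 (x, y)) x)
    (h2 : ∀ x ∈ Ioo a b, ∃ S : Set ℝ, S.Countable ∧ ∀ y ∈ Ioo c d \ S,
      HasDerivAt (fun y => F (x, y)) (D2 (x, y)) y)
    (i1 : IntegrableOn (fun p => D1 p ^ 2) (Ioc a b ×ˢ Ioc c d))
    (i2 : IntegrableOn (fun p => D2 p ^ 2) (Ioc a b ×ˢ Ioc c d)) :
    (∫ p in Ioc a b ×ˢ Ioc c d, F p ^ 2) - (∫ p in Ioc a b ×ˢ Ioc c d, F p) ^ 2 / s ^ 2 ≤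
      s ^ 2 / (961 / 100) * ((∫ p in Ioc a b ×ˢ Ioc c d, D1 p ^ 2) +
        ∫ p in Ioc a b ×ˢ Ioc c d, D2 p ^ 2) := by
  have hlt1 : a < b := by linarith
  have hlt2 : c < d := by linarith
  set F' : ℝ × ℝ → ℝ := fun p => F (max a (min p.1 b), max c (min p.2 d)) with hF'
  have hin : ∀ p : ℝ × ℝ, (max a (min p.1 b), max c (min p.2 d)) ∈ Icc a b ×ˢ Icc c d := by
    intro p
    refine ⟨⟨le_max_left _ _, max_le hlt1.le (min_le_right _ _)⟩,
      ⟨le_max_left _ _, max_le hlt2.le (min_le_right _ _)⟩⟩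
  have cF' : Continuous F' := hF.comp_continuous (by fun_prop) hin
  have hFF : ∀ p ∈ Icc a b ×ˢ Icc c d, F' p = F p := by
    rintro ⟨x, y⟩ ⟨hx, hy⟩
    simp only [hF', min_eq_left hx.2, min_eq_left hy.2, max_eq_right hx.1, max_eq_right hy.1]
  have hsub : Ioc a b ×ˢ Ioc c d ⊆ Icc a b ×ˢ Icc c d :=
    prod_mono Ioc_subset_Icc_self Ioc_subset_Icc_self
  have hmeas : MeasurableSet (Ioc a b ×ˢ Ioc c d) := measurableSet_Ioc.prod measurableSet_Ioc
  have k1 : ∫ p in Ioc a b ×ˢ Ioc c d, F p ^ 2 = ∫ p in Ioc a b ×ˢ Ioc c d, F' p ^ 2 :=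
    setIntegral_congr_fun hmeas (fun p hp => by simp only [hFF p (hsub hp)])
  have k2 : ∫ p in Ioc a b ×ˢ Ioc c d, F p = ∫ p in Ioc a b ×ˢ Ioc c d, F' p :=
    setIntegral_congr_fun hmeas (fun p hp => by simp only [hFF p (hsub hp)])
  rw [k1, k2]
  refine (efron hs hab hcd cF').trans ?_
  rw [mul_add]
  set μ : Measure ℝ := volume.restrict (Ioc a b) with hμ
  set ν : Measure ℝ := volume.restrict (Ioc c d) with hν
  have hP : (volume.restrict (Ioc a b ×ˢ Ioc c d) : Measure (ℝ × ℝ)) = μ.prod ν := by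
    rw [Measure.volume_eq_prod, ← Measure.prod_restrict]
  have hint : ∀ f : ℝ × ℝ → ℝ, Continuous f → Integrable f (μ.prod ν) := by
    intro f hf
    rw [← hP]
    exact (hf.continuousOn.integrableOn_compact (isCompact_Icc.prod isCompact_Icc)).mono_set
      (prod_mono Ioc_subset_Icc_self Ioc_subset_Icc_self)
  have cA : Continuous (fun y => (∫ x in a..b, F' (x, y)) / s) := by
    apply Continuous.div_const
    exact intervalIntegral.continuous_parametric_intervalIntegral_of_continuous' (by fun_prop) _ _
  have cB : Continuous (fun x => (∫ y in c..d, F' (x, y)) / s) := by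
    apply Continuous.div_const
    exact intervalIntegral.continuous_parametric_intervalIntegral_of_continuous' (by fun_prop) _ _
  unfold IntegrableOn at i1 i2
  rw [hP] at i1 i2 ⊢
  have aeμ : ∀ᵐ x ∂μ, x ∈ Ioo a b := by
    rw [hμ, ← restrict_Ioo_eq_restrict_Ioc]; exact ae_restrict_mem measurableSet_Ioo
  have aeν : ∀ᵐ x ∂ν, x ∈ Ioo c d := by
    rw [hν, ← restrict_Ioo_eq_restrict_Ioc]; exact ae_restrict_mem measurableSet_Ioo
  have q1 : Integrable (fun p : ℝ × ℝ => (F' p - (∫ x in a..b, F' (x, p.2)) / s) ^ 2)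
      (μ.prod ν) := by
    have := cA.comp (continuous_snd (X := ℝ))
    exact hint _ ((cF'.sub this).pow 2)
  have q2 : Integrable (fun p : ℝ × ℝ => (F' p - (∫ y in c..d, F' (p.1, y)) / s) ^ 2)
      (μ.prod ν) := by
    have := cB.comp (continuous_fst (Y := ℝ))
    exact hint _ ((cF'.sub this).pow 2)
  apply add_le_add
  · rw [integral_prod_symm _ q1, integral_prod_symm _ i1, ← integral_const_mul]
    apply integral_mono_ae
    · exact q1.integral_prod_right
    · exact i1.integral_prod_right.const_mul _
    · filter_upwards [aeν, i1.prod_left_ae] with y hy hi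
      obtain ⟨S, hS, hd⟩ := h1 y hy
      have := poinc1 hlt1 (g := fun x => F' (x, y)) (g' := fun x => D1 (x, y)) hS
        (by fun_prop) ?_ (by
          exact (hD1.comp (by fun_prop : Measurable fun x : ℝ => (x, y))).aestronglyMeasurable) ?_
      · rw [hab] at this
        simp only [intervalIntegral.integral_of_le hlt1.le] at this ⊢
        exact this
      · intro x hx
        refine (hd x hx).congr_of_eventuallyEq ?_
        filter_upwards [Ioo_mem_nhds hx.1.1 hx.1.2] with z hz
        exact hFF _ ⟨Ioo_subset_Icc_self hz, Ioo_subset_Icc_self hy⟩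
      · rw [intervalIntegrable_iff_integrableOn_Ioc_of_le hlt1.le]
        exact hi
  · rw [integral_prod _ q2, integral_prod _ i2, ← integral_const_mul]
    apply integral_mono_ae
    · exact q2.integral_prod_left
    · exact i2.integral_prod_left.const_mul _
    · filter_upwards [aeμ, i2.prod_right_ae] with x hx hi
      obtain ⟨S, hS, hd⟩ := h2 x hx
      have := poinc1 hlt2 (g := fun y => F' (x, y)) (g' := fun y => D2 (x, y)) hS
        (by fun_prop) ?_ (by
          exact (hD2.comp (by fun_prop : Measurable fun y : ℝ => (x, y))).aestronglyMeasurable) ?_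
      · rw [hcd] at this
        simp only [intervalIntegral.integral_of_le hlt2.le] at this ⊢
        exact this
      · intro y hy
        refine (hd y hy).congr_of_eventuallyEq ?_
        filter_upwards [Ioo_mem_nhds hy.1.1 hy.1.2] with z hz
        exact hFF _ ⟨Ioo_subset_Icc_self hx, Ioo_subset_Icc_self hz⟩
      · rw [intervalIntegrable_iff_integrableOn_Ioc_of_le hlt2.le]
        exact hi
end NT

namespace NT
open MeasureTheory Filter Topology

/-- triangle of an affine basis -/
def TT (B : AffineBasis (Fin 3) ℝ E2) : Set E2 := convexHull ℝ (range B)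

lemma mem_TT (B : AffineBasis (Fin 3) ℝ E2) {p : E2} : p ∈ TT B ↔ ∀ i, 0 ≤ B.coord i p := by
  rw [TT, AffineBasis.convexHull_eq_nonneg_coord]; rfl

lemma mem_int_TT (B : AffineBasis (Fin 3) ℝ E2) {p : E2} :
    p ∈ interior (TT B) ↔ ∀ i, 0 < B.coord i p := by
  rw [TT, AffineBasis.interior_convexHull]; rfl

lemma isCompact_TT (B : AffineBasis (Fin 3) ℝ E2) : IsCompact (TT B) :=
  (Set.finite_range B).isCompact_convexHull ℝ

lemma convex_TT (B : AffineBasis (Fin 3) ℝ E2) : Convex ℝ (TT B) := convex_convexHull _ _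

lemma isClosed_TT (B : AffineBasis (Fin 3) ℝ E2) : IsClosed (TT B) := (isCompact_TT B).isClosed

lemma meas_TT (B : AffineBasis (Fin 3) ℝ E2) : MeasurableSet (TT B) :=
  (isClosed_TT B).measurableSet

lemma TT_ae (B : AffineBasis (Fin 3) ℝ E2) : (interior (TT B) : Set E2) =ᵐ[volume] TT B := by
  have := (convex_TT B).addHaar_frontier (μ := volume)
  exact interior_ae_eq_of_null_frontier this

lemma restrict_int (B : AffineBasis (Fin 3) ℝ E2) :
    (volume.restrict (interior (TT B)) : Measure E2) = volume.restrict (TT B) :=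
  Measure.restrict_congr_set (TT_ae B)

instance (B : AffineBasis (Fin 3) ℝ E2) : IsFiniteMeasure (volume.restrict (TT B) : Measure E2) :=
  ⟨by simpa using (isCompact_TT B).measure_lt_top⟩

/-- affine coordinates -/
def AA (B : AffineBasis (Fin 3) ℝ E2) (q : ℝ × ℝ) : E2 :=
  B 0 + (q.1 • (B 1 - B 0) + q.2 • (B 2 - B 1))

lemma coord_sum (B : AffineBasis (Fin 3) ℝ E2) (p : E2) :
    B.coord 0 p + B.coord 1 p + B.coord 2 p = 1 := by
  have := B.sum_coord_apply_eq_one p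
  rwa [Fin.sum_univ_three] at this

lemma coord_lin_sub (B : AffineBasis (Fin 3) ℝ E2) (i : Fin 3) (p q : E2) :
    (B.coord i).linear (p - q) = B.coord i p - B.coord i q := by
  have := (B.coord i).linearMap_vsub p q
  simpa using this

lemma coord_add (B : AffineBasis (Fin 3) ℝ E2) (i : Fin 3) (p v : E2) :
    B.coord i (p + v) = B.coord i p + (B.coord i).linear v := by
  have := (B.coord i).map_vadd p v
  simp only [vadd_eq_add] at this
  rw [add_comm p v, this, add_comm]

lemma coord_lin_B (B : AffineBasis (Fin 3) ℝ E2) (i j k : Fin 3) :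
    (B.coord i).linear (B j - B k) = (if i = j then 1 else 0) - (if i = k then 1 else 0) := by
  rw [coord_lin_sub, B.coord_apply, B.coord_apply]

lemma coord0_AA (B : AffineBasis (Fin 3) ℝ E2) (q : ℝ × ℝ) : B.coord 0 (AA B q) = 1 - q.1 := by
  simp only [AA, coord_add, map_add, map_smul, coord_lin_B, B.coord_apply]; simp; ring

lemma coord1_AA (B : AffineBasis (Fin 3) ℝ E2) (q : ℝ × ℝ) : B.coord 1 (AA B q) = q.1 - q.2 := by
  simp only [AA, coord_add, map_add, map_smul, coord_lin_B, B.coord_apply]; simp; ring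

lemma coord2_AA (B : AffineBasis (Fin 3) ℝ E2) (q : ℝ × ℝ) : B.coord 2 (AA B q) = q.2 := by
  simp only [AA, coord_add, map_add, map_smul, coord_lin_B, B.coord_apply]; simp

lemma coord_ext (B : AffineBasis (Fin 3) ℝ E2) {p q : E2} (h : ∀ i, B.coord i p = B.coord i q) :
    p = q := by
  have h1 := B.linear_combination_coord_eq_self p
  have h2 := B.linear_combination_coord_eq_self q
  rw [← h1, ← h2]; simp only [h]

lemma AA_inv (B : AffineBasis (Fin 3) ℝ E2) (p : E2) :
    AA B (1 - B.coord 0 p, B.coord 2 p) = p := by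
  apply coord_ext B
  intro i
  have := coord_sum B p
  fin_cases i
  · simp [coord0_AA]
  · change B.coord 1 _ = B.coord 1 p; rw [coord1_AA]; simp; linarith
  · simp [coord2_AA]

lemma cont_coord (B : AffineBasis (Fin 3) ℝ E2) (i : Fin 3) : Continuous (B.coord i) :=
  AffineMap.continuous_of_finiteDimensional _

/-- linear part of the coordinates as a continuous linear equivalence -/
def LA (B : AffineBasis (Fin 3) ℝ E2) : (ℝ × ℝ) ≃L[ℝ] E2 :=
  LinearEquiv.toContinuousLinearEquiv
  { toFun := fun q => q.1 • (B 1 - B 0) + q.2 • (B 2 - B 1)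
    map_add' := by intro x y; simp only [Prod.fst_add, Prod.snd_add, add_smul]; abel
    map_smul' := by intro c x; simp [mul_smul]
    invFun := fun w => (-(B.coord 0).linear w, (B.coord 2).linear w)
    left_inv := by
      intro q
      simp only [map_add, map_smul, coord_lin_B]
      ext <;> simp
    right_inv := by
      intro w
      have h := AA_inv B (B 0 + w)
      simp only [AA, coord_add, B.coord_apply] at h
      simpa using h }

lemma AA_eq (B : AffineBasis (Fin 3) ℝ E2) (q : ℝ × ℝ) : AA B q = B 0 + LA B q := rfl

def AH (B : AffineBasis (Fin 3) ℝ E2) : (ℝ × ℝ) ≃ₜ E2 :=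
  (LA B).toHomeomorph.trans (Homeomorph.addLeft (B 0))

lemma AH_apply (B : AffineBasis (Fin 3) ℝ E2) (q : ℝ × ℝ) : AH B q = AA B q := rfl

lemma contAA (B : AffineBasis (Fin 3) ℝ E2) : Continuous (AA B) := (AH B).continuous

lemma exJ (B : AffineBasis (Fin 3) ℝ E2) : ∃ J : ℝ, 0 < J ∧
    (volume : Measure E2) = ENNReal.ofReal J • Measure.map (AH B) volume := by
  have h1 : Measure.map (AH B) volume = Measure.map (LA B) (volume : Measure (ℝ × ℝ)) := by
    have : (AH B : ℝ × ℝ → E2) = (fun x => B 0 + x) ∘ (LA B) := rfl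
    rw [this, ← Measure.map_map (by fun_prop) (by fun_prop)]
    exact map_add_left_eq_self _ _
  rw [h1]
  have : (Measure.map (LA B) (volume : Measure (ℝ × ℝ))).IsAddHaarMeasure :=
    (LA B).isAddHaarMeasure_map volume
  obtain ⟨c, hc⟩ := (⟨_, Measure.isAddLeftInvariant_eq_smul (volume : Measure E2)
    (Measure.map (LA B) (volume : Measure (ℝ × ℝ)))⟩ : ∃ c : NNReal, (volume : Measure E2) = c • _)
  have hc0 : c ≠ 0 := by
    rintro rfl
    have : (volume : Measure E2) = 0 := by rw [hc]; simp
    exact (NeZero.ne (volume : Measure E2)) this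
  refine ⟨c, by positivity, ?_⟩
  rw [hc]
  simp

def JJ (B : AffineBasis (Fin 3) ℝ E2) : ℝ := (exJ B).choose
lemma JJ_pos (B : AffineBasis (Fin 3) ℝ E2) : 0 < JJ B := (exJ B).choose_spec.1
lemma JJ_eq (B : AffineBasis (Fin 3) ℝ E2) :
    (volume : Measure E2) = ENNReal.ofReal (JJ B) • Measure.map (AH B) volume :=
  (exJ B).choose_spec.2

def T0 : Set (ℝ × ℝ) := {q | 0 ≤ q.2 ∧ q.2 ≤ q.1 ∧ q.1 ≤ 1}

lemma isClosed_T0 : IsClosed T0 := by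
  apply IsClosed.inter (isClosed_le continuous_const continuous_snd)
  exact IsClosed.inter (isClosed_le continuous_snd continuous_fst)
    (isClosed_le continuous_fst continuous_const)

lemma AA_mem (B : AffineBasis (Fin 3) ℝ E2) (q : ℝ × ℝ) : AA B q ∈ TT B ↔ q ∈ T0 := by
  rw [mem_TT, Fin.forall_fin_succ, Fin.forall_fin_succ, Fin.forall_fin_succ]
  simp only [T0, mem_ofPred_eq]
  have h1 : Fin.succ (0 : Fin 2) = 1 := rfl
  have h2 : Fin.succ (Fin.succ (0 : Fin 1)) = 2 := rfl
  rw [h1, h2, coord0_AA, coord1_AA, coord2_AA]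
  constructor
  · rintro ⟨a, b, c, -⟩; exact ⟨c, by linarith, by linarith⟩
  · rintro ⟨a, b, c⟩; exact ⟨by linarith, by linarith, a, fun i => i.elim0⟩

lemma AA_mem_int (B : AffineBasis (Fin 3) ℝ E2) (q : ℝ × ℝ) :
    AA B q ∈ interior (TT B) ↔ (0 < q.2 ∧ q.2 < q.1 ∧ q.1 < 1) := by
  rw [mem_int_TT, Fin.forall_fin_succ, Fin.forall_fin_succ, Fin.forall_fin_succ]
  have h1 : Fin.succ (0 : Fin 2) = 1 := rfl
  have h2 : Fin.succ (Fin.succ (0 : Fin 1)) = 2 := rfl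
  rw [h1, h2, coord0_AA, coord1_AA, coord2_AA]
  constructor
  · rintro ⟨a, b, c, -⟩; exact ⟨c, by linarith, by linarith⟩
  · rintro ⟨a, b, c⟩; exact ⟨by linarith, by linarith, a, fun i => i.elim0⟩

lemma cov (B : AffineBasis (Fin 3) ℝ E2) (f : E2 → ℝ) :
    ∫ p in TT B, f p = JJ B * ∫ q in T0, f (AA B q) := by
  rw [JJ_eq B, Measure.restrict_smul, integral_smul_measure,
    (AH B).measurableEmbedding.setIntegral_map, ENNReal.toReal_ofReal (JJ_pos B).le]
  have : ⇑(AH B) ⁻¹' TT B = T0 := by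
    ext q; exact AA_mem B q
  rw [this]; rfl

lemma cov_int (B : AffineBasis (Fin 3) ℝ E2) (f : E2 → ℝ) :
    IntegrableOn f (TT B) ↔ IntegrableOn (fun q => f (AA B q)) T0 := by
  rw [JJ_eq B, IntegrableOn, Measure.restrict_smul, integrable_smul_measure (by simp [JJ_pos B])
    (by simp)]
  rw [← IntegrableOn, (AH B).measurableEmbedding.integrableOn_map_iff]
  have : ⇑(AH B) ⁻¹' TT B = T0 := by
    ext q; exact AA_mem B q
  rw [this]; rfl
end NT

namespace NT
open MeasureTheory Filter Topology

def QQ : Set (ℝ × ℝ) := Ioc 0 1 ×ˢ Ioc 0 1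

lemma meas_T0 : MeasurableSet T0 := isClosed_T0.measurableSet

lemma diag_null : (volume : Measure (ℝ × ℝ)) {q | q.1 = q.2} = 0 := by
  have hm : MeasurableSet {q : ℝ × ℝ | q.1 = q.2} :=
    (isClosed_eq continuous_fst continuous_snd).measurableSet
  rw [Measure.volume_eq_prod, Measure.measure_prod_null hm]
  refine Eventually.of_forall fun x => ?_
  have : Prod.mk x ⁻¹' {q : ℝ × ℝ | q.1 = q.2} = {x} := by
    ext y; simp [eq_comm]
  simp only [this]; simp

lemma QQ_ae : (QQ : Set (ℝ × ℝ)) =ᵐ[volume] (T0 ∪ Prod.swap ⁻¹' T0 : Set (ℝ × ℝ)) := by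
  have h1 : (QQ : Set (ℝ × ℝ)) =ᵐ[volume] (Icc 0 1 ×ˢ Icc 0 1 : Set (ℝ × ℝ)) := by
    rw [Measure.volume_eq_prod]
    exact Measure.set_prod_ae_eq Ioc_ae_eq_Icc Ioc_ae_eq_Icc
  have h2 : (Icc 0 1 ×ˢ Icc 0 1 : Set (ℝ × ℝ)) = T0 ∪ Prod.swap ⁻¹' T0 := by
    ext ⟨x, y⟩
    simp only [T0, mem_prod, mem_Icc, mem_union, mem_ofPred_eq, mem_preimage, Prod.fst_swap,
      Prod.snd_swap]
    constructor
    · rintro ⟨⟨a, b⟩, c, d⟩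
      rcases le_total y x with h | h
      · exact Or.inl ⟨c, h, b⟩
      · exact Or.inr ⟨a, h, d⟩
    · rintro (⟨a, b, c⟩ | ⟨a, b, c⟩)
      · exact ⟨⟨by linarith, c⟩, a, by linarith⟩
      · exact ⟨⟨a, by linarith⟩, by linarith, by linarith⟩
  rw [← h2]; exact h1

lemma T0_disj : AEDisjoint (volume : Measure (ℝ × ℝ)) T0 (Prod.swap ⁻¹' T0) := by
  refine measure_mono_null ?_ diag_null
  rintro ⟨x, y⟩ ⟨⟨a, b, c⟩, ⟨d, e, f⟩⟩
  simp only [Prod.fst_swap, Prod.snd_swap] at *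
  exact le_antisymm e b

lemma mp_swap : MeasurePreserving (Prod.swap : ℝ × ℝ → ℝ × ℝ) volume volume :=
  Measure.measurePreserving_swap

lemma emb_swap : MeasurableEmbedding (Prod.swap : ℝ × ℝ → ℝ × ℝ) :=
  MeasurableEquiv.prodComm.measurableEmbedding

lemma fold_int {f : ℝ × ℝ → ℝ} (h1 : IntegrableOn f T0)
    (h2 : IntegrableOn (fun q => f q.swap) T0) : IntegrableOn f QQ := by
  rw [integrableOn_congr_set_ae QQ_ae]
  refine h1.union ?_
  have := (mp_swap.integrableOn_comp_preimage emb_swap (f := fun q => f q.swap) (s := T0)).2 h2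
  simpa [Function.comp_def] using this

lemma fold {f : ℝ × ℝ → ℝ} (h1 : IntegrableOn f T0)
    (h2 : IntegrableOn (fun q => f q.swap) T0) :
    ∫ q in QQ, f q = (∫ q in T0, f q) + ∫ q in T0, f q.swap := by
  have h3 := (mp_swap.integrableOn_comp_preimage emb_swap (f := fun q => f q.swap) (s := T0)).2 h2
  have h4 := mp_swap.setIntegral_preimage_emb emb_swap (fun q => f q.swap) T0
  rw [setIntegral_congr_set QQ_ae, setIntegral_union₀ T0_disj
    (measurable_swap meas_T0).nullMeasurableSet h1 (by simpa [Function.comp_def] using h3), ← h4]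
  simp

/-- unfolding to the square -/
def Unf (B : AffineBasis (Fin 3) ℝ E2) (u : E2 → ℝ) (q : ℝ × ℝ) : ℝ :=
  u (AA B (max q.1 q.2, min q.1 q.2))

lemma Unf_T0 (B : AffineBasis (Fin 3) ℝ E2) (u : E2 → ℝ) {q : ℝ × ℝ} (hq : q ∈ T0) :
    Unf B u q = u (AA B q) := by
  simp [Unf, max_eq_left hq.2.1, min_eq_right hq.2.1]

lemma Unf_swap (B : AffineBasis (Fin 3) ℝ E2) (u : E2 → ℝ) (q : ℝ × ℝ) :
    Unf B u q.swap = Unf B u q := by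
  simp [Unf, max_comm, min_comm]

def Un1 (B : AffineBasis (Fin 3) ℝ E2) (u : E2 → ℝ) (q : ℝ × ℝ) : ℝ :=
  if q.2 < q.1 then fderiv ℝ u (AA B q) (B 1 - B 0) else fderiv ℝ u (AA B q.swap) (B 2 - B 1)

lemma Unf_cont (B : AffineBasis (Fin 3) ℝ E2) {u : E2 → ℝ} (hu : ContinuousOn u (TT B)) :
    ContinuousOn (Unf B u) (Icc 0 1 ×ˢ Icc 0 1) := by
  refine hu.comp ((contAA B).comp (by fun_prop)).continuousOn ?_
  rintro ⟨x, y⟩ ⟨⟨a, b⟩, c, d⟩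
  refine (AA_mem B _).2 ?_
  simp only at *
  exact ⟨le_min a c, min_le_max, max_le b d⟩

lemma Un1_meas (B : AffineBasis (Fin 3) ℝ E2) (u : E2 → ℝ) : Measurable (Un1 B u) := by
  have h : ∀ w, Measurable fun p => fderiv ℝ u p w := fun w => measurable_fderiv_apply_const ℝ u w
  refine Measurable.ite (measurableSet_lt measurable_snd measurable_fst) ?_ ?_
  · exact (h _).comp (contAA B).measurable
  · exact (h _).comp ((contAA B).measurable.comp measurable_swap)

lemma hasDeriv_AA1 (B : AffineBasis (Fin 3) ℝ E2) (x y : ℝ) :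
    HasDerivAt (fun x => AA B (x, y)) (B 1 - B 0) x := by
  have := (((hasDerivAt_id x).smul_const (B 1 - B 0)).add_const (y • (B 2 - B 1))).const_add (B 0)
  simpa [AA] using this

lemma hasDeriv_AA2 (B : AffineBasis (Fin 3) ℝ E2) (x y : ℝ) :
    HasDerivAt (fun y => AA B (x, y)) (B 2 - B 1) y := by
  have := (((hasDerivAt_id y).smul_const (B 2 - B 1)).const_add (x • (B 1 - B 0))).const_add (B 0)
  simpa [AA] using this

lemma Un1_deriv (B : AffineBasis (Fin 3) ℝ E2) {u : E2 → ℝ}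
    (hd : ∀ p ∈ interior (TT B), DifferentiableAt ℝ u p) {x y : ℝ} (hx : x ∈ Ioo (0 : ℝ) 1)
    (hy : y ∈ Ioo (0 : ℝ) 1) (hxy : x ≠ y) :
    HasDerivAt (fun x => Unf B u (x, y)) (Un1 B u (x, y)) x := by
  rcases lt_or_gt_of_ne hxy with h | h
  · have hp : AA B (y, x) ∈ interior (TT B) := (AA_mem_int B _).2 ⟨hx.1, h, hy.2⟩
    have := (hd _ hp).hasFDerivAt.comp_hasDerivAt x (hasDeriv_AA2 B y x)
    have e : Un1 B u (x, y) = fderiv ℝ u (AA B (y, x)) (B 2 - B 1) := by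
      simp [Un1, h.le]
    rw [e]
    refine this.congr_of_eventuallyEq ?_
    filter_upwards [Iio_mem_nhds h] with z hz
    rw [mem_Iio] at hz
    simp [Unf, max_eq_right (le_of_lt hz), min_eq_left (le_of_lt hz)]
  · have hp : AA B (x, y) ∈ interior (TT B) := (AA_mem_int B _).2 ⟨hy.1, h, hx.2⟩
    have := (hd _ hp).hasFDerivAt.comp_hasDerivAt x (hasDeriv_AA1 B x y)
    have e : Un1 B u (x, y) = fderiv ℝ u (AA B (x, y)) (B 1 - B 0) := by
      simp [Un1, h]
    rw [e]
    refine this.congr_of_eventuallyEq ?_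
    filter_upwards [Ioi_mem_nhds h] with z hz
    rw [mem_Ioi] at hz
    simp [Unf, max_eq_left (le_of_lt hz), min_eq_right (le_of_lt hz)]

lemma Un2_deriv (B : AffineBasis (Fin 3) ℝ E2) {u : E2 → ℝ}
    (hd : ∀ p ∈ interior (TT B), DifferentiableAt ℝ u p) {x y : ℝ} (hx : x ∈ Ioo (0 : ℝ) 1)
    (hy : y ∈ Ioo (0 : ℝ) 1) (hxy : y ≠ x) :
    HasDerivAt (fun y => Unf B u (x, y)) (Un1 B u (y, x)) y := by
  have := Un1_deriv B hd hy hx hxy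
  refine this.congr_of_eventuallyEq ?_
  filter_upwards with z
  exact (Unf_swap B u (x, z)).symm

lemma T0_ae_lt : ∀ᵐ q ∂(volume.restrict T0 : Measure (ℝ × ℝ)), q ∈ T0 ∧ q.2 < q.1 := by
  have h : ∀ᵐ q ∂(volume.restrict T0 : Measure (ℝ × ℝ)), ¬ q ∈ {q : ℝ × ℝ | q.1 = q.2} := by
    apply ae_restrict_of_ae
    rw [ae_iff]; simpa using diag_null
  filter_upwards [h, ae_restrict_mem meas_T0] with q hq hq2
  exact ⟨hq2, lt_of_le_of_ne hq2.2.1 (fun h => hq h.symm)⟩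

lemma Un1_T0 (B : AffineBasis (Fin 3) ℝ E2) (u : E2 → ℝ) :
    (fun q => Un1 B u q ^ 2) =ᵐ[volume.restrict T0]
      fun q => fderiv ℝ u (AA B q) (B 1 - B 0) ^ 2 := by
  filter_upwards [T0_ae_lt] with q hq
  simp [Un1, hq.2]

lemma Un2_T0 (B : AffineBasis (Fin 3) ℝ E2) (u : E2 → ℝ) :
    (fun q => Un1 B u q.swap ^ 2) =ᵐ[volume.restrict T0]
      fun q => fderiv ℝ u (AA B q) (B 2 - B 1) ^ 2 := by
  filter_upwards [T0_ae_lt] with q hq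
  simp [Un1, hq.2.le]

lemma energy_dir (B : AffineBasis (Fin 3) ℝ E2) {u : E2 → ℝ}
    (hE : IntegrableOn (fun p => ‖fderiv ℝ u p‖ ^ 2) (TT B)) (w : E2) :
    IntegrableOn (fun p => (fderiv ℝ u p w) ^ 2) (TT B) := by
  refine (hE.mul_const (‖w‖ ^ 2)).mono'
    ((measurable_fderiv_apply_const ℝ u w).pow_const 2).aestronglyMeasurable ?_
  refine Eventually.of_forall fun p => ?_
  rw [Real.norm_eq_abs, abs_of_nonneg (sq_nonneg _), ← mul_pow, ← sq_abs]
  exact pow_le_pow_left₀ (abs_nonneg _) ((fderiv ℝ u p).le_opNorm w) 2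

lemma Un1_int (B : AffineBasis (Fin 3) ℝ E2) {u : E2 → ℝ}
    (hE : IntegrableOn (fun p => ‖fderiv ℝ u p‖ ^ 2) (TT B)) :
    IntegrableOn (fun q => Un1 B u q ^ 2) QQ ∧
    ∫ q in QQ, Un1 B u q ^ 2 = (∫ q in T0, fderiv ℝ u (AA B q) (B 1 - B 0) ^ 2) +
      ∫ q in T0, fderiv ℝ u (AA B q) (B 2 - B 1) ^ 2 := by
  have h1 := (cov_int B _).1 (energy_dir B hE (B 1 - B 0))
  have h2 := (cov_int B _).1 (energy_dir B hE (B 2 - B 1))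
  have h1' : IntegrableOn (fun q => Un1 B u q ^ 2) T0 := h1.congr (Un1_T0 B u).symm
  have h2' : IntegrableOn (fun q => Un1 B u q.swap ^ 2) T0 := h2.congr (Un2_T0 B u).symm
  refine ⟨fold_int h1' h2', ?_⟩
  rw [fold h1' h2', integral_congr_ae (Un1_T0 B u), integral_congr_ae (Un2_T0 B u)]

lemma swap_QQ (f : ℝ × ℝ → ℝ) : ∫ q in QQ, f q.swap = ∫ q in QQ, f q := by
  have h4 := mp_swap.setIntegral_preimage_emb emb_swap f QQ
  rw [← h4]
  have : Prod.swap ⁻¹' QQ = QQ := by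
    ext q; simp only [QQ, mem_prod, mem_preimage, Prod.fst_swap, Prod.snd_swap]; tauto
  rw [this]

lemma swap_QQ_int {f : ℝ × ℝ → ℝ} (h : IntegrableOn f QQ) :
    IntegrableOn (fun q => f q.swap) QQ := by
  have h3 := (mp_swap.integrableOn_comp_preimage emb_swap (f := f) (s := QQ)).2 h
  have : Prod.swap ⁻¹' QQ = QQ := by
    ext q; simp only [QQ, mem_prod, mem_preimage, Prod.fst_swap, Prod.snd_swap]; tauto
  rw [this] at h3
  exact h3

/-- subsquares -/
def Qs (N : ℕ) (i : ℕ × ℕ) : Set (ℝ × ℝ) :=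
  Ioc ((i.1 : ℝ) / N) ((i.1 + 1 : ℝ) / N) ×ˢ Ioc ((i.2 : ℝ) / N) ((i.2 + 1 : ℝ) / N)

def idx (N : ℕ) : Finset (ℕ × ℕ) := Finset.range N ×ˢ Finset.range N

lemma meas_Qs (N : ℕ) (i : ℕ × ℕ) : MeasurableSet (Qs N i) :=
  measurableSet_Ioc.prod measurableSet_Ioc

lemma Ioc_disj {N : ℕ} (hN : 0 < N) {i j : ℕ} {x : ℝ} (h1 : x ∈ Ioc ((i : ℝ) / N) ((i + 1 : ℝ) / N))
    (h2 : x ∈ Ioc ((j : ℝ) / N) ((j + 1 : ℝ) / N)) : i = j := by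
  have hN' : (0 : ℝ) < N := by exact_mod_cast hN
  simp only [mem_Ioc, div_lt_iff₀ hN', le_div_iff₀ hN'] at h1 h2
  have a : (i : ℝ) < j + 1 := by linarith
  have b : (j : ℝ) < i + 1 := by linarith
  have a' : i < j + 1 := by exact_mod_cast a
  have b' : j < i + 1 := by exact_mod_cast b
  omega

lemma Ioc_cov {N : ℕ} (hN : 0 < N) {x : ℝ} (hx : x ∈ Ioc (0 : ℝ) 1) :
    ∃ i < N, x ∈ Ioc ((i : ℝ) / N) ((i + 1 : ℝ) / N) := by
  have hN' : (0 : ℝ) < N := by exact_mod_cast hN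
  have hpos : 0 < x * N := mul_pos hx.1 hN'
  have hc := Nat.ceil_pos.2 hpos
  have h1 := Nat.ceil_lt_add_one hpos.le
  have h2 := Nat.le_ceil (x * N)
  have h3 : ⌈x * N⌉₊ ≤ N := Nat.ceil_le.2 (by nlinarith [hx.2])
  obtain ⟨k, hk⟩ : ∃ k, ⌈x * N⌉₊ = k + 1 := ⟨⌈x * N⌉₊ - 1, by omega⟩
  rw [hk] at h1 h2 h3
  push_cast at h1 h2
  refine ⟨k, by omega, ?_⟩
  simp only [mem_Ioc, div_lt_iff₀ hN', le_div_iff₀ hN']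
  exact ⟨by linarith, h2⟩

lemma Ioc_sub {N : ℕ} {i : ℕ} (hi : i < N) :
    Ioc ((i : ℝ) / N) ((i + 1 : ℝ) / N) ⊆ Ioc (0 : ℝ) 1 := by
  have hN' : (0 : ℝ) < N := by exact_mod_cast (by omega : 0 < N)
  apply Ioc_subset_Ioc
  · positivity
  · rw [div_le_one hN']; exact_mod_cast hi

lemma Qs_union {N : ℕ} (hN : 0 < N) : QQ = ⋃ i ∈ idx N, Qs N i := by
  ext ⟨x, y⟩
  simp only [QQ, mem_prod, mem_iUnion, idx, Finset.mem_product, Finset.mem_range, Qs, exists_prop,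
    Prod.exists]
  constructor
  · rintro ⟨h1, h2⟩
    obtain ⟨i, hi, hi'⟩ := Ioc_cov hN h1
    obtain ⟨j, hj, hj'⟩ := Ioc_cov hN h2
    exact ⟨i, j, ⟨hi, hj⟩, hi', hj'⟩
  · rintro ⟨i, j, ⟨hi, hj⟩, hi', hj'⟩
    exact ⟨Ioc_sub hi hi', Ioc_sub hj hj'⟩

lemma Qs_sub {N : ℕ} {i : ℕ × ℕ} (hi : i ∈ idx N) : Qs N i ⊆ QQ := by
  simp only [idx, Finset.mem_product, Finset.mem_range] at hi
  exact prod_mono (Ioc_sub hi.1) (Ioc_sub hi.2)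

lemma Qs_sum {N : ℕ} (hN : 0 < N) {f : ℝ × ℝ → ℝ} (hf : IntegrableOn f QQ) :
    ∫ q in QQ, f q = ∑ i ∈ idx N, ∫ q in Qs N i, f q := by
  rw [Qs_union hN]
  refine integral_biUnion_finset _ (fun i _ => meas_Qs N i) ?_ (fun i hi => hf.mono_set (Qs_sub hi))
  intro i _ j _ hij
  rw [Function.onFun, Set.disjoint_left]
  rintro q ⟨h1, h2⟩ ⟨h3, h4⟩
  exact hij (Prod.ext (Ioc_disj hN h1 h3) (Ioc_disj hN h2 h4))

/-- the averaging functionals -/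
def ell (B : AffineBasis (Fin 3) ℝ E2) (N : ℕ) (i : ℕ × ℕ) (u : E2 → ℝ) : ℝ :=
  ∫ q in Qs N i, Unf B u q

lemma IntOn_of_cont {f : ℝ × ℝ → ℝ} (hf : ContinuousOn f (Icc 0 1 ×ˢ Icc 0 1)) :
    IntegrableOn f QQ :=
  (hf.integrableOn_compact (isCompact_Icc.prod isCompact_Icc)).mono_set
    (prod_mono Ioc_subset_Icc_self Ioc_subset_Icc_self)

lemma sq_le_energy (B : AffineBasis (Fin 3) ℝ E2) {Λ : ℝ}
    (hΛ : ∀ L : E2 →L[ℝ] ℝ, L (B 1 - B 0) ^ 2 + L (B 2 - B 1) ^ 2 ≤ Λ * ‖L‖ ^ 2)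
    {u : E2 → ℝ} (hu : ContinuousOn u (TT B)) (hd : ∀ p ∈ interior (TT B), DifferentiableAt ℝ u p)
    (hE : IntegrableOn (fun p => ‖fderiv ℝ u p‖ ^ 2) (TT B)) {N : ℕ} (hN : 0 < N) :
    ∫ p in TT B, u p ^ 2 ≤ Λ / (961 / 100 * N ^ 2) * (∫ p in TT B, ‖fderiv ℝ u p‖ ^ 2) +
      JJ B / 2 * N ^ 2 * ∑ i ∈ idx N, ell B N i u ^ 2 := by
  have hN' : (0 : ℝ) < N := by exact_mod_cast hN
  obtain ⟨e1, e2⟩ := Un1_int B hE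
  have cF := Unf_cont B hu
  have iF2 : IntegrableOn (fun q => Unf B u q ^ 2) QQ := IntOn_of_cont (cF.pow 2)
  have hT0 : T0 ⊆ Icc 0 1 ×ˢ Icc 0 1 := by
    rintro ⟨x, y⟩ ⟨a, b, c⟩
    simp only at *
    exact ⟨⟨by simp; linarith, c⟩, a, by simp; linarith⟩
  have iT : IntegrableOn (fun q => Unf B u q ^ 2) T0 :=
    ((cF.pow 2).integrableOn_compact (isCompact_Icc.prod isCompact_Icc)).mono_set hT0
  have iT' : IntegrableOn (fun q => Unf B u q.swap ^ 2) T0 := by simpa only [Unf_swap] using iT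
  have s1 : ∫ p in TT B, u p ^ 2 = JJ B / 2 * ∫ q in QQ, Unf B u q ^ 2 := by
    rw [fold iT iT', cov]
    have : ∫ q in T0, Unf B u q ^ 2 = ∫ q in T0, u (AA B q) ^ 2 :=
      setIntegral_congr_fun meas_T0 (fun q hq => by simp only [Unf_T0 B u hq])
    simp only [Unf_swap, this]; ring
  have s2 : (∫ q in QQ, Un1 B u q ^ 2) + (∫ q in QQ, Un1 B u q.swap ^ 2)
      ≤ 2 * Λ / JJ B * ∫ p in TT B, ‖fderiv ℝ u p‖ ^ 2 := by
    rw [swap_QQ (fun q => Un1 B u q ^ 2), e2, cov]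
    have h1 := (cov_int B _).1 (energy_dir B hE (B 1 - B 0))
    have h2 := (cov_int B _).1 (energy_dir B hE (B 2 - B 1))
    have h3 := (cov_int B _).1 hE
    have : (∫ q in T0, fderiv ℝ u (AA B q) (B 1 - B 0) ^ 2) +
      (∫ q in T0, fderiv ℝ u (AA B q) (B 2 - B 1) ^ 2) ≤ Λ * ∫ q in T0, ‖fderiv ℝ u (AA B q)‖ ^ 2 := by
      rw [← integral_add h1 h2, ← integral_const_mul]
      exact integral_mono (h1.add h2) (h3.const_mul _) (fun q => hΛ _)
    have hJ := JJ_pos B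
    calc _ ≤ 2 * (Λ * ∫ q in T0, ‖fderiv ℝ u (AA B q)‖ ^ 2) := by linarith
      _ = _ := by field_simp
  have e3 := swap_QQ_int e1
  have s3 : ∀ i ∈ idx N, (∫ q in Qs N i, Unf B u q ^ 2) ≤
      (1 / N : ℝ) ^ 2 / (961 / 100) * ((∫ q in Qs N i, Un1 B u q ^ 2) +
        ∫ q in Qs N i, Un1 B u q.swap ^ 2) + N ^ 2 * ell B N i u ^ 2 := by
    intro i hi
    have hi' := hi
    simp only [idx, Finset.mem_product, Finset.mem_range] at hi'
    have k : ∀ {i : ℕ}, i < N → Icc ((i : ℝ) / N) ((i + 1 : ℝ) / N) ⊆ Icc (0 : ℝ) 1 := by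
      intro i hi
      apply Icc_subset_Icc
      · positivity
      · rw [div_le_one hN']; exact_mod_cast hi
    have k' : ∀ {i : ℕ}, i < N → Ioo ((i : ℝ) / N) ((i + 1 : ℝ) / N) ⊆ Ioo (0 : ℝ) 1 := by
      intro i hi
      apply Ioo_subset_Ioo
      · positivity
      · rw [div_le_one hN']; exact_mod_cast hi
    have := sqPoinc (a := (i.1 : ℝ) / N) (b := (i.1 + 1 : ℝ) / N) (c := (i.2 : ℝ) / N)
      (d := (i.2 + 1 : ℝ) / N) (s := 1 / N) (by positivity) (by ring) (by ring)
      (cF.mono (prod_mono (k hi'.1) (k hi'.2))) (Un1_meas B u)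
      ((Un1_meas B u).comp measurable_swap)
      (fun y hy => ⟨{y}, countable_singleton y, fun x hx =>
        Un1_deriv B hd (k' hi'.1 hx.1) (k' hi'.2 hy) hx.2⟩)
      (fun x hx => ⟨{x}, countable_singleton x, fun y hy =>
        Un2_deriv B hd (k' hi'.1 hx) (k' hi'.2 hy.1) hy.2⟩)
      (e1.mono_set (Qs_sub hi)) (e3.mono_set (Qs_sub hi))
    have e : (∫ q in Qs N i, Unf B u q) ^ 2 / (1 / N : ℝ) ^ 2 = N ^ 2 * ell B N i u ^ 2 := by
      rw [ell]; field_simp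
    unfold Qs at e ⊢
    rw [e] at this
    simp only [Function.comp] at this
    linarith
  rw [s1, Qs_sum hN iF2]
  have s4 := Finset.sum_le_sum s3
  rw [Finset.sum_add_distrib, ← Finset.mul_sum, ← Finset.mul_sum, Finset.sum_add_distrib,
    ← Qs_sum hN e1, ← Qs_sum hN e3] at s4
  have hJ := JJ_pos B
  calc _ ≤ JJ B / 2 * _ := mul_le_mul_of_nonneg_left s4 (by positivity)
    _ ≤ JJ B / 2 * ((1 / N : ℝ) ^ 2 / (961 / 100) *
        (2 * Λ / JJ B * ∫ p in TT B, ‖fderiv ℝ u p‖ ^ 2) + N ^ 2 * ∑ i ∈ idx N, ell B N i u ^ 2) := by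
        gcongr
    _ = _ := by field_simp

end NT

namespace NT
open MeasureTheory Filter Topology

lemma T0_iter {f : ℝ × ℝ → ℝ} (hf : IntegrableOn f T0) :
    ∫ q in T0, f q = ∫ x in (0 : ℝ)..1, ∫ y in (0 : ℝ)..x, f (x, y) := by
  rw [← integral_indicator meas_T0, Measure.volume_eq_prod, integral_prod]
  · rw [intervalIntegral.integral_of_le zero_le_one, ← integral_Icc_eq_integral_Ioc,
      ← integral_indicator measurableSet_Icc]
    congr 1; ext x
    by_cases hx : x ∈ Icc (0 : ℝ) 1
    · rw [indicator_of_mem hx, intervalIntegral.integral_of_le hx.1, ← integral_Icc_eq_integral_Ioc,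
        ← integral_indicator measurableSet_Icc]
      congr 1; ext y
      simp only [indicator, T0, mem_ofPred_eq, mem_Icc, hx.2, and_true]
    · rw [indicator_of_notMem hx]
      have : ∀ y, T0.indicator f (x, y) = 0 := by
        intro y
        refine indicator_of_notMem (fun h => hx ?_) _
        exact ⟨le_trans h.1 h.2.1, h.2.2⟩
      simp [this]
  · rw [← Measure.volume_eq_prod]; exact hf.integrable_indicator meas_T0

lemma T0_iter' {f : ℝ × ℝ → ℝ} (hf : IntegrableOn f T0) :
    ∫ q in T0, f q = ∫ y in (0 : ℝ)..1, ∫ x in y..(1 : ℝ), f (x, y) := by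
  rw [← integral_indicator meas_T0, Measure.volume_eq_prod, integral_prod_symm]
  · rw [intervalIntegral.integral_of_le zero_le_one, ← integral_Icc_eq_integral_Ioc,
      ← integral_indicator measurableSet_Icc]
    congr 1; ext y
    by_cases hx : y ∈ Icc (0 : ℝ) 1
    · rw [indicator_of_mem hx, intervalIntegral.integral_of_le hx.2, ← integral_Icc_eq_integral_Ioc,
        ← integral_indicator measurableSet_Icc]
      congr 1; ext x
      simp only [indicator, T0, mem_ofPred_eq, mem_Icc, hx.1, true_and]
    · rw [indicator_of_notMem hx]
      have : ∀ x, T0.indicator f (x, y) = 0 := by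
        intro x
        refine indicator_of_notMem (fun h => hx ?_) _
        exact ⟨h.1, le_trans h.2.1 h.2.2⟩
      simp [this]
  · rw [← Measure.volume_eq_prod]; exact hf.integrable_indicator meas_T0

lemma isCompact_T0 : IsCompact T0 := by
  refine (isCompact_Icc.prod isCompact_Icc).of_isClosed_subset isClosed_T0
    (?_ : T0 ⊆ Icc (0 : ℝ) 1 ×ˢ Icc (0 : ℝ) 1)
  rintro ⟨x, y⟩ ⟨a, b, c⟩
  simp only at *
  exact ⟨⟨by simp; linarith, c⟩, a, by simp; linarith⟩

lemma sq_int_le {α : Type*} [MeasurableSpace α] {μ : Measure α} [IsFiniteMeasure μ]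
    (hμ : μ.real univ ≤ 1) {f : α → ℝ} (hf : Integrable f μ) (hf2 : Integrable (fun x => f x ^ 2) μ) :
    (∫ x, f x ∂μ) ^ 2 ≤ ∫ x, f x ^ 2 ∂μ := by
  set c := ∫ x, f x ∂μ with hc
  have h0 : 0 ≤ ∫ x, (f x - c) ^ 2 ∂μ := integral_nonneg fun x => sq_nonneg _
  have h1 : ∫ x, (f x - c) ^ 2 ∂μ = (∫ x, f x ^ 2 ∂μ) - 2 * c * c + μ.real univ * c ^ 2 := by
    have : ∀ x, (f x - c) ^ 2 = f x ^ 2 - 2 * c * f x + c ^ 2 := fun x => by ring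
    simp_rw [this]
    have e : Integrable (fun x => f x ^ 2 - 2 * c * f x) μ := hf2.sub (hf.const_mul _)
    rw [integral_add e (integrable_const _),
      integral_sub hf2 (hf.const_mul _), integral_const_mul, integral_const, smul_eq_mul]
  nlinarith [sq_nonneg c]

lemma ell_add (B : AffineBasis (Fin 3) ℝ E2) {N : ℕ} {i : ℕ × ℕ} (hi : i ∈ idx N) {u v : E2 → ℝ}
    (hu : ContinuousOn u (TT B)) (hv : ContinuousOn v (TT B)) :
    ell B N i (fun p => u p + v p) = ell B N i u + ell B N i v :=
  integral_add ((IntOn_of_cont (Unf_cont B hu)).mono_set (Qs_sub hi))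
    ((IntOn_of_cont (Unf_cont B hv)).mono_set (Qs_sub hi))

lemma ell_smul (B : AffineBasis (Fin 3) ℝ E2) {N : ℕ} {i : ℕ × ℕ} (c : ℝ) (u : E2 → ℝ) :
    ell B N i (fun p => c * u p) = c * ell B N i u :=
  integral_const_mul c _

lemma QQ_sq (B : AffineBasis (Fin 3) ℝ E2) {u : E2 → ℝ} (hu : ContinuousOn u (TT B)) :
    ∫ q in QQ, Unf B u q = 2 / JJ B * ∫ p in TT B, u p := by
  have hc := (Unf_cont B hu)
  have hT0 : T0 ⊆ Icc 0 1 ×ˢ Icc 0 1 := by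
    rintro ⟨x, y⟩ ⟨a, b, c⟩
    simp only at *
    exact ⟨⟨by simp; linarith, c⟩, a, by simp; linarith⟩
  have iT : IntegrableOn (fun q => Unf B u q) T0 :=
    ((hc).integrableOn_compact (isCompact_Icc.prod isCompact_Icc)).mono_set hT0
  have iT' : IntegrableOn (fun q => Unf B u q.swap) T0 := by simpa only [Unf_swap] using iT
  have := JJ_pos B
  rw [fold iT iT', cov]
  have : ∫ q in T0, Unf B u q = ∫ q in T0, u (AA B q) :=
    setIntegral_congr_fun meas_T0 (fun q hq => by simp only [Unf_T0 B u hq])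
  simp only [Unf_swap, this]; field_simp; ring

lemma ell_bound (B : AffineBasis (Fin 3) ℝ E2) {N : ℕ} {i : ℕ × ℕ} (hi : i ∈ idx N) {u : E2 → ℝ}
    (hu : ContinuousOn u (TT B)) : ell B N i u ^ 2 ≤ 2 / JJ B * ∫ p in TT B, u p ^ 2 := by
  have h2 : IntegrableOn (fun q => Unf B u q ^ 2) QQ := IntOn_of_cont ((Unf_cont B hu).pow 2)
  have hvol : (volume : Measure (ℝ × ℝ)) QQ = 1 := by
    rw [QQ, Measure.volume_eq_prod, Measure.prod_prod]; simp
  have hle : (volume : Measure (ℝ × ℝ)) (Qs N i) ≤ 1 := hvol ▸ measure_mono (Qs_sub hi)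
  have : IsFiniteMeasure (volume.restrict (Qs N i) : Measure (ℝ × ℝ)) :=
    ⟨by simpa using hle.trans_lt ENNReal.one_lt_top⟩
  refine (sq_int_le ?_ ((IntOn_of_cont (Unf_cont B hu)).mono_set (Qs_sub hi))
    (h2.mono_set (Qs_sub hi))).trans ?_
  · rw [Measure.real, Measure.restrict_apply_univ]
    exact ENNReal.toReal_mono ENNReal.one_ne_top hle
  · have : ∫ q in QQ, Unf B u q ^ 2 = 2 / JJ B * ∫ p in TT B, u p ^ 2 :=
      QQ_sq B (u := fun p => u p ^ 2) (hu.pow 2)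
    rw [← this]
    exact setIntegral_mono_set h2 (Eventually.of_forall fun q => sq_nonneg _)
      (Qs_sub hi).eventuallyLE

lemma ell_symm (B : AffineBasis (Fin 3) ℝ E2) (u : E2 → ℝ) :
    ell B 2 (0, 1) u = ell B 2 (1, 0) u := by
  have h4 := mp_swap.setIntegral_preimage_emb emb_swap (Unf B u) (Qs 2 (1, 0))
  rw [ell, ell, ← h4]
  have : Prod.swap ⁻¹' (Qs 2 (1, 0)) = Qs 2 (0, 1) := by
    ext q; simp only [Qs, mem_prod, mem_preimage, Prod.fst_swap, Prod.snd_swap]; tauto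
  rw [this]; simp only [Unf_swap]

lemma idx2_sum (f : ℕ × ℕ → ℝ) :
    ∑ i ∈ idx 2, f i = f (0, 0) + f (0, 1) + f (1, 0) + f (1, 1) := by
  rw [idx, Finset.sum_product]
  simp [Finset.sum_range_succ]; ring

/-- second Poincare inequality -/
lemma poinc2 (B : AffineBasis (Fin 3) ℝ E2) {Λ : ℝ}
    (hΛ : ∀ L : E2 →L[ℝ] ℝ, L (B 1 - B 0) ^ 2 + L (B 2 - B 1) ^ 2 ≤ Λ * ‖L‖ ^ 2)
    {u : E2 → ℝ} (hu : ContinuousOn u (TT B)) (hd : ∀ p ∈ interior (TT B), DifferentiableAt ℝ u p)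
    (hE : IntegrableOn (fun p => ‖fderiv ℝ u p‖ ^ 2) (TT B))
    (h0 : ∫ p in TT B, u p = 0) (h1 : ell B 2 (0, 0) u = 0) (h2 : ell B 2 (1, 1) u = 0) :
    961 / 25 * ∫ p in TT B, u p ^ 2 ≤ Λ * (∫ p in TT B, ‖fderiv ℝ u p‖ ^ 2) := by
  have h := sq_le_energy B hΛ hu hd hE (N := 2) (by norm_num)
  have hs := Qs_sum (N := 2) (by norm_num) (IntOn_of_cont (Unf_cont B hu))
  rw [QQ_sq B hu, h0, idx2_sum] at hs
  rw [idx2_sum, h1, h2] at h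
  have hsym := ell_symm B u
  unfold ell at hsym h1 h2
  rw [h1, h2, ← hsym] at hs
  have h3 : ell B 2 (0, 1) u = 0 := by unfold ell; linarith
  have h4 : ell B 2 (1, 0) u = 0 := by rw [← ell_symm]; exact h3
  rw [h3, h4] at h
  norm_num at h
  have e : Λ / (961 / 25) * (∫ p in TT B, ‖fderiv ℝ u p‖ ^ 2)
    = (Λ * ∫ p in TT B, ‖fderiv ℝ u p‖ ^ 2) / (961 / 25) := by ring
  rw [e, le_div_iff₀ (by norm_num)] at h
  linarith

/-- first Poincare inequality -/
lemma poincN (B : AffineBasis (Fin 3) ℝ E2) {Λ : ℝ}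
    (hΛ : ∀ L : E2 →L[ℝ] ℝ, L (B 1 - B 0) ^ 2 + L (B 2 - B 1) ^ 2 ≤ Λ * ‖L‖ ^ 2)
    {u : E2 → ℝ} (hu : ContinuousOn u (TT B)) (hd : ∀ p ∈ interior (TT B), DifferentiableAt ℝ u p)
    (hE : IntegrableOn (fun p => ‖fderiv ℝ u p‖ ^ 2) (TT B))
    (h0 : ∫ p in TT B, u p = 0) :
    961 / 100 * ∫ p in TT B, u p ^ 2 ≤ Λ * (∫ p in TT B, ‖fderiv ℝ u p‖ ^ 2) := by
  have h := sq_le_energy B hΛ hu hd hE (N := 1) (by norm_num)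
  have hs := Qs_sum (N := 1) (by norm_num) (IntOn_of_cont (Unf_cont B hu))
  rw [QQ_sq B hu, h0] at hs
  have hi : idx 1 = {(0, 0)} := rfl
  rw [hi, Finset.sum_singleton] at hs h
  have h3 : ell B 1 (0, 0) u = 0 := by unfold ell; linarith
  rw [h3] at h
  norm_num at h
  have e : Λ / (961 / 100) * (∫ p in TT B, ‖fderiv ℝ u p‖ ^ 2)
    = (Λ * ∫ p in TT B, ‖fderiv ℝ u p‖ ^ 2) / (961 / 100) := by ring
  rw [e, le_div_iff₀ (by norm_num)] at h
  linarith

lemma exLam (B : AffineBasis (Fin 3) ℝ E2) : ∃ Λ : ℝ, 0 < Λ ∧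
    (∀ L : E2 →L[ℝ] ℝ, L (B 1 - B 0) ^ 2 + L (B 2 - B 1) ^ 2 ≤ Λ * ‖L‖ ^ 2) ∧
    ∃ L : E2 →L[ℝ] ℝ, ‖L‖ = 1 ∧ L (B 1 - B 0) ^ 2 + L (B 2 - B 1) ^ 2 = Λ := by
  have hne : (Metric.sphere (0 : E2 →L[ℝ] ℝ) 1).Nonempty := by
    have : Nontrivial (E2 →L[ℝ] ℝ) := by
      refine ⟨⟨(EuclideanSpace.proj 0 : E2 →L[ℝ] ℝ), 0, fun h => ?_⟩⟩
      have := congrArg (fun f : E2 →L[ℝ] ℝ => f (EuclideanSpace.single 0 1)) h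
      simp at this
    exact (NormedSpace.sphere_nonempty (E := E2 →L[ℝ] ℝ)).2 zero_le_one
  have hcont : Continuous fun L : E2 →L[ℝ] ℝ => L (B 1 - B 0) ^ 2 + L (B 2 - B 1) ^ 2 := by
    fun_prop
  obtain ⟨L, hL, hmax⟩ := (isCompact_sphere (0 : E2 →L[ℝ] ℝ) 1).exists_isMaxOn hne hcont.continuousOn
  have hL1 : ‖L‖ = 1 := by simpa using hL
  have hall : ∀ M : E2 →L[ℝ] ℝ, M (B 1 - B 0) ^ 2 + M (B 2 - B 1) ^ 2 ≤
      (L (B 1 - B 0) ^ 2 + L (B 2 - B 1) ^ 2) * ‖M‖ ^ 2 := by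
    intro M
    by_cases hM : M = 0
    · simp [hM]
    have hM' : ‖M‖ ≠ 0 := by simpa using hM
    have : (‖M‖⁻¹ • M) ∈ Metric.sphere (0 : E2 →L[ℝ] ℝ) 1 := by
      simp [norm_smul, hM']
    have h := hmax this
    simp only [mem_ofPred_eq, _root_.smul_apply, smul_eq_mul, mul_pow] at h
    have hp : 0 < ‖M‖ ^ 2 := by positivity
    calc _ = ((‖M‖⁻¹) ^ 2 * M (B 1 - B 0) ^ 2 + (‖M‖⁻¹) ^ 2 * M (B 2 - B 1) ^ 2) * ‖M‖ ^ 2 := by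
          field_simp
      _ ≤ _ := mul_le_mul_of_nonneg_right h hp.le
  refine ⟨_, ?_, hall, L, hL1, rfl⟩
  have hnn : 0 ≤ L (B 1 - B 0) ^ 2 + L (B 2 - B 1) ^ 2 := by positivity
  refine lt_of_le_of_ne hnn (fun h0 => ?_)
  rw [← h0] at hall
  have hb : B 2 - B 1 = 0 := by
    have := hall (innerSL ℝ (B 2 - B 1))
    simp only [zero_mul] at this
    have h2 : (innerSL ℝ (B 2 - B 1) (B 2 - B 1)) ^ 2 ≤ 0 := by
      nlinarith [sq_nonneg ((innerSL ℝ (B 2 - B 1)) (B 1 - B 0))]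
    have h3 : (innerSL ℝ (B 2 - B 1) (B 2 - B 1)) = 0 := by
      nlinarith [sq_nonneg ((innerSL ℝ (B 2 - B 1)) (B 2 - B 1))]
    rw [innerSL_apply_apply] at h3
    exact inner_self_eq_zero.1 h3
  have := B.ind.injective (sub_eq_zero.1 hb)
  exact absurd this (by decide)

lemma trial_int (α β : ℝ) : ∫ q in T0, (α * (q.1 - 2 / 3) + β * (q.2 - 1 / 3)) ^ 2 =
    (α ^ 2 + β ^ 2 + α * β) / 36 := by
  rw [T0_iter ((by fun_prop : Continuous fun q : ℝ × ℝ =>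
    (α * (q.1 - 2 / 3) + β * (q.2 - 1 / 3)) ^ 2).continuousOn.integrableOn_compact isCompact_T0)]
  have h1 : ∀ x : ℝ, ∫ y in (0 : ℝ)..x, (α * (x - 2 / 3) + β * (y - 1 / 3)) ^ 2 =
      (α * (x - 2 / 3)) ^ 2 * x + α * (x - 2 / 3) * β * (x ^ 2 - 2 / 3 * x) +
      β ^ 2 * (x ^ 3 / 3 - x ^ 2 / 3 + x / 9) := by
    intro x
    rw [intervalIntegral.integral_eq_sub_of_hasDerivAt (f := fun y =>
      (α * (x - 2 / 3)) ^ 2 * y + α * (x - 2 / 3) * β * (y ^ 2 - 2 / 3 * y) +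
      β ^ 2 * (y ^ 3 / 3 - y ^ 2 / 3 + y / 9))]
    · simp
    · intro y _
      have a1 := (hasDerivAt_id y).const_mul ((α * (x - 2 / 3)) ^ 2)
      have a2 := (((hasDerivAt_id y).pow 2).sub ((hasDerivAt_id y).const_mul (2 / 3))).const_mul
        (α * (x - 2 / 3) * β)
      have a3 := (((((hasDerivAt_id y).pow 3).div_const 3).sub (((hasDerivAt_id y).pow 2).div_const 3)).add
        ((hasDerivAt_id y).div_const 9)).const_mul (β ^ 2)
      refine ((a1.add a2).add a3).congr_deriv ?_
      simp; ring
    · exact (by fun_prop : Continuous _).intervalIntegrable _ _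
  simp only [h1]
  rw [intervalIntegral.integral_eq_sub_of_hasDerivAt (f := fun x =>
    α ^ 2 * (x ^ 4 / 4 - 4 / 9 * x ^ 3 + 2 / 9 * x ^ 2) +
    α * β * (x ^ 4 / 4 - 4 / 9 * x ^ 3 + 2 / 9 * x ^ 2) +
    β ^ 2 * (x ^ 4 / 12 - x ^ 3 / 9 + x ^ 2 / 18))]
  · ring
  · intro x _
    have b1 := (hasDerivAt_id x).pow 2
    have b2 := (hasDerivAt_id x).pow 3
    have b3 := (hasDerivAt_id x).pow 4
    have a1 := (((b3.div_const 4).sub (b2.const_mul (4 / 9))).add (b1.const_mul (2 / 9)))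
    have a3 := (((b3.div_const 12).sub (b2.div_const 9)).add (b1.div_const 18)).const_mul (β ^ 2)
    refine (((a1.const_mul (α ^ 2)).add (a1.const_mul (α * β))).add a3).congr_deriv ?_
    simp; ring
  · exact (by fun_prop : Continuous _).intervalIntegrable _ _

lemma trial_mean (α β : ℝ) : ∫ q in T0, (α * (q.1 - 2 / 3) + β * (q.2 - 1 / 3)) = 0 := by
  rw [T0_iter ((by fun_prop : Continuous fun q : ℝ × ℝ =>
    (α * (q.1 - 2 / 3) + β * (q.2 - 1 / 3))).continuousOn.integrableOn_compact isCompact_T0)]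
  have h1 : ∀ x : ℝ, ∫ y in (0 : ℝ)..x, (α * (x - 2 / 3) + β * (y - 1 / 3)) =
      (α * (x - 2 / 3)) * x + β * (x ^ 2 / 2 - x / 3) := by
    intro x
    rw [intervalIntegral.integral_eq_sub_of_hasDerivAt (f := fun y =>
      (α * (x - 2 / 3)) * y + β * (y ^ 2 / 2 - y / 3))]
    · simp
    · intro y _
      have a1 := (hasDerivAt_id y).const_mul ((α * (x - 2 / 3)))
      have a2 := (((((hasDerivAt_id y).pow 2).div_const 2).sub
        ((hasDerivAt_id y).div_const 3))).const_mul β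
      refine (a1.add a2).congr_deriv ?_
      simp
    · exact (by fun_prop : Continuous _).intervalIntegrable _ _
  simp only [h1]
  rw [intervalIntegral.integral_eq_sub_of_hasDerivAt (f := fun x =>
    α * (x ^ 3 / 3 - x ^ 2 / 3) + β * (x ^ 3 / 6 - x ^ 2 / 6))]
  · ring
  · intro x _
    have b1 := (hasDerivAt_id x).pow 2
    have b2 := (hasDerivAt_id x).pow 3
    refine ((((b2.div_const 3).sub (b1.div_const 3)).const_mul α).add
      (((b2.div_const 6).sub (b1.div_const 6)).const_mul β)).congr_deriv ?_
    simp; ring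
  · exact (by fun_prop : Continuous _).intervalIntegrable _ _

lemma T0_one : ∫ _q in T0, (1 : ℝ) = 1 / 2 := by
  rw [T0_iter (continuousOn_const.integrableOn_compact isCompact_T0)]
  simp

/-- a good trial function -/
lemma trial (B : AffineBasis (Fin 3) ℝ E2) (L : E2 →L[ℝ] ℝ) : ∃ c : ℝ,
    (∫ p in TT B, (L p - c)) = 0 ∧
    ∫ p in TT B, ‖fderiv ℝ (fun p => L p - c) p‖ ^ 2 = JJ B / 2 * ‖L‖ ^ 2 ∧
    JJ B / 72 * (L (B 1 - B 0) ^ 2 + L (B 2 - B 1) ^ 2) ≤ ∫ p in TT B, (L p - c) ^ 2 := by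
  refine ⟨L (B 0) + L (B 1 - B 0) * (2 / 3) + L (B 2 - B 1) * (1 / 3), ?_, ?_, ?_⟩
  · rw [cov]
    have : ∀ q : ℝ × ℝ, L (AA B q) - (L (B 0) + L (B 1 - B 0) * (2 / 3) + L (B 2 - B 1) * (1 / 3)) =
      L (B 1 - B 0) * (q.1 - 2 / 3) + L (B 2 - B 1) * (q.2 - 1 / 3) := by
      intro q; simp only [AA, map_add, map_smul, smul_eq_mul]; ring
    simp only [this]
    rw [trial_mean]; simp
  · have : ∀ p, fderiv ℝ (fun p => L p - (L (B 0) + L (B 1 - B 0) * (2 / 3) +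
        L (B 2 - B 1) * (1 / 3))) p = L := by
      intro p
      rw [fderiv_sub_const]; exact L.fderiv
    simp only [this]
    rw [cov]
    have h := T0_one
    rw [setIntegral_const] at h ⊢
    simp only [smul_eq_mul, mul_one] at h ⊢
    rw [h]; ring
  · rw [cov]
    have : ∀ q : ℝ × ℝ, L (AA B q) - (L (B 0) + L (B 1 - B 0) * (2 / 3) + L (B 2 - B 1) * (1 / 3)) =
      L (B 1 - B 0) * (q.1 - 2 / 3) + L (B 2 - B 1) * (q.2 - 1 / 3) := by
      intro q; simp only [AA, map_add, map_smul, smul_eq_mul]; ring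
    simp only [this]
    rw [trial_int]
    have := JJ_pos B
    nlinarith [sq_nonneg (L (B 1 - B 0) + L (B 2 - B 1))]
end NT

namespace NT
open MeasureTheory Filter Topology

abbrev ee (i : Fin 2) : E2 := EuclideanSpace.single i 1

/-- divergence -/
def dvg (X : E2 → E2) (p : E2) : ℝ := (fderiv ℝ X p (ee 0)) 0 + (fderiv ℝ X p (ee 1)) 1

lemma trace_ee (L : E2 →ₗ[ℝ] E2) : LinearMap.trace ℝ E2 L = (L (ee 0)) 0 + (L (ee 1)) 1 := by
  rw [LinearMap.trace_eq_matrix_trace ℝ (EuclideanSpace.basisFun (Fin 2) ℝ).toBasis L,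
    Matrix.trace, Fin.sum_univ_two]
  simp [LinearMap.toMatrix_apply, ee]

lemma trace_B (B : AffineBasis (Fin 3) ℝ E2) (L : E2 →ₗ[ℝ] E2) :
    LinearMap.trace ℝ E2 L = -(B.coord 0).linear (L (B 1 - B 0)) + (B.coord 2).linear (L (B 2 - B 1)) := by
  rw [LinearMap.trace_eq_matrix_trace ℝ ((Module.Basis.finTwoProd ℝ).map (LA B).toLinearEquiv) L,
    Matrix.trace, Fin.sum_univ_two]
  have h : ∀ w, (LA B).symm w = (-(B.coord 0).linear w, (B.coord 2).linear w) := fun w => rfl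
  have h1 : LA B (1, 0) = B 1 - B 0 := by
    change (1 : ℝ) • (B 1 - B 0) + (0 : ℝ) • (B 2 - B 1) = _; simp
  have h2 : LA B (0, 1) = B 2 - B 1 := by
    change (0 : ℝ) • (B 1 - B 0) + (1 : ℝ) • (B 2 - B 1) = _; simp
  simp [LinearMap.toMatrix_apply, h, h1, h2]

lemma dvg_B (B : AffineBasis (Fin 3) ℝ E2) (X : E2 → E2) (p : E2) :
    dvg X p = -(B.coord 0).linear (fderiv ℝ X p (B 1 - B 0)) +
      (B.coord 2).linear (fderiv ℝ X p (B 2 - B 1)) := by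
  exact (trace_ee (fderiv ℝ X p : E2 →ₗ[ℝ] E2)).symm.trans (trace_B B _)

/-- continuous linear version of coordinates -/
def cl (B : AffineBasis (Fin 3) ℝ E2) (i : Fin 3) : E2 →L[ℝ] ℝ :=
  LinearMap.toContinuousLinearMap (B.coord i).linear

lemma cl_apply (B : AffineBasis (Fin 3) ℝ E2) (i : Fin 3) (w : E2) :
    cl B i w = (B.coord i).linear w := rfl

lemma coord_eq_cl (B : AffineBasis (Fin 3) ℝ E2) (i : Fin 3) (p q : E2) :
    B.coord i q = B.coord i p + cl B i (q - p) := by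
  rw [cl_apply, coord_lin_sub]; ring

lemma cl_sum (B : AffineBasis (Fin 3) ℝ E2) (w : E2) : cl B 0 w + cl B 1 w + cl B 2 w = 0 := by
  have h1 := coord_sum B (B 0 + w)
  have h2 := coord_sum B (B 0)
  simp only [coord_add] at h1
  simp only [cl_apply]; linarith

lemma meas_fderiv_apply (X : E2 → E2) (w : E2) : Measurable fun p => fderiv ℝ X p w :=
  measurable_fderiv_apply_const ℝ X w

lemma int_fderiv_apply (B : AffineBasis (Fin 3) ℝ E2) {X : E2 → E2}
    (hi : IntegrableOn (fun p => fderiv ℝ X p) (TT B)) (ℓ : E2 →L[ℝ] ℝ) (w : E2) :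
    IntegrableOn (fun p => ℓ (fderiv ℝ X p w)) (TT B) :=
  ℓ.integrable_comp (((ContinuousLinearMap.apply ℝ E2 w)).integrable_comp hi)

lemma divT (B : AffineBasis (Fin 3) ℝ E2) {X : E2 → E2} (hc : ContinuousOn X (TT B))
    (hd : ∀ p ∈ interior (TT B), DifferentiableAt ℝ X p)
    (hi : IntegrableOn (fun p => fderiv ℝ X p) (TT B))
    (hb : ∀ i, ∀ p ∈ TT B, B.coord i p = 0 → cl B i (X p) = 0) :
    ∫ p in TT B, dvg X p = 0 := by
  have hi1 := int_fderiv_apply B hi (-cl B 0) (B 1 - B 0)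
  have hi2 := int_fderiv_apply B hi (cl B 2) (B 2 - B 1)
  have e : ∀ p, dvg X p = (-cl B 0) (fderiv ℝ X p (B 1 - B 0)) + cl B 2 (fderiv ℝ X p (B 2 - B 1)) := by
    intro p; rw [dvg_B B]; rfl
  simp only [e]
  rw [integral_add hi1 hi2, cov, cov, ← mul_add]
  have j1 := (cov_int B _).1 hi1
  have j2 := (cov_int B _).1 hi2
  rw [T0_iter' j1, T0_iter j2]
  -- line integrability
  have k1 : ∀ᵐ y : ℝ, y ∈ Ioo (0 : ℝ) 1 → IntervalIntegrable
      (fun x => (-cl B 0) (fderiv ℝ X (AA B (x, y)) (B 1 - B 0))) volume y 1 := by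
    have := j1.integrable_indicator meas_T0
    rw [Measure.volume_eq_prod] at this
    filter_upwards [this.prod_left_ae] with y hy hy1
    rw [intervalIntegrable_iff_integrableOn_Icc_of_le hy1.2.le,
      ← integrable_indicator_iff measurableSet_Icc]
    refine hy.congr (Eventually.of_forall fun x => ?_)
    simp only [indicator, T0, mem_ofPred_eq, mem_Icc, hy1.1.le, true_and]
  have k2 : ∀ᵐ x : ℝ, x ∈ Ioo (0 : ℝ) 1 → IntervalIntegrable
      (fun y => (cl B 2) (fderiv ℝ X (AA B (x, y)) (B 2 - B 1))) volume 0 x := by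
    have := j2.integrable_indicator meas_T0
    rw [Measure.volume_eq_prod] at this
    filter_upwards [this.prod_right_ae] with x hx hx1
    rw [intervalIntegrable_iff_integrableOn_Icc_of_le hx1.1.le,
      ← integrable_indicator_iff measurableSet_Icc]
    refine hx.congr (Eventually.of_forall fun y => ?_)
    simp only [indicator, T0, mem_ofPred_eq, mem_Icc, hx1.2.le, and_true]
  have ae01 : ∀ᵐ y ∂(volume.restrict (Ioc (0 : ℝ) 1)), y ∈ Ioo (0 : ℝ) 1 := by
    rw [← restrict_Ioo_eq_restrict_Ioc]; exact ae_restrict_mem measurableSet_Ioo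
  have l1 : ∫ y in (0 : ℝ)..1, ∫ x in y..(1 : ℝ), (-cl B 0) (fderiv ℝ X (AA B (x, y)) (B 1 - B 0)) =
      ∫ y in (0 : ℝ)..1, - (-cl B 0) (X (AA B (y, y))) := by
    rw [intervalIntegral.integral_of_le zero_le_one, intervalIntegral.integral_of_le zero_le_one]
    apply integral_congr_ae
    filter_upwards [ae01, ae_restrict_of_ae k1] with y hy hk
    rw [intervalIntegral.integral_eq_sub_of_hasDerivAt_of_le hy.2.le
      (f := fun x => (-cl B 0) (X (AA B (x, y)))) _ _ (hk hy)]
    · have := hb 0 (AA B (1, y)) ((AA_mem B _).2 ⟨hy.1.le, hy.2.le, le_rfl⟩) (by simp [coord0_AA])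
      simp [this]
    · refine (-cl B 0).continuous.comp_continuousOn (hc.comp
        ((contAA B).comp (by fun_prop)).continuousOn ?_)
      intro x hx
      exact (AA_mem B _).2 ⟨hy.1.le, hx.1, hx.2⟩
    · intro x hx
      have hp : AA B (x, y) ∈ interior (TT B) := (AA_mem_int B _).2 ⟨hy.1, hx.1, hx.2⟩
      exact ((-cl B 0).hasFDerivAt.comp_hasDerivAt x
        ((hd _ hp).hasFDerivAt.comp_hasDerivAt x (hasDeriv_AA1 B x y)))
  have l2 : ∫ x in (0 : ℝ)..1, ∫ y in (0 : ℝ)..x, (cl B 2) (fderiv ℝ X (AA B (x, y)) (B 2 - B 1)) =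
      ∫ y in (0 : ℝ)..1, (cl B 2) (X (AA B (y, y))) := by
    rw [intervalIntegral.integral_of_le zero_le_one, intervalIntegral.integral_of_le zero_le_one]
    apply integral_congr_ae
    filter_upwards [ae01, ae_restrict_of_ae k2] with x hx hk
    rw [intervalIntegral.integral_eq_sub_of_hasDerivAt_of_le hx.1.le
      (f := fun y => (cl B 2) (X (AA B (x, y)))) _ _ (hk hx)]
    · have := hb 2 (AA B (x, 0)) ((AA_mem B _).2 ⟨le_rfl, hx.1.le, hx.2.le⟩) (by simp [coord2_AA])
      simp [this]
    · refine (cl B 2).continuous.comp_continuousOn (hc.comp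
        ((contAA B).comp (by fun_prop)).continuousOn ?_)
      intro y hy
      exact (AA_mem B _).2 ⟨hy.1, hy.2, hx.2.le⟩
    · intro y hy
      have hp : AA B (x, y) ∈ interior (TT B) := (AA_mem_int B _).2 ⟨hy.1, hy.2, hx.2⟩
      exact ((cl B 2).hasFDerivAt.comp_hasDerivAt y
        ((hd _ hp).hasFDerivAt.comp_hasDerivAt y (hasDeriv_AA2 B x y)))
  rw [l1, l2]
  have cD : ∀ ℓ : E2 →L[ℝ] ℝ, IntervalIntegrable (fun y => ℓ (X (AA B (y, y)))) volume 0 1 := by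
    intro ℓ
    apply ContinuousOn.intervalIntegrable
    rw [uIcc_of_le zero_le_one]
    refine ℓ.continuous.comp_continuousOn (hc.comp
        ((contAA B).comp (by fun_prop)).continuousOn ?_)
    intro y hy
    exact (AA_mem B _).2 ⟨hy.1, le_rfl, hy.2⟩
  have cD1 : IntervalIntegrable (fun y => -(-cl B 0) (X (AA B (y, y)))) volume 0 1 :=
    (cD (-cl B 0)).neg
  rw [← intervalIntegral.integral_add cD1 (cD (cl B 2))]
  have : ∫ y in (0 : ℝ)..1, (-(-cl B 0) (X (AA B (y, y))) + cl B 2 (X (AA B (y, y)))) =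
      ∫ y in (0 : ℝ)..1, (0 : ℝ) := by
    apply intervalIntegral.integral_congr
    intro y hy
    rw [uIcc_of_le zero_le_one] at hy
    have h := hb 1 (AA B (y, y)) ((AA_mem B _).2 ⟨hy.1, le_rfl, hy.2⟩) (by simp [coord1_AA])
    have h2 := cl_sum B (X (AA B (y, y)))
    simp only [neg_apply, neg_neg]
    linarith
  rw [this]; simp
end NT

namespace NT
open MeasureTheory Filter Topology

lemma lim_of_cauchy {H : Type*} [NormedAddCommGroup H] [CompleteSpace H] {f : ℕ → H} {l : Filter ℕ}
    [l.NeBot] (h : ∀ ε > 0, ∀ᶠ p in l ×ˢ l, ‖f p.1 - f p.2‖ ^ 2 < ε) : ∃ a, Tendsto f l (𝓝 a) := by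
  have : Cauchy (map f l) := by
    rw [cauchy_map_iff]
    refine ⟨inferInstance, ?_⟩
    rw [Metric.uniformity_basis_dist.tendsto_right_iff]
    intro ε hε
    filter_upwards [h (ε ^ 2) (by positivity)] with p hp
    simp only [mem_ofPred_eq, dist_eq_norm]
    exact lt_of_pow_lt_pow_left₀ 2 hε.le hp
  exact CompleteSpace.complete this

lemma quad_zero {a b : ℝ} (h : ∀ t : ℝ, 0 ≤ 2 * t * a + t ^ 2 * b) : a = 0 := by
  by_contra ha
  set c := |b| + 1 with hc
  have hcpos : 0 < c := by positivity
  have h1 := h (-a / c)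
  have hb : b ≤ c - 1 := by rw [hc]; linarith [le_abs_self b]
  have hsq : 0 < a ^ 2 := by positivity
  have h2 : (2 * (-a / c) * a + (-a / c) ^ 2 * b) * c ^ 2 = a ^ 2 * (b - 2 * c) := by
    field_simp; ring
  have h3 : 0 ≤ a ^ 2 * (b - 2 * c) := by rw [← h2]; positivity
  nlinarith

theorem fa {V H K : Type*} [AddCommGroup V] [Module ℝ V] [NormedAddCommGroup H]
    [InnerProductSpace ℝ H] [CompleteSpace H] [NormedAddCommGroup K]
    [InnerProductSpace ℝ K] [CompleteSpace K] (J : V →ₗ[ℝ] H) (D : V →ₗ[ℝ] K)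
    (hex : ∃ v, J v ≠ 0)
    (hcomp : ∀ ε > 0, ∃ (ι : Type) (_ : Fintype ι) (ℓ : ι → V →ₗ[ℝ] ℝ) (C : ℝ),
      (∀ j v, |ℓ j v| ≤ C * ‖J v‖) ∧ ∀ v, ‖J v‖ ^ 2 ≤ ε * ‖D v‖ ^ 2 + ∑ j, (ℓ j v) ^ 2) :
    ∃ (m : ℝ) (v : ℕ → V) (l : Filter ℕ) (u : H) (g : K), l.NeBot ∧
      Tendsto (fun n => J (v n)) l (𝓝 u) ∧ Tendsto (fun n => D (v n)) l (𝓝 g) ∧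
      ‖u‖ = 1 ∧ ‖g‖ ^ 2 = m ∧ (∀ w, m * ‖J w‖ ^ 2 ≤ ‖D w‖ ^ 2) ∧
      ∀ w, inner ℝ g (D w) = m * inner ℝ u (J w) := by
  set R : Set ℝ := {r | ∃ v, ‖J v‖ = 1 ∧ r = ‖D v‖ ^ 2} with hR
  have hscale : ∀ w, J w ≠ 0 → ‖J ((‖J w‖)⁻¹ • w)‖ = 1 := by
    intro w hw
    rw [map_smul, norm_smul, norm_inv, norm_norm, inv_mul_cancel₀ (norm_ne_zero_iff.2 hw)]
  have hne : R.Nonempty := by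
    obtain ⟨v, hv⟩ := hex
    exact ⟨_, (‖J v‖)⁻¹ • v, hscale v hv, rfl⟩
  have hbdd : BddBelow R := ⟨0, by rintro r ⟨v, -, rfl⟩; positivity⟩
  set m := sInf R with hm
  have hlow : ∀ w, m * ‖J w‖ ^ 2 ≤ ‖D w‖ ^ 2 := by
    intro w
    by_cases hw : J w = 0
    · simp only [hw, norm_zero]; nlinarith [sq_nonneg ‖D w‖]
    have h1 : m ≤ ‖D ((‖J w‖)⁻¹ • w)‖ ^ 2 := csInf_le hbdd ⟨_, hscale w hw, rfl⟩
    rw [map_smul, norm_smul, norm_inv, norm_norm, mul_pow] at h1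
    have hp : 0 < ‖J w‖ ^ 2 := by positivity
    calc m * ‖J w‖ ^ 2 ≤ ((‖J w‖)⁻¹ ^ 2 * ‖D w‖ ^ 2) * ‖J w‖ ^ 2 := by gcongr
      _ = _ := by have := norm_ne_zero_iff.2 hw; field_simp
  have hmin : ∀ n : ℕ, ∃ v, ‖J v‖ = 1 ∧ ‖D v‖ ^ 2 < m + 1 / (n + 1) := by
    intro n
    obtain ⟨r, ⟨v, hv, rfl⟩, hr⟩ := exists_lt_of_csInf_lt hne
      (show sInf R < m + 1 / ((n : ℝ) + 1) by rw [← hm]; linarith [Nat.one_div_pos_of_nat (α := ℝ) (n := n)])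
    exact ⟨v, hv, hr⟩
  choose v hv1 hv2 using hmin
  have hm0 : 0 ≤ m := le_csInf hne (by rintro r ⟨v, -, rfl⟩; positivity)
  set l : Filter ℕ := (hyperfilter ℕ : Filter ℕ) with hl
  have hle : l ≤ atTop := by
    rw [← Nat.cofinite_eq_atTop]; exact hyperfilter_le_cofinite
  have hpar : ∀ n k, ‖D (v n) - D (v k)‖ ^ 2 ≤ 2 * (m + 1 / (n + 1)) + 2 * (m + 1 / (k + 1)) -
      m * ‖J (v n + v k)‖ ^ 2 := by
    intro n k
    have h1 := parallelogram_law_with_norm ℝ (D (v n)) (D (v k))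
    have h2 := hlow (v n + v k)
    rw [map_add D] at h2
    nlinarith [hv2 n, hv2 k]
  have hparJ : ∀ n k, ‖J (v n + v k)‖ ^ 2 = 4 - ‖J (v n) - J (v k)‖ ^ 2 := by
    intro n k
    have h1 := parallelogram_law_with_norm ℝ (J (v n)) (J (v k))
    rw [hv1, hv1] at h1
    rw [map_add]; nlinarith
  have hone : ∀ n : ℕ, (1 : ℝ) / (n + 1) ≤ 1 := by
    intro n; rw [div_le_one (by positivity)]; linarith [Nat.cast_nonneg (α := ℝ) n]
  have hDb : ∀ n k, ‖D (v n) - D (v k)‖ ^ 2 ≤ 4 * (m + 1) := by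
    intro n k
    have := hpar n k
    have h3 : 0 ≤ m * ‖J (v n + v k)‖ ^ 2 := by positivity
    linarith [hone n, hone k]
  obtain ⟨u, hu⟩ : ∃ u, Tendsto (fun n => J (v n)) l (𝓝 u) := by
    apply lim_of_cauchy
    intro ε hε
    obtain ⟨ι, hι, ℓ, C, hC, hJ⟩ := hcomp (ε / 2 / (4 * (m + 1))) (by positivity)
    have hlim : ∀ j, ∃ a, Tendsto (fun n => ℓ j (v n)) l (𝓝 a) := by
      intro j
      have hin : ∀ n, ℓ j (v n) ∈ Icc (-C) C := by
        intro n; have := hC j (v n); rw [hv1, mul_one] at this; exact abs_le.1 this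
      obtain ⟨a, -, ha⟩ := (isCompact_Icc (a := -C) (b := C)).ultrafilter_le_nhds
        ((hyperfilter ℕ).map (fun n => ℓ j (v n)))
        (by simp only [le_principal_iff, Ultrafilter.mem_coe, Ultrafilter.mem_map]
            exact univ_mem' hin)
      exact ⟨a, ha⟩
    choose a ha using hlim
    have hsum : Tendsto (fun p : ℕ × ℕ => ∑ j, (ℓ j (v p.1) - ℓ j (v p.2)) ^ 2) (l ×ˢ l) (𝓝 0) := by
      have : Tendsto (fun p : ℕ × ℕ => ∑ j, (ℓ j (v p.1) - ℓ j (v p.2)) ^ 2) (l ×ˢ l)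
          (𝓝 (∑ j, (a j - a j) ^ 2)) := by
        apply tendsto_finsetSum
        intro j _
        exact (((ha j).comp tendsto_fst).sub ((ha j).comp tendsto_snd)).pow 2
      simpa using this
    filter_upwards [hsum.eventually (gt_mem_nhds (half_pos hε))] with p hp
    have h1 := hJ (v p.1 - v p.2)
    simp only [map_sub] at h1
    have h2 : ε / 2 / (4 * (m + 1)) * ‖D (v p.1) - D (v p.2)‖ ^ 2 ≤ ε / 2 := by
      calc _ ≤ ε / 2 / (4 * (m + 1)) * (4 * (m + 1)) := by gcongr; exact hDb _ _
        _ = ε / 2 := by field_simp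
    linarith
  have hn1 : Tendsto (fun n : ℕ => (1 : ℝ) / (n + 1)) l (𝓝 0) :=
    tendsto_one_div_add_atTop_nhds_zero_nat.mono_left hle
  obtain ⟨g, hg⟩ : ∃ g, Tendsto (fun n => D (v n)) l (𝓝 g) := by
    apply lim_of_cauchy
    intro ε hε
    have h1 : Tendsto (fun p : ℕ × ℕ => 2 * (m + 1 / ((p.1 : ℝ) + 1)) + 2 * (m + 1 / ((p.2 : ℝ) + 1)) -
      m * (4 - ‖J (v p.1) - J (v p.2)‖ ^ 2)) (l ×ˢ l)
      (𝓝 (2 * (m + 0) + 2 * (m + 0) - m * (4 - ‖u - u‖ ^ 2))) := by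
      refine Tendsto.sub (Tendsto.add ?_ ?_) ?_
      · exact ((hn1.comp tendsto_fst).const_add m).const_mul 2
      · exact ((hn1.comp tendsto_snd).const_add m).const_mul 2
      · exact ((((hu.comp tendsto_fst).sub (hu.comp tendsto_snd)).norm.pow 2).const_sub 4).const_mul m
    have h2 : 2 * (m + 0) + 2 * (m + 0) - m * (4 - ‖u - u‖ ^ 2) < ε := by
      simp; linarith
    filter_upwards [h1.eventually (gt_mem_nhds h2)] with p hp
    have := hpar p.1 p.2
    rw [hparJ] at this
    exact this.trans_lt hp
  have hu1 : ‖u‖ = 1 := by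
    refine tendsto_nhds_unique hu.norm ?_
    simp [hv1]
  have hgm : ‖g‖ ^ 2 = m := by
    apply le_antisymm
    · have h1 : Tendsto (fun n : ℕ => m + 1 / ((n : ℝ) + 1)) l (𝓝 (m + 0)) := hn1.const_add m
      rw [add_zero] at h1
      exact le_of_tendsto_of_tendsto' (hg.norm.pow 2) h1 (fun n => (hv2 n).le)
    · refine ge_of_tendsto' (hg.norm.pow 2) (fun n => ?_)
      have := hlow (v n)
      rw [hv1] at this; linarith
  refine ⟨m, v, l, u, g, inferInstance, hu, hg, hu1, hgm, hlow, fun w => ?_⟩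
  have key : ∀ t : ℝ, m * ‖u + t • J w‖ ^ 2 ≤ ‖g + t • D w‖ ^ 2 := by
    intro t
    have h1 := ((hu.add_const (t • J w)).norm.pow 2).const_mul m
    have h2 := (hg.add_const (t • D w)).norm.pow 2
    refine le_of_tendsto_of_tendsto' h1 h2 (fun n => ?_)
    have := hlow (v n + t • w)
    simpa using this
  have := quad_zero (a := inner ℝ g (D w) - m * inner ℝ u (J w)) (b := ‖D w‖ ^ 2 - m * ‖J w‖ ^ 2) ?_
  · linarith
  intro t
  have h := key t
  rw [norm_add_sq_real, norm_add_sq_real, inner_smul_right, inner_smul_right, norm_smul, norm_smul,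
    hu1, hgm, mul_pow, mul_pow, Real.norm_eq_abs, sq_abs] at h
  nlinarith
end NT

namespace NT
open MeasureTheory Filter Topology

/-- gradient -/
def gr (f : E2 → ℝ) (p : E2) : E2 := (InnerProductSpace.toDual ℝ E2).symm (fderiv ℝ f p)

lemma gr_inner (f : E2 → ℝ) (p w : E2) : inner ℝ (gr f p) w = fderiv ℝ f p w :=
  InnerProductSpace.toDual_symm_apply

lemma gr_norm (f : E2 → ℝ) (p : E2) : ‖gr f p‖ = ‖fderiv ℝ f p‖ := by
  simp [gr]

lemma gr_cont {f : E2 → ℝ} (hf : ContDiff ℝ 1 f) : Continuous (gr f) :=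
  (InnerProductSpace.toDual ℝ E2).symm.continuous.comp (hf.continuous_fderiv one_ne_zero)

abbrev μT (B : AffineBasis (Fin 3) ℝ E2) : Measure E2 := volume.restrict (TT B)

lemma cont_memLp (B : AffineBasis (Fin 3) ℝ E2) {F : Type*} [NormedAddCommGroup F]
    [SecondCountableTopology F] {f : E2 → F} (hf : Continuous f) : MemLp f 2 (μT B) := by
  obtain ⟨C, hC⟩ := (isCompact_TT B).exists_bound_of_continuousOn hf.continuousOn
  refine MemLp.of_bound (hf.aestronglyMeasurable) C ?_
  filter_upwards [ae_restrict_mem (meas_TT B)] with x hx using hC x hx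

/-- trial space -/
def VV (B : AffineBasis (Fin 3) ℝ E2) : Submodule ℝ (E2 → ℝ) where
  carrier := {f | ContDiff ℝ 1 f ∧ ∫ p in TT B, f p = 0}
  add_mem' := by
    rintro f g ⟨hf, hf0⟩ ⟨hg, hg0⟩
    refine ⟨hf.add hg, ?_⟩
    have h1 : IntegrableOn f (TT B) := hf.continuous.continuousOn.integrableOn_compact (isCompact_TT B)
    have h2 : IntegrableOn g (TT B) := hg.continuous.continuousOn.integrableOn_compact (isCompact_TT B)
    have := integral_add h1 h2
    simp only [Pi.add_apply]
    rw [this, hf0, hg0, add_zero]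
  zero_mem' := ⟨contDiff_const, by simp⟩
  smul_mem' := by
    rintro c f ⟨hf, hf0⟩
    refine ⟨hf.const_smul c, ?_⟩
    simp only [Pi.smul_apply, smul_eq_mul, integral_const_mul, hf0, mul_zero]

def J1 (B : AffineBasis (Fin 3) ℝ E2) : VV B →ₗ[ℝ] Lp ℝ 2 (μT B) where
  toFun f := (cont_memLp B f.2.1.continuous).toLp _
  map_add' _ _ := rfl
  map_smul' _ _ := rfl

lemma gr_add {f g : E2 → ℝ} (hf : ContDiff ℝ 1 f) (hg : ContDiff ℝ 1 g) :
    gr (f + g) = gr f + gr g := by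
  ext1 p
  simp only [gr, Pi.add_apply]
  rw [← map_add, fderiv_add (hf.differentiable one_ne_zero p) (hg.differentiable one_ne_zero p)]

lemma gr_smul {f : E2 → ℝ} (hf : ContDiff ℝ 1 f) (c : ℝ) : gr (c • f) = c • gr f := by
  ext1 p
  simp only [gr, Pi.smul_apply]
  rw [fderiv_const_smul (hf.differentiable one_ne_zero p)]
  simp

def D1 (B : AffineBasis (Fin 3) ℝ E2) : VV B →ₗ[ℝ] Lp E2 2 (μT B) where
  toFun f := (cont_memLp B (gr_cont f.2.1)).toLp _
  map_add' f g := by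
    rw [← MemLp.toLp_add]
    apply MemLp.toLp_congr
    exact Eventually.of_forall fun p => congrFun (gr_add f.2.1 g.2.1) p
  map_smul' c f := by
    rw [RingHom.id_apply, ← MemLp.toLp_const_smul]
    apply MemLp.toLp_congr
    exact Eventually.of_forall fun p => congrFun (gr_smul f.2.1 c) p

lemma inner_toLp {B : AffineBasis (Fin 3) ℝ E2} {F : Type*} [NormedAddCommGroup F]
    [InnerProductSpace ℝ F] {f : E2 → F} (g : Lp F 2 (μT B)) (hf : MemLp f 2 (μT B)) :
    inner ℝ g (hf.toLp f) = ∫ p in TT B, inner ℝ (g p) (f p) := by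
  rw [L2.inner_def]
  apply integral_congr_ae
  filter_upwards [hf.coeFn_toLp] with p hp
  rw [hp]

lemma inner_toLp' {B : AffineBasis (Fin 3) ℝ E2} {F : Type*} [NormedAddCommGroup F]
    [InnerProductSpace ℝ F] {f g : E2 → F} (hg : MemLp g 2 (μT B)) (hf : MemLp f 2 (μT B)) :
    inner ℝ (hg.toLp g) (hf.toLp f) = ∫ p in TT B, inner ℝ (g p) (f p) := by
  rw [inner_toLp]
  apply integral_congr_ae
  filter_upwards [hg.coeFn_toLp] with p hp
  rw [hp]

lemma norm_J1 (B : AffineBasis (Fin 3) ℝ E2) (f : VV B) :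
    ‖J1 B f‖ ^ 2 = ∫ p in TT B, (f : E2 → ℝ) p ^ 2 := by
  rw [← real_inner_self_eq_norm_sq]
  refine (inner_toLp' (cont_memLp B f.2.1.continuous) (cont_memLp B f.2.1.continuous)).trans ?_
  simp [pow_two]

lemma norm_D1 (B : AffineBasis (Fin 3) ℝ E2) (f : VV B) :
    ‖D1 B f‖ ^ 2 = ∫ p in TT B, ‖fderiv ℝ (f : E2 → ℝ) p‖ ^ 2 := by
  rw [← real_inner_self_eq_norm_sq]
  refine (inner_toLp' (cont_memLp B (gr_cont f.2.1)) (cont_memLp B (gr_cont f.2.1))).trans ?_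
  simp only [real_inner_self_eq_norm_sq, gr_norm]

lemma grad_int (B : AffineBasis (Fin 3) ℝ E2) {f : E2 → ℝ} (hf : ContDiff ℝ 1 f) :
    IntegrableOn (fun p => ‖fderiv ℝ f p‖ ^ 2) (TT B) :=
  (((hf.continuous_fderiv one_ne_zero).norm.pow 2).continuousOn).integrableOn_compact (isCompact_TT B)

def ellV (B : AffineBasis (Fin 3) ℝ E2) (N : ℕ) (i : idx N) : VV B →ₗ[ℝ] ℝ where
  toFun f := ell B N i f
  map_add' f g := ell_add B i.2 f.2.1.continuous.continuousOn g.2.1.continuous.continuousOn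
  map_smul' c f := ell_smul B c f

/-- weak solution data -/
structure Weak (B : AffineBasis (Fin 3) ℝ E2) (m : ℝ) (u : E2 → ℝ) (g : E2 → E2) : Prop where
  um : StronglyMeasurable u
  gm : StronglyMeasurable g
  u2 : MemLp u 2 (μT B)
  g2 : MemLp g 2 (μT B)
  nrm : ∫ p in TT B, u p ^ 2 = 1
  mean : ∫ p in TT B, u p = 0
  el : ∀ w : E2 → ℝ, ContDiff ℝ 1 w → ∫ p in TT B, inner ℝ (g p) (gr w p) = m * ∫ p in TT B, u p * w p
  wg : ∀ X : E2 → E2, ContDiff ℝ 1 X → (∀ i, ∀ p ∈ TT B, B.coord i p = 0 → cl B i (X p) = 0) →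
    ∫ p in TT B, u p * dvg X p = - ∫ p in TT B, inner ℝ (g p) (X p)

lemma dvg_cont {X : E2 → E2} (hX : ContDiff ℝ 1 X) : Continuous (dvg X) := by
  have h := hX.continuous_fderiv one_ne_zero
  have e : ∀ i : Fin 2, Continuous fun p => (fderiv ℝ X p (ee i)) i := fun i =>
    (EuclideanSpace.proj i : E2 →L[ℝ] ℝ).continuous.comp (h.clm_apply continuous_const)
  exact (e 0).add (e 1)

lemma inner_ee (v w : E2) : inner ℝ v w = v 0 * w 0 + v 1 * w 1 := by
  simp [PiLp.inner_apply, Fin.sum_univ_two, mul_comm]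

lemma ee_decomp (v : E2) : v = v 0 • ee 0 + v 1 • ee 1 := by
  ext i; fin_cases i <;> simp [ee]

lemma fderiv_ee (L : E2 →L[ℝ] ℝ) (v : E2) : L v = v 0 * L (ee 0) + v 1 * L (ee 1) := by
  conv_lhs => rw [ee_decomp v]
  simp

/-- product rule at a point -/
lemma dvg_smul {f : E2 → ℝ} {X : E2 → E2} {p : E2} (hf : DifferentiableAt ℝ f p)
    (hX : DifferentiableAt ℝ X p) :
    dvg (fun q => f q • X q) p = f p * dvg X p + fderiv ℝ f p (X p) := by
  have h := (hf.hasFDerivAt.smul hX.hasFDerivAt).fderiv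
  have h' : fderiv ℝ (fun q => f q • X q) p = f p • fderiv ℝ X p +
    (fderiv ℝ f p).smulRight (X p) := h
  rw [dvg, h', fderiv_ee (fderiv ℝ f p) (X p), dvg]
  simp
  ring

lemma green (B : AffineBasis (Fin 3) ℝ E2) {f : E2 → ℝ} {X : E2 → E2} (hf : ContDiff ℝ 1 f)
    (hX : ContDiff ℝ 1 X) (hb : ∀ i, ∀ p ∈ TT B, B.coord i p = 0 → cl B i (X p) = 0) :
    ∫ p in TT B, f p * dvg X p = - ∫ p in TT B, inner ℝ (gr f p) (X p) := by
  have hfX : ContDiff ℝ 1 (fun q => f q • X q) := hf.smul hX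
  have h := divT B (X := fun q => f q • X q) hfX.continuous.continuousOn
    (fun p _ => hfX.differentiable one_ne_zero p)
    ((hfX.continuous_fderiv one_ne_zero).continuousOn.integrableOn_compact (isCompact_TT B))
    (fun i p hp h0 => by simp [hb i p hp h0])
  have e : ∀ p, dvg (fun q => f q • X q) p = f p * dvg X p + inner ℝ (gr f p) (X p) := by
    intro p
    rw [gr_inner, dvg_smul (hf.differentiable one_ne_zero p) (hX.differentiable one_ne_zero p)]
  simp only [e] at h
  rw [integral_add] at h
  · linarith
  · exact ((hf.continuous.mul (dvg_cont hX)).continuousOn).integrableOn_compact (isCompact_TT B)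
  · exact (((gr_cont hf).inner hX.continuous).continuousOn).integrableOn_compact (isCompact_TT B)

theorem exists_weak (B : AffineBasis (Fin 3) ℝ E2) {Λ : ℝ} (hpos : 0 < Λ)
    (hΛ : ∀ L : E2 →L[ℝ] ℝ, L (B 1 - B 0) ^ 2 + L (B 2 - B 1) ^ 2 ≤ Λ * ‖L‖ ^ 2)
    (hL : ∃ L : E2 →L[ℝ] ℝ, ‖L‖ = 1 ∧ L (B 1 - B 0) ^ 2 + L (B 2 - B 1) ^ 2 = Λ) :
    ∃ m u g, 0 < m ∧ m ≤ 36 / Λ ∧ Weak B m u g := by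
  obtain ⟨L, hL1, hL2⟩ := hL
  obtain ⟨c, hc1, hc2, hc3⟩ := trial B L
  rw [hL2] at hc3
  rw [hL1] at hc2
  have hJ := JJ_pos B
  set t : VV B := ⟨fun p => L p - c, L.contDiff.sub contDiff_const, hc1⟩ with ht
  have htn : JJ B / 72 * Λ ≤ ‖J1 B t‖ ^ 2 := by rw [norm_J1]; exact hc3
  have hJt : J1 B t ≠ 0 := by
    intro h
    rw [h, norm_zero] at htn
    have : 0 < JJ B / 72 * Λ := by positivity
    norm_num at htn; linarith
  obtain ⟨m, v, l, u, g, hl, hu, hg, hu1, hgm, hlow, hel⟩ := fa (J1 B) (D1 B) ⟨t, hJt⟩ (by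
    intro ε hε
    obtain ⟨N, hN⟩ := exists_nat_gt (Λ / ε)
    have hN0 : (0 : ℝ) < N := (div_pos hpos hε).trans hN
    have hN1 : 1 ≤ (N : ℝ) := by
      have : 0 < N := by exact_mod_cast hN0
      exact_mod_cast this
    refine ⟨idx N, inferInstance, fun i => (Real.sqrt (JJ B / 2 * N ^ 2)) • ellV B N i,
      Real.sqrt (JJ B / 2 * N ^ 2) * Real.sqrt (2 / JJ B), ?_, ?_⟩
    · intro i f
      rw [LinearMap.smul_apply, smul_eq_mul, abs_mul, abs_of_nonneg (Real.sqrt_nonneg _), mul_assoc]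
      refine mul_le_mul_of_nonneg_left ?_ (Real.sqrt_nonneg _)
      apply abs_le_of_sq_le_sq _ (by positivity)
      rw [mul_pow, Real.sq_sqrt (by positivity), norm_J1]
      exact ell_bound B i.2 f.2.1.continuous.continuousOn
    · intro f
      have h := sq_le_energy B hΛ f.2.1.continuous.continuousOn
        (fun p _ => f.2.1.differentiable one_ne_zero p) (grad_int B f.2.1) (N := N)
        (by exact_mod_cast hN0)
      rw [norm_J1, norm_D1]
      refine h.trans (add_le_add ?_ ?_)
      · refine mul_le_mul_of_nonneg_right ?_ (integral_nonneg fun p => by positivity)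
        rw [div_le_iff₀ (by positivity)]
        rw [div_lt_iff₀ hε] at hN
        nlinarith [mul_pos hN0 hε]
      · simp only [LinearMap.smul_apply, smul_eq_mul, mul_pow]
        rw [← Finset.mul_sum, Real.sq_sqrt (by positivity)]
        apply le_of_eq
        congr 1
        exact (Finset.sum_coe_sort (idx N) (fun i => ell B N i (f : E2 → ℝ) ^ 2)).symm)
  have hcv : ∀ φ : E2 → ℝ, Continuous φ → Tendsto (fun n => ∫ p in TT B, (v n : E2 → ℝ) p * φ p) l
      (𝓝 (∫ p in TT B, u p * φ p)) := by
    intro φ hφ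
    have h := hu.inner (𝕜 := ℝ) (tendsto_const_nhds (x := (cont_memLp B hφ).toLp φ))
    rw [inner_toLp] at h
    have e : ∀ n, inner ℝ (J1 B (v n)) ((cont_memLp B hφ).toLp φ) =
      ∫ p in TT B, inner ℝ ((v n : E2 → ℝ) p) (φ p) := fun n => inner_toLp' (cont_memLp B (v n).2.1.continuous) (cont_memLp B hφ)
    simp only [e] at h
    simpa [mul_comm] using h
  have hcg : ∀ X : E2 → E2, Continuous X → Tendsto
      (fun n => ∫ p in TT B, inner ℝ (gr (v n : E2 → ℝ) p) (X p)) l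
      (𝓝 (∫ p in TT B, inner ℝ (g p) (X p))) := by
    intro φ hφ
    have h := hg.inner (𝕜 := ℝ) (tendsto_const_nhds (x := (cont_memLp B hφ).toLp φ))
    rw [inner_toLp] at h
    have e : ∀ n, inner ℝ (D1 B (v n)) ((cont_memLp B hφ).toLp φ) =
      ∫ p in TT B, inner ℝ (gr (v n : E2 → ℝ) p) (φ p) := fun n => inner_toLp' (cont_memLp B (gr_cont (v n).2.1)) (cont_memLp B hφ)
    simp only [e] at h
    exact h
  have hmean : ∫ p in TT B, u p = 0 := by
    have h1 := hcv (fun _ => 1) continuous_const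
    have h2 : ∀ n, ∫ p in TT B, (v n : E2 → ℝ) p = 0 := fun n => (v n).2.2
    simp only [mul_one, h2] at h1
    exact tendsto_nhds_unique h1 tendsto_const_nhds
  have humem := Lp.memLp u
  have huint : Integrable u (μT B) := humem.integrable (by norm_num)
  refine ⟨m, u, g, ?_, ?_, ?_⟩
  · have hlb : ∀ n, 961 / 100 / Λ * ‖J1 B (v n)‖ ^ 2 ≤ ‖D1 B (v n)‖ ^ 2 := by
      intro n
      rw [norm_J1, norm_D1]
      have := poincN B hΛ (v n).2.1.continuous.continuousOn
        (fun p _ => (v n).2.1.differentiable one_ne_zero p) (grad_int B (v n).2.1) (v n).2.2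
      rw [div_mul_eq_mul_div, div_le_iff₀ hpos]; linarith
    have := le_of_tendsto_of_tendsto' ((hu.norm.pow 2).const_mul (961 / 100 / Λ))
      (hg.norm.pow 2) hlb
    rw [hu1, hgm] at this
    have h2 : 0 < 961 / 100 / Λ * (1 : ℝ) ^ 2 := by positivity
    linarith
  · have h1 := hlow t
    have h3 : ‖D1 B t‖ ^ 2 = JJ B / 2 * 1 ^ 2 := by rw [norm_D1]; exact hc2
    rw [h3] at h1
    rw [le_div_iff₀ hpos]
    have hm0 : 0 ≤ m := by rw [← hgm]; positivity
    have h4 := mul_le_mul_of_nonneg_left htn hm0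
    have h5 : JJ B * (m * Λ) ≤ JJ B * 36 := by nlinarith
    exact le_of_mul_le_mul_left h5 hJ
  · refine ⟨Lp.stronglyMeasurable u, Lp.stronglyMeasurable g, humem, Lp.memLp g, ?_, hmean, ?_, ?_⟩
    · have h := real_inner_self_eq_norm_sq u
      rw [hu1, L2.inner_def] at h
      simpa [pow_two] using h
    · intro w hw
      set a : ℝ := (∫ p in TT B, w p) / (volume.real (TT B)) with ha
      have hvol : 0 < volume.real (TT B) := by
        have h := cov B (fun _ => (1 : ℝ))
        rw [T0_one] at h
        rw [setIntegral_const] at h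
        simp only [smul_eq_mul, mul_one] at h
        rw [h]; positivity
      have hwint : IntegrableOn w (TT B) :=
        hw.continuous.continuousOn.integrableOn_compact (isCompact_TT B)
      have hw' : ContDiff ℝ 1 (fun p => w p - a) := hw.sub contDiff_const
      have h0 : ∫ p in TT B, (w p - a) = 0 := by
        rw [integral_sub hwint (integrable_const _), setIntegral_const, smul_eq_mul, ha]
        field_simp; ring
      have hgr : ∀ p, gr (fun p => w p - a) p = gr w p := by
        intro p; simp only [gr]; rw [fderiv_sub_const]
      have h := hel ⟨fun p => w p - a, hw', h0⟩
      have e1 : inner ℝ g (D1 B ⟨fun p => w p - a, hw', h0⟩) =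
        ∫ p in TT B, inner ℝ (g p) (gr (fun p => w p - a) p) := inner_toLp g (cont_memLp B (gr_cont hw'))
      have e2 : inner ℝ u (J1 B ⟨fun p => w p - a, hw', h0⟩) =
        ∫ p in TT B, inner ℝ (u p) (w p - a) := inner_toLp u (cont_memLp B hw'.continuous)
      rw [e1, e2] at h
      simp only [hgr] at h
      rw [h]
      congr 1
      have e3 : ∀ p, inner ℝ (u p) (w p - a) = u p * w p - a * u p := by
        intro p; simp; ring
      simp only [e3]
      rw [integral_sub _ (huint.const_mul a), integral_const_mul, hmean, mul_zero, sub_zero]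
      exact humem.integrable_mul (cont_memLp B hw.continuous)
    · intro X hX hb
      have h1 := hcv (dvg X) (dvg_cont hX)
      have h2 := (hcg X hX.continuous).neg
      have e : ∀ n, ∫ p in TT B, (v n : E2 → ℝ) p * dvg X p =
        -∫ p in TT B, inner ℝ (gr (v n : E2 → ℝ) p) (X p) := fun n => green B (v n).2.1 hX hb
      simp only [e] at h1
      exact tendsto_nhds_unique h1 h2
end NT

namespace NT
open MeasureTheory Filter Topology

/-- unit circle -/
def ec (θ : ℝ) : E2 := Real.cos θ • ee 0 + Real.sin θ • ee 1
def ec' (θ : ℝ) : E2 := (-Real.sin θ) • ee 0 + Real.cos θ • ee 1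

lemma ec_deriv (θ : ℝ) : HasDerivAt ec (ec' θ) θ :=
  ((Real.hasDerivAt_cos θ).smul_const (ee 0)).add ((Real.hasDerivAt_sin θ).smul_const (ee 1))

lemma ec'_deriv (θ : ℝ) : HasDerivAt ec' (-ec θ) θ := by
  refine (((Real.hasDerivAt_sin θ).neg.smul_const (ee 0)).add
    ((Real.hasDerivAt_cos θ).smul_const (ee 1))).congr_deriv ?_
  simp only [ec, neg_add, neg_smul]

lemma ec_cont : Continuous ec := continuous_iff_continuousAt.2 fun θ => (ec_deriv θ).continuousAt
lemma ec'_cont : Continuous ec' := continuous_iff_continuousAt.2 fun θ => (ec'_deriv θ).continuousAt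

lemma ec_norm (θ : ℝ) : ‖ec θ‖ = 1 := by
  rw [EuclideanSpace.norm_eq, Fin.sum_univ_two]
  simp [ec, ee]

lemma polarE2 (f : E2 → ℝ) :
    ∫ p in polarCoord.target, p.1 * f (p.1 • ec p.2) = ∫ y, f y := by
  have h := Complex.orthonormalBasisOneI.repr.measurePreserving.integral_comp
    Complex.orthonormalBasisOneI.repr.toHomeomorph.measurableEmbedding f
  rw [← h, ← Complex.integral_comp_polarCoord_symm]
  refine integral_congr_ae (Eventually.of_forall fun p => ?_)
  simp only [smul_eq_mul]
  congr 2
  ext i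
  fin_cases i <;> simp [ec, ee, Complex.cos_ofReal_re, Complex.sin_ofReal_re]

lemma deriv_under {F F' : ℝ → ℝ → ℝ} (hF : ∀ r, Continuous (F r))
    (hF' : Continuous fun q : ℝ × ℝ => F' q.1 q.2)
    (hd : ∀ r θ, HasDerivAt (fun s => F s θ) (F' r θ) r) (a b r : ℝ) :
    HasDerivAt (fun s => ∫ θ in a..b, F s θ) (∫ θ in a..b, F' r θ) r := by
  obtain ⟨C, hC⟩ := ((isCompact_Icc (a := r - 1) (b := r + 1)).prod (isCompact_uIcc (a := a) (b := b))).exists_bound_of_continuousOn hF'.continuousOn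
  refine (intervalIntegral.hasDerivAt_integral_of_dominated_loc_of_deriv_le (F := F) (F' := F')
    (s := Icc (r - 1) (r + 1)) (bound := fun _ => C)
    (Icc_mem_nhds (by linarith) (by linarith)) ?_ ?_ ?_ ?_ ?_ ?_).2
  · exact Eventually.of_forall fun s => (hF s).aestronglyMeasurable
  · exact (hF r).intervalIntegrable _ _
  · exact (hF'.comp (continuous_const.prodMk continuous_id)).aestronglyMeasurable
  · refine Eventually.of_forall fun t ht s hs => hC (s, t) ⟨hs, uIoc_subset_uIcc ht⟩
  · exact intervalIntegrable_const
  · exact Eventually.of_forall fun t ht s hs => hd s t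

/-- Laplacian -/
def lap (v : E2 → ℝ) (p : E2) : ℝ := mixedDeriv v p (ee 0) (ee 0) + mixedDeriv v p (ee 1) (ee 1)

lemma mixed_eq {v : E2 → ℝ} {p : E2} (h : DifferentiableAt ℝ (fderiv ℝ v) p) (a b : E2) :
    mixedDeriv v p a b = fderiv ℝ (fderiv ℝ v) p b a := by
  unfold mixedDeriv
  rw [(h.hasFDerivAt.clm_apply (hasFDerivAt_const a p)).fderiv]
  simp

lemma circle_zero {v : E2 → ℝ} (hv : ContDiff ℝ 2 v) {m ρ : ℝ} (hm : 0 < m) {p : E2}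
    (h : ∀ q ∈ Metric.ball p ρ, lap v q = - m * v q) (h0 : v p = 0) {r : ℝ} (hr0 : 0 ≤ r)
    (hr : r < ρ) : ∫ θ in (-Real.pi)..Real.pi, v (p + r • ec θ) = 0 := by
  have hD : ContDiff ℝ 1 (fderiv ℝ v) := hv.fderiv_right (by norm_num)
  have hDd : Differentiable ℝ (fderiv ℝ v) := hD.differentiable one_ne_zero
  have hvd : Differentiable ℝ v := hv.differentiable two_ne_zero
  have hH : Continuous (fderiv ℝ (fderiv ℝ v)) := hD.continuous_fderiv one_ne_zero
  set M : ℝ → ℝ := fun r => ∫ θ in (-Real.pi)..Real.pi, v (p + r • ec θ) with hM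
  set M1 : ℝ → ℝ := fun r => ∫ θ in (-Real.pi)..Real.pi, fderiv ℝ v (p + r • ec θ) (ec θ) with hM1
  set M2 : ℝ → ℝ := fun r => ∫ θ in (-Real.pi)..Real.pi,
    fderiv ℝ (fderiv ℝ v) (p + r • ec θ) (ec θ) (ec θ) with hM2
  have cpt : Continuous fun q : ℝ × ℝ => p + q.1 • ec q.2 :=
    continuous_const.add (continuous_fst.smul (ec_cont.comp continuous_snd))
  have cptr : ∀ r : ℝ, Continuous fun θ : ℝ => p + r • ec θ := fun r =>
    continuous_const.add (ec_cont.const_smul r)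
  have hpr : ∀ r θ : ℝ, HasDerivAt (fun s : ℝ => p + s • ec θ) (ec θ) r := by
    intro r θ
    refine (((hasDerivAt_id r).smul_const (ec θ)).const_add p).congr_deriv (one_smul _ _)
  have hpt : ∀ r θ : ℝ, HasDerivAt (fun s : ℝ => p + r • ec s) (r • ec' θ) θ := by
    intro r θ
    exact ((ec_deriv θ).const_smul r).const_add p
  have d0 : ∀ r, HasDerivAt M (M1 r) r := by
    intro r
    refine deriv_under (F := fun r θ => v (p + r • ec θ))
      (F' := fun r θ => fderiv ℝ v (p + r • ec θ) (ec θ)) ?_ ?_ ?_ _ _ r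
    · intro r; exact hv.continuous.comp (cptr r)
    · exact ((hD.continuous.comp cpt).clm_apply (ec_cont.comp continuous_snd))
    · intro r θ
      exact (hvd _).hasFDerivAt.comp_hasDerivAt r (hpr r θ)
  have d1 : ∀ r, HasDerivAt M1 (M2 r) r := by
    intro r
    refine deriv_under (F := fun r θ => fderiv ℝ v (p + r • ec θ) (ec θ))
      (F' := fun r θ => fderiv ℝ (fderiv ℝ v) (p + r • ec θ) (ec θ) (ec θ)) ?_ ?_ ?_ _ _ r
    · intro r; exact (hD.continuous.comp (cptr r)).clm_apply ec_cont
    · exact ((hH.comp cpt).clm_apply (ec_cont.comp continuous_snd)).clm_apply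
        (ec_cont.comp continuous_snd)
    · intro r θ
      have := ((hDd _).hasFDerivAt.comp_hasDerivAt r (hpr r θ)).clm_apply (hasDerivAt_const r (ec θ))
      simpa using this
  have hang : ∀ r, r * (∫ θ in (-Real.pi)..Real.pi,
      fderiv ℝ (fderiv ℝ v) (p + r • ec θ) (ec' θ) (ec' θ)) = M1 r := by
    intro r
    have hder : ∀ θ, HasDerivAt (fun θ => fderiv ℝ v (p + r • ec θ) (ec' θ))
        (r * fderiv ℝ (fderiv ℝ v) (p + r • ec θ) (ec' θ) (ec' θ)
          - fderiv ℝ v (p + r • ec θ) (ec θ)) θ := by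
      intro θ
      have := ((hDd _).hasFDerivAt.comp_hasDerivAt θ (hpt r θ)).clm_apply (ec'_deriv θ)
      refine this.congr_deriv ?_
      simp [sub_eq_add_neg]
    have c1 : Continuous fun θ => fderiv ℝ (fderiv ℝ v) (p + r • ec θ) (ec' θ) (ec' θ) :=
      ((hH.comp (cptr r)).clm_apply ec'_cont).clm_apply ec'_cont
    have c2 : Continuous fun θ => fderiv ℝ v (p + r • ec θ) (ec θ) :=
      (hD.continuous.comp (cptr r)).clm_apply ec_cont
    have c3 : Continuous fun θ => r * fderiv ℝ (fderiv ℝ v) (p + r • ec θ) (ec' θ) (ec' θ) :=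
      continuous_const.mul c1
    have hi := intervalIntegral.integral_eq_sub_of_hasDerivAt (a := -Real.pi) (b := Real.pi)
      (fun θ _ => hder θ) ((c3.sub c2).intervalIntegrable _ _)
    rw [intervalIntegral.integral_sub (c3.intervalIntegrable _ _)
      (c2.intervalIntegrable _ _), intervalIntegral.integral_const_mul] at hi
    have e1 : ec Real.pi = ec (-Real.pi) := by simp [ec]
    have e2 : ec' Real.pi = ec' (-Real.pi) := by simp [ec']
    rw [e1, e2, sub_self] at hi
    simp only [hM1]
    linarith
  have hode : ∀ r, 0 ≤ r → r < ρ → r * M2 r + M1 r = - m * r * M r := by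
    intro r hr0 hr
    rw [← hang r, ← mul_add, mul_comm (-m) r, mul_assoc]
    congr 1
    simp only [hM2, hM]
    rw [← intervalIntegral.integral_add, ← intervalIntegral.integral_const_mul]
    · apply intervalIntegral.integral_congr
      intro θ _
      simp only
      have hq : p + r • ec θ ∈ Metric.ball p ρ := by
        rw [Metric.mem_ball, dist_eq_norm, add_sub_cancel_left, norm_smul, ec_norm, mul_one,
          Real.norm_eq_abs, abs_of_nonneg hr0]
        exact hr
      rw [← h _ hq, lap, mixed_eq (hDd _), mixed_eq (hDd _)]
      simp only [ec, ec', map_add, map_smul, add_apply, _root_.smul_apply, smul_eq_mul]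
      have := Real.sin_sq_add_cos_sq θ
      linear_combination (fderiv ℝ (fderiv ℝ v) (p + r • (Real.cos θ • ee 0 + Real.sin θ • ee 1)) (ee 0) (ee 0) + fderiv ℝ (fderiv ℝ v) (p + r • (Real.cos θ • ee 0 + Real.sin θ • ee 1)) (ee 1) (ee 1)) * this
    · exact (((hH.comp (cptr r)).clm_apply ec_cont).clm_apply ec_cont).intervalIntegrable _ _
    · exact (((hH.comp (cptr r)).clm_apply ec'_cont).clm_apply ec'_cont).intervalIntegrable _ _
  have hM0 : M 0 = 0 := by simp [hM, h0]
  have hM10 : M1 0 = 0 := by have := hang 0; simp at this; exact this.symm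
  have dE : ∀ r, HasDerivAt (fun r => M1 r ^ 2 + m * M r ^ 2) (2 * M1 r * (M2 r + m * M r)) r := by
    intro r
    refine (((d1 r).pow 2).add (((d0 r).pow 2).const_mul m)).congr_deriv ?_
    simp; ring
  have hanti : AntitoneOn (fun r => M1 r ^ 2 + m * M r ^ 2) (Ico 0 ρ) := by
    apply antitoneOn_of_deriv_nonpos (convex_Ico 0 ρ)
    · exact fun x _ => (dE x).continuousAt.continuousWithinAt
    · exact fun x _ => (dE x).differentiableAt.differentiableWithinAt
    · intro x hx
      rw [interior_Ico] at hx
      rw [(dE x).deriv]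
      have := hode x hx.1.le hx.2
      have h2 : M2 x + m * M x = - M1 x / x := by
        have := hx.1.ne'
        field_simp; linarith
      rw [h2]
      have : 2 * M1 x * (-M1 x / x) = - (2 * M1 x ^ 2 / x) := by ring
      rw [this]
      have := hx.1
      have : 0 ≤ 2 * M1 x ^ 2 / x := by positivity
      linarith
  have hfin := hanti ⟨le_rfl, hr0.trans_lt hr⟩ ⟨hr0, hr⟩ hr0
  simp only [hM0, hM10] at hfin
  have h1 : m * M r ^ 2 ≤ 0 := by nlinarith [sq_nonneg (M1 r)]
  have h2 : M r ^ 2 = 0 := by nlinarith [sq_nonneg (M r), mul_nonneg hm.le (sq_nonneg (M r))]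
  exact pow_eq_zero_iff two_ne_zero |>.1 h2

lemma radial_zero {v : E2 → ℝ} (hv : Continuous v) {h : ℝ → ℝ} (hh : Continuous h) {ρ : ℝ} (hρ : 0 < ρ)
    (hs : ∀ t, ρ ^ 2 ≤ t → h t = 0) {p : E2}
    (hz : ∀ r, 0 ≤ r → r < ρ → ∫ θ in (-Real.pi)..Real.pi, v (p + r • ec θ) = 0) :
    ∫ y, v (p + y) * h (‖y‖ ^ 2) = 0 := by
  rw [← polarE2 (fun y => v (p + y) * h (‖y‖ ^ 2))]
  have hc : Continuous fun q : ℝ × ℝ => q.1 * (v (p + q.1 • ec q.2) * h (‖q.1 • ec q.2‖ ^ 2)) := by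
    have c : Continuous fun q : ℝ × ℝ => q.1 • ec q.2 :=
      continuous_fst.smul (ec_cont.comp continuous_snd)
    exact continuous_fst.mul ((hv.comp (continuous_const.add c)).mul (hh.comp (c.norm.pow 2)))
  have hz0 : ∀ q : ℝ × ℝ, q ∈ (Ioi (0:ℝ) ×ˢ Ioo (-Real.pi) Real.pi) \ (Ioc (0:ℝ) ρ ×ˢ Ioo (-Real.pi) Real.pi) →
      q.1 * (v (p + q.1 • ec q.2) * h (‖q.1 • ec q.2‖ ^ 2)) = 0 := by
    rintro ⟨r, θ⟩ ⟨⟨h1, h2⟩, h3⟩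
    simp only [mem_prod, mem_Ioc, not_and] at h3 h1 h2
    rw [mem_Ioi] at h1
    have : ρ < r := by
      by_contra hcon
      exact h3 ⟨h1, not_lt.1 hcon⟩ h2
    rw [hs]
    · simp
    · simp only [norm_smul, ec_norm, mul_one, Real.norm_eq_abs, sq_abs]
      exact pow_le_pow_left₀ hρ.le this.le 2
  have ht : polarCoord.target = Ioi (0:ℝ) ×ˢ Ioo (-Real.pi) Real.pi := rfl
  rw [ht, setIntegral_eq_of_subset_of_forall_sdiff_eq_zero
    ((measurableSet_Ioi).prod measurableSet_Ioo) (prod_mono Ioc_subset_Ioi_self le_rfl) hz0]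
  rw [Measure.volume_eq_prod, setIntegral_prod]
  · apply setIntegral_eq_zero_of_forall_eq_zero
    intro r hr
    simp only [norm_smul, ec_norm, mul_one, Real.norm_eq_abs, sq_abs]
    rw [integral_const_mul, integral_mul_const, ← integral_Ioc_eq_integral_Ioo,
      ← intervalIntegral.integral_of_le (by linarith [Real.pi_pos])]
    rcases hr.2.lt_or_eq with h1 | h1
    · rw [hz r hr.1.le h1]; simp
    · rw [h1, hs _ le_rfl]; simp
  · refine IntegrableOn.mono_set (t := Icc (0:ℝ) ρ ×ˢ Icc (-Real.pi) Real.pi) ?_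
      (prod_mono Ioc_subset_Icc_self Ioo_subset_Icc_self)
    exact hc.continuousOn.integrableOn_compact (isCompact_Icc.prod isCompact_Icc)

/-- comparison solution -/
def cosf (m : ℝ) (y : E2) : ℝ := Real.cos (Real.sqrt m * y 0)

lemma cosf_smooth (m : ℝ) {n : ℕ∞} : ContDiff ℝ n (cosf m) :=
  Real.contDiff_cos.comp (contDiff_const.mul (EuclideanSpace.proj 0 : E2 →L[ℝ] ℝ).contDiff)

lemma cosf_fderiv (m : ℝ) (y w : E2) :
    fderiv ℝ (cosf m) y w = - Real.sqrt m * w 0 * Real.sin (Real.sqrt m * y 0) := by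
  have h1 : HasFDerivAt (fun y : E2 => Real.sqrt m * y 0) (Real.sqrt m • (EuclideanSpace.proj 0 : E2 →L[ℝ] ℝ)) y :=
    ((EuclideanSpace.proj 0 : E2 →L[ℝ] ℝ).hasFDerivAt).const_mul _
  have h2 := h1.cos.fderiv
  have h3 : fderiv ℝ (cosf m) y = _ := h2
  rw [h3]
  simp; ring

lemma cosf_lap {m : ℝ} (hm : 0 ≤ m) (y : E2) : lap (cosf m) y = - m * cosf m y := by
  have h1 : HasFDerivAt (fun y : E2 => Real.sqrt m * y 0) (Real.sqrt m • (EuclideanSpace.proj 0 : E2 →L[ℝ] ℝ)) y :=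
    ((EuclideanSpace.proj 0 : E2 →L[ℝ] ℝ).hasFDerivAt).const_mul _
  have h2 : ∀ a b : E2, mixedDeriv (cosf m) y a b = - m * a 0 * b 0 * cosf m y := by
    intro a b
    unfold mixedDeriv
    simp only [cosf_fderiv]
    rw [((h1.sin).const_mul _).fderiv]
    have := Real.mul_self_sqrt hm
    simp [cosf]
    linear_combination ((a 0 * b 0 * Real.cos (√m * y 0))) * this
  rw [lap, h2, h2]
  simp [ee]

lemma lap_sub {f g : E2 → ℝ} (hf : ContDiff ℝ 2 f) (hg : ContDiff ℝ 2 g) (p : E2) :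
    lap (fun q => f q - g q) p = lap f p - lap g p := by
  have hm : ∀ a, mixedDeriv (fun q => f q - g q) p a a = mixedDeriv f p a a - mixedDeriv g p a a := by
    intro a
    unfold mixedDeriv
    have e : (fun y => fderiv ℝ (fun q => f q - g q) y a) =
      fun y => fderiv ℝ f y a - fderiv ℝ g y a := by
      ext y
      rw [fderiv_fun_sub (hf.differentiable two_ne_zero y) (hg.differentiable two_ne_zero y)]; rfl
    have hd : ∀ k : E2 → ℝ, ContDiff ℝ 2 k → DifferentiableAt ℝ (fun y => fderiv ℝ k y a) p := by
      intro k hk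
      have hD : ContDiff ℝ 1 (fderiv ℝ k) := hk.fderiv_right (by norm_num)
      exact (hD.clm_apply contDiff_const).differentiable one_ne_zero p
    rw [e, fderiv_fun_sub (hd f hf) (hd g hg)]; rfl
  simp only [lap, hm]; ring

lemma lap_const_mul {f : E2 → ℝ} (hf : ContDiff ℝ 2 f) (c : ℝ) (p : E2) :
    lap (fun q => c * f q) p = c * lap f p := by
  have hm : ∀ a, mixedDeriv (fun q => c * f q) p a a = c * mixedDeriv f p a a := by
    intro a
    unfold mixedDeriv
    have e : (fun y => fderiv ℝ (fun q => c * f q) y a) =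
      fun y => c * fderiv ℝ f y a := by
      ext y
      rw [fderiv_const_mul (hf.differentiable two_ne_zero y)]; rfl
    have hd : DifferentiableAt ℝ (fun y => fderiv ℝ f y a) p := by
      have hD : ContDiff ℝ 1 (fderiv ℝ f) := hf.fderiv_right (by norm_num)
      exact (hD.clm_apply contDiff_const).differentiable one_ne_zero p
    rw [e, fderiv_const_mul hd]; rfl
  simp only [lap, hm]; ring

lemma lap_comp_sub (f : E2 → ℝ) (p q : E2) : lap (fun y => f (y - p)) q = lap f (q - p) := by
  have : ∀ a, mixedDeriv (fun y => f (y - p)) q a a = mixedDeriv f (q - p) a a := by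
    intro a
    unfold mixedDeriv
    simp only [fderiv_comp_sub]
    rw [fderiv_comp_sub (f := fun y => fderiv ℝ f y a)]
  simp only [lap, this]

theorem MV {v : E2 → ℝ} (hv : ContDiff ℝ 2 v) {m ρ : ℝ} (hm : 0 < m) (hρ : 0 < ρ) {p : E2}
    (heq : ∀ q ∈ Metric.ball p ρ, lap v q = - m * v q) {h : ℝ → ℝ} (hh : Continuous h)
    (hs : ∀ t, ρ ^ 2 ≤ t → h t = 0) :
    ∫ y, v (p + y) * h (‖y‖ ^ 2) = v p * ∫ y, cosf m y * h (‖y‖ ^ 2) := by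
  have hcp : ContDiff ℝ 2 fun q => cosf m (q - p) :=
    (cosf_smooth m (n := 2)).comp (contDiff_id.sub contDiff_const)
  have hw : ContDiff ℝ 2 fun q => v q - v p * cosf m (q - p) := hv.sub (contDiff_const.mul hcp)
  have key := radial_zero hw.continuous hh hρ hs (p := p) (fun r h0 hr => by
    refine circle_zero hw hm (ρ := ρ) ?_ ?_ h0 hr
    · intro q hq
      rw [lap_sub hv (contDiff_const.mul hcp), lap_const_mul hcp, heq q hq, lap_comp_sub, cosf_lap hm.le]
      ring
    · simp [cosf])
  have hsupp : HasCompactSupport fun y : E2 => h (‖y‖ ^ 2) := by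
    refine HasCompactSupport.intro (isCompact_closedBall (0:E2) ρ) ?_
    intro y hy
    rw [Metric.mem_closedBall, dist_zero_right, not_le] at hy
    exact hs _ (pow_le_pow_left₀ hρ.le hy.le 2)
  have chh : Continuous fun y : E2 => h (‖y‖ ^ 2) := hh.comp (continuous_norm.pow 2)
  have i1 : Integrable fun y => v (p + y) * h (‖y‖ ^ 2) :=
    ((hv.continuous.comp (continuous_const.add continuous_id)).mul chh).integrable_of_hasCompactSupport
      hsupp.mul_left
  have i2 : Integrable fun y => cosf m y * h (‖y‖ ^ 2) :=
    (((cosf_smooth m (n := 0)).continuous).mul chh).integrable_of_hasCompactSupport hsupp.mul_left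
  have e : ∀ y, (v (p + y) - v p * cosf m (p + y - p)) * h (‖y‖ ^ 2) =
    v (p + y) * h (‖y‖ ^ 2) - v p * (cosf m y * h (‖y‖ ^ 2)) := by
    intro y; rw [add_sub_cancel_left]; ring
  simp only [e] at key
  rw [integral_sub i1 (i2.const_mul _), integral_const_mul] at key
  linarith
end NT

namespace NT
open MeasureTheory Filter Topology

abbrev smo : WithTop ℕ∞ := ((⊤ : ℕ∞) : WithTop ℕ∞)

lemma smo1 : (1 : WithTop ℕ∞) ≤ smo := WithTop.coe_le_coe.2 (le_top (a := (1 : ℕ∞)))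
lemma smo2 : (2 : WithTop ℕ∞) ≤ smo := WithTop.coe_le_coe.2 (le_top (a := (2 : ℕ∞)))
lemma smo11 : (1 : WithTop ℕ∞) + 1 ≤ smo := by rw [one_add_one_eq_two]; exact smo2

/-- radial bump -/
def eta (ε : ℝ) (y : E2) : ℝ := Real.smoothTransition (1 - ‖y‖ ^ 2 / ε ^ 2)

lemma eta_smooth (ε : ℝ) : ContDiff ℝ smo (eta ε) :=
  Real.smoothTransition.contDiff.comp
    (contDiff_const.sub ((contDiff_norm_sq ℝ).div_const _))

lemma eta_zero {ε : ℝ} (hε : 0 < ε) {y : E2} (hy : ε ≤ ‖y‖) : eta ε y = 0 := by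
  apply Real.smoothTransition.zero_of_nonpos
  have : 1 ≤ ‖y‖ ^ 2 / ε ^ 2 := by
    rw [one_le_div (by positivity)]
    exact pow_le_pow_left₀ hε.le hy 2
  linarith

lemma eta_nonneg (ε : ℝ) (y : E2) : 0 ≤ eta ε y := Real.smoothTransition.nonneg _
lemma eta_le_one (ε : ℝ) (y : E2) : eta ε y ≤ 1 := Real.smoothTransition.le_one _
lemma eta_abs (ε : ℝ) (y : E2) : |eta ε y| ≤ 1 := by
  rw [abs_of_nonneg (eta_nonneg _ _)]; exact eta_le_one _ _

lemma eta_norm (ε : ℝ) {y z : E2} (h : ‖y‖ = ‖z‖) : eta ε y = eta ε z := by simp [eta, h]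

lemma eta_comm (ε : ℝ) (y z : E2) : eta ε (y - z) = eta ε (z - y) := eta_norm ε (norm_sub_rev _ _)

lemma eta_cs {ε : ℝ} (hε : 0 < ε) : HasCompactSupport (eta ε) := by
  refine HasCompactSupport.intro (isCompact_closedBall (0:E2) ε) ?_
  intro y hy
  rw [Metric.mem_closedBall, dist_zero_right, not_le] at hy
  exact eta_zero hε hy.le

lemma eta_cont (ε : ℝ) : Continuous (eta ε) := (eta_smooth ε).continuous

lemma eta_int {ε : ℝ} (hε : 0 < ε) : Integrable (eta ε) :=
  (eta_cont ε).integrable_of_hasCompactSupport (eta_cs hε)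

def I1 : ℝ := ∫ y, eta 1 y

lemma I1_pos : 0 < I1 := by
  apply Continuous.integral_pos_of_hasCompactSupport_nonneg_nonzero (eta_cont 1) (eta_cs one_pos)
    (fun y => eta_nonneg 1 y) (x := 0)
  simp [eta]

lemma eta_scale {ε : ℝ} (hε : 0 < ε) : ∫ y, eta ε y = ε ^ 2 * I1 := by
  have h := Measure.integral_comp_inv_smul (volume : Measure E2) (eta 1) ε
  have e : ∀ y : E2, eta 1 (ε⁻¹ • y) = eta ε y := by
    intro y
    simp only [eta, norm_smul, norm_inv, Real.norm_eq_abs, mul_pow, inv_pow, sq_abs]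
    congr 2; field_simp
  simp only [e] at h
  rw [h, finrank_euclideanSpace_fin, abs_of_nonneg (by positivity), smul_eq_mul, I1]

def cc (m ε : ℝ) : ℝ := ∫ y, cosf m y * eta ε y

lemma abs_coord_le (y : E2) (i : Fin 2) : |y i| ≤ ‖y‖ := by
  have := PiLp.norm_apply_le (p := 2) y i
  simpa using this

lemma cosf_le_one (m : ℝ) (y : E2) : cosf m y ≤ 1 := Real.cos_le_one _

lemma ci_int (m : ℝ) {ε : ℝ} (hε : 0 < ε) : Integrable fun y => cosf m y * eta ε y :=
  (((cosf_smooth m (n := 0)).continuous).mul (eta_cont ε)).integrable_of_hasCompactSupport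
    (eta_cs hε).mul_left

lemma cc_le (m : ℝ) {ε : ℝ} (hε : 0 < ε) : cc m ε ≤ ε ^ 2 * I1 := by
  rw [← eta_scale hε]
  refine integral_mono (ci_int m hε) (eta_int hε) fun y => ?_
  have := mul_le_mul_of_nonneg_right (cosf_le_one m y) (eta_nonneg ε y)
  simpa using this

lemma cc_ge {m ε : ℝ} (hε : 0 < ε) (hs : Real.sqrt m * ε ≤ 1) :
    Real.cos (Real.sqrt m * ε) * (ε ^ 2 * I1) ≤ cc m ε := by
  rw [← eta_scale hε, ← integral_const_mul]
  refine integral_mono ((eta_int hε).const_mul _) (ci_int m hε) fun y => ?_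
  simp only
  rcases le_or_gt ε ‖y‖ with h | h
  · rw [eta_zero hε h]; simp
  · refine mul_le_mul_of_nonneg_right ?_ (eta_nonneg ε y)
    unfold cosf
    rw [← Real.cos_abs (Real.sqrt m * y 0)]
    apply Real.cos_le_cos_of_nonneg_of_le_pi (abs_nonneg _)
    · linarith [Real.pi_gt_three]
    · rw [abs_mul, abs_of_nonneg (Real.sqrt_nonneg _)]
      exact mul_le_mul_of_nonneg_left ((abs_coord_le y 0).trans h.le) (Real.sqrt_nonneg _)

lemma cc_half {m ε : ℝ} (hε : 0 < ε) (hs : Real.sqrt m * ε ≤ 1) :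
    ε ^ 2 * I1 / 2 ≤ cc m ε := by
  refine le_trans ?_ (cc_ge hε hs)
  have : 1 / 2 ≤ Real.cos (Real.sqrt m * ε) := by
    have h0 : 0 ≤ Real.sqrt m * ε := by positivity
    have := Real.one_sub_sq_div_two_le_cos (x := Real.sqrt m * ε)
    nlinarith
  have hI := I1_pos
  have : 0 < ε ^ 2 * I1 := by positivity
  nlinarith

lemma cc_pos {m ε : ℝ} (hε : 0 < ε) (hs : Real.sqrt m * ε ≤ 1) : 0 < cc m ε := by
  have := cc_half hε hs
  have hI := I1_pos
  have : 0 < ε ^ 2 * I1 / 2 := by positivity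
  linarith

/-- convolution -/
def Cv (w k : E2 → ℝ) (p : E2) : ℝ := ∫ y, w y * k (p - y)

lemma Cv_eq (w k : E2 → ℝ) : Cv w k = convolution w k (ContinuousLinearMap.mul ℝ ℝ) volume := rfl

lemma Cv_fderiv {w k : E2 → ℝ} (hw : Integrable w) (hk : ContDiff ℝ 1 k) (hc : HasCompactSupport k)
    (p b : E2) : fderiv ℝ (Cv w k) p b = Cv w (fun a => fderiv ℝ k a b) p := by
  rw [Cv_eq, (hc.hasFDerivAt_convolution_right _ hw.locallyIntegrable hk p).fderiv,
    convolution_precompR_apply _ hw.locallyIntegrable (hc.fderiv ℝ) (hk.continuous_fderiv one_ne_zero)]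
  rfl

lemma Cv_smooth {w k : E2 → ℝ} (hw : Integrable w) (hk : ContDiff ℝ smo k) (hc : HasCompactSupport k) :
    ContDiff ℝ smo (Cv w k) := by
  rw [Cv_eq]
  exact hc.contDiff_convolution_right _ hw.locallyIntegrable hk

lemma Cv_int {w k : E2 → ℝ} (hw : Integrable w) (hk : Continuous k) (hc : HasCompactSupport k) (p : E2) :
    Integrable fun y => w y * k (p - y) := by
  obtain ⟨C, hC⟩ := hc.exists_bound_of_continuous hk
  exact hw.mul_bdd (hk.comp (continuous_const.sub continuous_id)).aestronglyMeasurable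
    (Eventually.of_forall fun y => hC _)

lemma Cv_lap {w k : E2 → ℝ} (hw : Integrable w) (hk : ContDiff ℝ smo k) (hc : HasCompactSupport k)
    (p : E2) : lap (Cv w k) p = Cv w (lap k) p := by
  have h1 : ContDiff ℝ 1 k := hk.of_le smo1
  have h2 : ∀ a : E2, ContDiff ℝ 1 (fun y => fderiv ℝ k y a) := fun a =>
    (hk.fderiv_right (m := 1) smo11).clm_apply contDiff_const
  have hm : ∀ a, mixedDeriv (Cv w k) p a a = Cv w (fun y => mixedDeriv k y a a) p := by
    intro a
    unfold mixedDeriv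
    have e : (fun y => fderiv ℝ (Cv w k) y a) = Cv w (fun y => fderiv ℝ k y a) := by
      ext y; exact Cv_fderiv hw h1 hc y a
    rw [e, Cv_fderiv hw (h2 a) (hc.fderiv_apply ℝ a)]
  have hmc : ∀ a, Continuous (fun y => mixedDeriv k y a a) := fun a =>
    ((h2 a).continuous_fderiv one_ne_zero).clm_apply continuous_const
  have hms : ∀ a, HasCompactSupport (fun y => mixedDeriv k y a a) := fun a =>
    (hc.fderiv_apply ℝ a).fderiv_apply ℝ a
  rw [lap, hm, hm]
  have e : Cv w (lap k) p = ∫ y, (w y * mixedDeriv k (p - y) (ee 0) (ee 0) +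
      w y * mixedDeriv k (p - y) (ee 1) (ee 1)) := by
    unfold Cv lap
    simp only [mul_add]
  rw [e, integral_add (Cv_int hw (hmc _) (hms _) p) (Cv_int hw (hmc _) (hms _) p)]
  rfl

def WeakOn (m : ℝ) (w : E2 → ℝ) (Ω : Set E2) : Prop :=
  ∀ φ : E2 → ℝ, ContDiff ℝ smo φ → HasCompactSupport φ → tsupport φ ⊆ Ω →
    ∫ y, w y * (lap φ y + m * φ y) = 0

def Vf (w : E2 → ℝ) (ε : ℝ) : E2 → ℝ := Cv w (eta ε)

lemma Vf_eq (w : E2 → ℝ) (ε : ℝ) (p : E2) : Vf w ε p = ∫ y, w y * eta ε (y - p) := by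
  unfold Vf Cv
  simp only [eta_comm ε p]

lemma fderiv_aff (k : E2 → ℝ) (A : E2 ≃L[ℝ] E2) (c q a : E2) :
    fderiv ℝ (fun y => k (A y + c)) q a = fderiv ℝ k (A q + c) (A a) := by
  have h := A.comp_right_fderiv (f := fun z => k (z + c)) (x := q)
  have e : (fun y => k (A y + c)) = (fun z => k (z + c)) ∘ A := rfl
  rw [e, h, fderiv_comp_add_right]
  rfl

lemma lap_comp_sub' (f : E2 → ℝ) (p q : E2) : lap (fun y => f (p - y)) q = lap f (p - q) := by
  have h1 : ∀ (k : E2 → ℝ) (q a : E2), fderiv ℝ (fun y => k (p - y)) q a = - fderiv ℝ k (p - q) a := by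
    intro k q a
    have := fderiv_aff k (ContinuousLinearEquiv.neg ℝ) p q a
    simp only [ContinuousLinearEquiv.coe_neg, Pi.neg_apply, id] at this
    simp only [sub_eq_neg_add, this, map_neg]
  have : ∀ a, mixedDeriv (fun y => f (p - y)) q a a = mixedDeriv f (p - q) a a := by
    intro a
    unfold mixedDeriv
    simp only [h1]
    have := h1 (fun z => fderiv ℝ f z a) q a
    rw [fderiv_fun_neg, neg_apply, this, neg_neg]
  simp only [lap, this]

lemma lap_cont {k : E2 → ℝ} (hk : ContDiff ℝ smo k) : Continuous (lap k) := by
  have h2 : ∀ a : E2, ContDiff ℝ 1 (fun y => fderiv ℝ k y a) := fun a =>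
    (hk.fderiv_right (m := 1) smo11).clm_apply contDiff_const
  have hmc : ∀ a, Continuous (fun y => mixedDeriv k y a a) := fun a =>
    ((h2 a).continuous_fderiv one_ne_zero).clm_apply continuous_const
  exact (hmc _).add (hmc _)

lemma lap_cs {k : E2 → ℝ} (hc : HasCompactSupport k) : HasCompactSupport (lap k) := by
  have hms : ∀ a, HasCompactSupport (fun y => mixedDeriv k y a a) := fun a =>
    (hc.fderiv_apply ℝ a).fderiv_apply ℝ a
  exact (hms _).add (hms _)

lemma Vf_smooth {w : E2 → ℝ} (hw : Integrable w) {ε : ℝ} (hε : 0 < ε) : ContDiff ℝ smo (Vf w ε) :=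
  Cv_smooth hw (eta_smooth ε) (eta_cs hε)

lemma tsupport_eta {ε : ℝ} (hε : 0 < ε) (p : E2) :
    tsupport (fun y => eta ε (p - y)) ⊆ Metric.closedBall p ε := by
  apply closure_minimal _ Metric.isClosed_closedBall
  intro y hy
  rw [Metric.mem_closedBall, dist_comm, dist_eq_norm]
  by_contra hc
  exact hy (eta_zero hε (not_le.1 hc).le)

lemma Vf_lap {w : E2 → ℝ} (hw : Integrable w) {m ε : ℝ} (hε : 0 < ε) {Ω : Set E2}
    (hW : WeakOn m w Ω) {p : E2} (hp : Metric.closedBall p ε ⊆ Ω) :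
    lap (Vf w ε) p = - m * Vf w ε p := by
  have h := hW (fun y => eta ε (p - y)) ((eta_smooth ε).comp (contDiff_const.sub contDiff_id))
    (HasCompactSupport.of_support_subset_isCompact (isCompact_closedBall p ε)
      (subset_closure.trans (tsupport_eta hε p))) ((tsupport_eta hε p).trans hp)
  rw [Vf, Cv_lap hw (eta_smooth ε) (eta_cs hε)]
  have e : ∀ y, w y * (lap (fun y => eta ε (p - y)) y + m * eta ε (p - y)) =
    w y * lap (eta ε) (p - y) + m * (w y * eta ε (p - y)) := by
    intro y; rw [lap_comp_sub']; ring
  simp only [e] at h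
  rw [integral_add (Cv_int hw (lap_cont (eta_smooth ε)) (lap_cs (eta_cs hε)) p)
    ((Cv_int hw (eta_cont ε) (eta_cs hε) p).const_mul m), integral_const_mul] at h
  unfold Cv
  linarith

lemma Vf_swap {w : E2 → ℝ} (hw : Integrable w) {ε δ : ℝ} (hε : 0 < ε) (hδ : 0 < δ) (p : E2) :
    ∫ y, Vf w δ (p + y) * eta ε y = ∫ y, Vf w ε (p + y) * eta δ y := by
  have key : ∀ {ε δ : ℝ}, 0 < ε → 0 < δ → ∫ y, Vf w δ (p + y) * eta ε y =
      ∫ z, w z * ∫ y, eta δ (p + y - z) * eta ε y := by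
    intro ε δ hε hδ
    have e : ∀ y, Vf w δ (p + y) * eta ε y = ∫ z, w z * eta δ (p + y - z) * eta ε y := by
      intro y; rw [integral_mul_const]; rfl
    simp only [e]
    rw [integral_integral_swap]
    · refine integral_congr_ae (Eventually.of_forall fun z => ?_)
      simp only [mul_assoc]
      rw [integral_const_mul]
    · have h1 : Integrable (fun q : E2 × E2 => eta ε q.1 * w q.2) (volume.prod volume) :=
        (eta_int hε).mul_prod hw
      have h2 : Integrable (fun q : E2 × E2 => (eta ε q.1 * w q.2) * eta δ (p + q.1 - q.2)) (volume.prod volume) := by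
        refine h1.mul_bdd (c := 1) ?_ (Eventually.of_forall fun q => eta_abs _ _)
        exact ((eta_cont δ).comp ((continuous_const.add continuous_fst).sub continuous_snd)).aestronglyMeasurable
      refine h2.congr (Eventually.of_forall fun q => ?_)
      simp only [Function.uncurry]
      ring
  rw [key hε hδ, key hδ hε]
  refine integral_congr_ae (Eventually.of_forall fun z => ?_)
  simp only
  congr 1
  rw [← integral_sub_left_eq_self _ volume (z - p)]
  refine integral_congr_ae (Eventually.of_forall fun y => ?_)
  simp only
  rw [mul_comm]
  congr 1
  · rw [← eta_comm]; congr 1; abel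
  · apply eta_norm; rw [← norm_neg]; congr 1; abel

lemma Vf_comm {w : E2 → ℝ} (hw : Integrable w) {m ε δ : ℝ} (hm : 0 < m) (hε : 0 < ε) (hδ : 0 < δ)
    {Ω : Set E2} (hW : WeakOn m w Ω) {p : E2} (hp : Metric.closedBall p (ε + δ) ⊆ Ω) :
    Vf w δ p * cc m ε = Vf w ε p * cc m δ := by
  have key : ∀ {ε δ : ℝ}, 0 < ε → 0 < δ → Metric.closedBall p (ε + δ) ⊆ Ω →
      ∫ y, Vf w δ (p + y) * eta ε y = Vf w δ p * cc m ε := by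
    intro ε δ hε hδ hp
    refine MV ((Vf_smooth hw hδ).of_le smo2) hm hε (p := p) ?_
      (h := fun t => Real.smoothTransition (1 - t / ε ^ 2)) ?_ ?_
    · intro q hq
      apply Vf_lap hw hδ hW
      refine (Metric.closedBall_subset_closedBall' ?_).trans hp
      rw [Metric.mem_ball] at hq; linarith
    · exact Real.smoothTransition.continuous.comp (continuous_const.sub (continuous_id.div_const _))
    · intro t ht
      apply Real.smoothTransition.zero_of_nonpos
      have : 1 ≤ t / ε ^ 2 := by rwa [one_le_div (by positivity)]
      linarith
  rw [← key hε hδ hp, Vf_swap hw hε hδ, key hδ hε (by rwa [add_comm])]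

/-- regularised function -/
def Wf (m : ℝ) (w : E2 → ℝ) (p : E2) : ℝ :=
  limUnder atTop (fun n : ℕ => Vf w ((1/2 : ℝ) ^ n) p / cc m ((1/2 : ℝ) ^ n))

lemma half_tendsto : Tendsto (fun n : ℕ => (1/2 : ℝ) ^ n) atTop (𝓝 0) :=
  tendsto_pow_atTop_nhds_zero_of_lt_one (by norm_num) (by norm_num)

lemma Wf_eq {w : E2 → ℝ} (hw : Integrable w) {m ε : ℝ} (hm : 0 < m) (hε : 0 < ε)
    (hs : Real.sqrt m * ε ≤ 1) {Ω : Set E2} (hW : WeakOn m w Ω) {p : E2}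
    (hp : Metric.closedBall p (2 * ε) ⊆ Ω) : Wf m w p = Vf w ε p / cc m ε := by
  apply Tendsto.limUnder_eq
  apply tendsto_const_nhds.congr'
  filter_upwards [half_tendsto.eventually_le_const hε] with n hn
  have h0 : (0:ℝ) < (1/2) ^ n := by positivity
  have hs' : Real.sqrt m * (1/2) ^ n ≤ 1 :=
    (mul_le_mul_of_nonneg_left hn (Real.sqrt_nonneg _)).trans hs
  rw [div_eq_div_iff (cc_pos hε hs).ne' (cc_pos h0 hs').ne']
  refine (Vf_comm hw hm hε h0 hW ?_).symm
  exact (Metric.closedBall_subset_closedBall (by linarith)).trans hp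

lemma Wf_congr {w w' : E2 → ℝ} {m r : ℝ} (hr : 0 < r) {p : E2}
    (h : ∀ y ∈ Metric.ball p r, w y = w' y) : Wf m w p = Wf m w' p := by
  unfold Wf limUnder
  congr 1
  apply Filter.map_congr
  filter_upwards [half_tendsto.eventually_le_const hr] with n hn
  have h0 : (0:ℝ) < (1/2) ^ n := by positivity
  congr 1
  refine integral_congr_ae (Eventually.of_forall fun y => ?_)
  simp only
  by_cases hy : y ∈ Metric.ball p r
  · rw [h y hy]
  · rw [Metric.mem_ball, not_lt, dist_comm, dist_eq_norm] at hy
    rw [eta_zero h0 (hn.trans hy)]; simp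

lemma Wf_symm {w : E2 → ℝ} {m : ℝ} {σ : E2 → E2} (hσ : Isometry σ) (hm : MeasurePreserving σ)
    (he : MeasurableEmbedding σ) (h : ∀ y, w (σ y) = w y) (p : E2) : Wf m w (σ p) = Wf m w p := by
  unfold Wf
  congr 1
  ext n
  congr 1
  rw [Vf, Cv, ← hm.integral_comp he]
  refine integral_congr_ae (Eventually.of_forall fun y => ?_)
  simp only
  rw [h y]
  congr 1
  apply eta_norm
  rw [← dist_eq_norm, ← dist_eq_norm, hσ.dist_eq]

lemma exists_eps {Ω : Set E2} (hΩ : IsOpen Ω) {p : E2} (hp : p ∈ Ω) (m : ℝ) :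
    ∃ ε > 0, Real.sqrt m * ε ≤ 1 ∧ ∀ q ∈ Metric.ball p ε, Metric.closedBall q (2 * ε) ⊆ Ω := by
  obtain ⟨r, hr, h⟩ := Metric.isOpen_iff.1 hΩ p hp
  refine ⟨min (r / 4) (1 / (Real.sqrt m + 1)), by positivity, ?_, ?_⟩
  · have h1 := Real.sqrt_nonneg m
    calc Real.sqrt m * min (r / 4) (1 / (Real.sqrt m + 1)) ≤ Real.sqrt m * (1 / (Real.sqrt m + 1)) :=
          mul_le_mul_of_nonneg_left (min_le_right _ _) h1
      _ ≤ 1 := by rw [mul_one_div, div_le_one (by positivity)]; linarith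
  · intro q hq
    refine subset_trans ?_ h
    apply Metric.closedBall_subset_ball'
    rw [Metric.mem_ball] at hq
    have := min_le_left (r / 4) (1 / (Real.sqrt m + 1))
    linarith

lemma Wf_local {w : E2 → ℝ} (hw : Integrable w) {m : ℝ} (hm : 0 < m)
    {Ω : Set E2} (hΩ : IsOpen Ω) (hW : WeakOn m w Ω) {p : E2}
    (hp : p ∈ Ω) : ∃ ε > 0, Real.sqrt m * ε ≤ 1 ∧ Metric.closedBall p (2 * ε) ⊆ Ω ∧
      Wf m w =ᶠ[𝓝 p] fun q => Vf w ε q / cc m ε := by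
  obtain ⟨ε, hε, hs, hb⟩ := exists_eps hΩ hp m
  refine ⟨ε, hε, hs, hb p (Metric.mem_ball_self hε), ?_⟩
  filter_upwards [Metric.ball_mem_nhds p hε] with q hq
  exact Wf_eq hw hm hε hs hW (hb q hq)

lemma Wf_smooth {w : E2 → ℝ} (hw : Integrable w) {m : ℝ} (hm : 0 < m)
    {Ω : Set E2} (hΩ : IsOpen Ω) (hW : WeakOn m w Ω) {p : E2} (hp : p ∈ Ω) :
    ContDiffAt ℝ smo (Wf m w) p := by
  obtain ⟨ε, hε, hs, hb, he⟩ := Wf_local hw hm hΩ hW hp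
  exact ((Vf_smooth hw hε).div_const _).contDiffAt.congr_of_eventuallyEq he

lemma lap_congr {f g : E2 → ℝ} {p : E2} (h : f =ᶠ[𝓝 p] g) : lap f p = lap g p := by
  have : ∀ a, mixedDeriv f p a a = mixedDeriv g p a a := by
    intro a
    unfold mixedDeriv
    have h2 : (fun y => fderiv ℝ f y a) =ᶠ[𝓝 p] fun y => fderiv ℝ g y a := by
      filter_upwards [h.fderiv (𝕜 := ℝ)] with y hy
      rw [hy]
    rw [h2.fderiv_eq]
  simp only [lap, this]

lemma Wf_lap {w : E2 → ℝ} (hw : Integrable w) {m : ℝ} (hm : 0 < m)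
    {Ω : Set E2} (hΩ : IsOpen Ω) (hW : WeakOn m w Ω) {p : E2} (hp : p ∈ Ω) :
    lap (Wf m w) p = - m * Wf m w p := by
  obtain ⟨ε, hε, hs, hb, he⟩ := Wf_local hw hm hΩ hW hp
  rw [lap_congr he, he.eq_of_nhds]
  have e : (fun q => Vf w ε q / cc m ε) = fun q => (cc m ε)⁻¹ * Vf w ε q := by
    ext q; rw [div_eq_inv_mul]
  rw [e, lap_const_mul ((Vf_smooth hw hε).of_le smo2),
    Vf_lap hw hε hW ((Metric.closedBall_subset_closedBall (by linarith)).trans hb)]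
  ring

lemma Wf_ae {w : E2 → ℝ} (hw : Integrable w) {m : ℝ} :
    ∀ᵐ p, Wf m w p = w p := by
  filter_upwards [(Besicovitch.vitaliFamily (volume : Measure E2)).ae_tendsto_average_norm_sub
    hw.locallyIntegrable] with p h₀
  have hφ' : Tendsto (fun n : ℕ => (1/2 : ℝ) ^ n) atTop (𝓝[>] 0) :=
    tendsto_nhdsWithin_iff.2 ⟨half_tendsto, Eventually.of_forall (fun i ↦ by
      rw [mem_Ioi]; positivity)⟩
  have := (h₀.comp (Besicovitch.tendsto_filterAt volume p)).comp hφ'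
  apply Tendsto.limUnder_eq
  have hs : ∀ᶠ n : ℕ in atTop, Real.sqrt m * (1/2) ^ n ≤ 1 := by
    have h := half_tendsto.const_mul (Real.sqrt m)
    rw [mul_zero] at h
    exact h.eventually_le_const one_pos
  have hI := I1_pos
  have key := tendsto_integral_smul_of_tendsto_average_norm_sub
    (g := fun n y => eta ((1/2:ℝ) ^ n) (p - y) / cc m ((1/2:ℝ)^n))
    (2 * volume.real (Metric.ball (0:E2) 1) / I1) this ?_ ?_ ?_ ?_
  · refine key.congr fun n => ?_
    unfold Vf Cv
    rw [← integral_div]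
    refine integral_congr_ae (Eventually.of_forall fun y => ?_)
    simp only [smul_eq_mul]; ring
  · exact Eventually.of_forall fun n => hw.integrableOn
  · have e : ∀ n : ℕ, ∫ y, eta ((1/2:ℝ) ^ n) (p - y) / cc m ((1/2:ℝ)^n) =
      ((1/2:ℝ) ^ n) ^ 2 * I1 / cc m ((1/2:ℝ)^n) := by
      intro n
      rw [integral_div, integral_sub_left_eq_self (fun y => eta ((1/2:ℝ) ^ n) y),
        eta_scale (by positivity)]
    simp only [e]
    have hcos : Tendsto (fun n : ℕ => 1 / Real.cos (Real.sqrt m * (1/2) ^ n)) atTop (𝓝 1) := by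
      have h := (Real.continuous_cos.tendsto _).comp (half_tendsto.const_mul (Real.sqrt m))
      rw [mul_zero, Real.cos_zero] at h
      have := h.inv₀ one_ne_zero
      simpa [one_div] using this
    refine tendsto_of_tendsto_of_tendsto_of_le_of_le' tendsto_const_nhds hcos ?_ ?_
    · filter_upwards [hs] with n hn
      have h0 : (0:ℝ) < (1/2) ^ n := by positivity
      rw [one_le_div (cc_pos h0 hn)]
      exact cc_le m h0
    · filter_upwards [hs] with n hn
      have h0 : (0:ℝ) < (1/2) ^ n := by positivity
      have hcp : 0 < Real.cos (Real.sqrt m * (1/2) ^ n) := by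
        apply Real.cos_pos_of_mem_Ioo
        have : 0 ≤ Real.sqrt m * (1/2) ^ n := by positivity
        constructor <;> linarith [Real.pi_gt_three]
      rw [div_le_div_iff₀ (cc_pos h0 hn) hcp]
      have := cc_ge h0 hn
      linarith
  · filter_upwards with n
    intro y hy
    have h0 : (0:ℝ) < (1/2) ^ n := by positivity
    apply tsupport_eta h0 p
    apply subset_closure
    intro h
    apply hy
    simp only at h ⊢
    rw [h, zero_div]
  · filter_upwards [hs] with n hn
    intro y
    have h0 : (0:ℝ) < (1/2) ^ n := by positivity
    rw [Measure.addHaar_real_closedBall _ _ h0.le, finrank_euclideanSpace_fin]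
    have hvol : 0 < volume.real (Metric.ball (0:E2) 1) := by
      rw [measureReal_def]
      exact ENNReal.toReal_pos (Metric.measure_ball_pos _ _ one_pos).ne' measure_ball_lt_top.ne
    have h1 := cc_half h0 hn
    have h2 := cc_pos h0 hn
    rw [abs_div, abs_of_pos h2, div_le_div_iff₀ h2 (by positivity)]
    calc |eta ((1/2) ^ n) (p - y)| * ((((1:ℝ) / 2) ^ n) ^ 2 * volume.real (Metric.ball (0:E2) 1))
        ≤ 1 * ((((1:ℝ) / 2) ^ n) ^ 2 * volume.real (Metric.ball (0:E2) 1)) :=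
          mul_le_mul_of_nonneg_right (eta_abs _ _) (by positivity)
      _ = 2 * volume.real (Metric.ball (0:E2) 1) / I1 * ((((1:ℝ) / 2) ^ n) ^ 2 * I1 / 2) := by
          field_simp
      _ ≤ _ := mul_le_mul_of_nonneg_left h1 (by positivity)
end NT

namespace NT
open MeasureTheory Filter Topology

def nn (B : AffineBasis (Fin 3) ℝ E2) (k : Fin 3) : E2 := (InnerProductSpace.toDual ℝ E2).symm (cl B k)

lemma nn_inner (B : AffineBasis (Fin 3) ℝ E2) (k : Fin 3) (w : E2) : inner ℝ (nn B k) w = cl B k w :=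
  InnerProductSpace.toDual_symm_apply

lemma coord_self (B : AffineBasis (Fin 3) ℝ E2) (k : Fin 3) : B.coord k (B k) = 1 := by simp
lemma coord_ne (B : AffineBasis (Fin 3) ℝ E2) {k j : Fin 3} (h : k ≠ j) : B.coord k (B j) = 0 := by
  simp [AffineBasis.coord_apply, h]

lemma k1_ne (k : Fin 3) : k ≠ k + 1 := by fin_cases k <;> decide

lemma cl_one (B : AffineBasis (Fin 3) ℝ E2) (k : Fin 3) : cl B k (B k - B (k+1)) = 1 := by
  rw [cl_apply, coord_lin_sub, coord_self, coord_ne B (k1_ne k)]; ring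

lemma nn_ne (B : AffineBasis (Fin 3) ℝ E2) (k : Fin 3) : nn B k ≠ 0 := by
  intro h
  have := nn_inner B k (B k - B (k+1))
  rw [h, inner_zero_left, cl_one] at this
  norm_num at this

def SS (B : AffineBasis (Fin 3) ℝ E2) (k : Fin 3) : E2 ≃ₗᵢ[ℝ] E2 := (ℝ ∙ nn B k)ᗮ.reflection

lemma SS_apply (B : AffineBasis (Fin 3) ℝ E2) (k : Fin 3) (w : E2) :
    SS B k w = w - (2 * (cl B k w / ‖nn B k‖ ^ 2)) • nn B k := by
  unfold SS
  rw [Submodule.reflection_orthogonal_apply, Submodule.reflection_singleton_apply, nn_inner]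
  rw [← neg_sub, neg_neg, two_smul, mul_smul, two_smul]
  simp

lemma cl_SS (B : AffineBasis (Fin 3) ℝ E2) (k : Fin 3) (w : E2) : cl B k (SS B k w) = - cl B k w := by
  have h : cl B k (nn B k) = ‖nn B k‖ ^ 2 := by rw [← nn_inner, real_inner_self_eq_norm_sq]
  have h0 : ‖nn B k‖ ≠ 0 := norm_ne_zero_iff.2 (nn_ne B k)
  rw [SS_apply, map_sub, map_smul, h, smul_eq_mul]
  field_simp; ring

lemma SS_fix (B : AffineBasis (Fin 3) ℝ E2) (k : Fin 3) {w : E2} (h : cl B k w = 0) : SS B k w = w := by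
  rw [SS_apply, h]; simp

lemma SS_SS (B : AffineBasis (Fin 3) ℝ E2) (k : Fin 3) (w : E2) : SS B k (SS B k w) = w :=
  Submodule.reflection_reflection _ w

lemma SS_adj (B : AffineBasis (Fin 3) ℝ E2) (k : Fin 3) (v w : E2) :
    inner ℝ (SS B k v) w = inner ℝ v (SS B k w) := by
  rw [← LinearIsometryEquiv.inner_map_map (SS B k), SS_SS]

def sgc (B : AffineBasis (Fin 3) ℝ E2) (k : Fin 3) : E2 := B (k+1) - SS B k (B (k+1))
def sg (B : AffineBasis (Fin 3) ℝ E2) (k : Fin 3) (p : E2) : E2 := SS B k p + sgc B k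

lemma sg_sub (B : AffineBasis (Fin 3) ℝ E2) (k : Fin 3) (p q : E2) : sg B k p - sg B k q = SS B k (p - q) := by
  simp [sg, map_sub]

lemma sg_B (B : AffineBasis (Fin 3) ℝ E2) (k : Fin 3) : sg B k (B (k+1)) = B (k+1) := by
  simp [sg, sgc]

lemma sg_sg (B : AffineBasis (Fin 3) ℝ E2) (k : Fin 3) (p : E2) : sg B k (sg B k p) = p := by
  have h1 := sg_sub B k (sg B k p) (B (k+1))
  have h2 := sg_sub B k p (B (k+1))
  rw [sg_B] at h1 h2
  rw [h2, SS_SS] at h1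
  exact sub_left_injective h1

lemma coord_sg (B : AffineBasis (Fin 3) ℝ E2) (k : Fin 3) (p : E2) :
    B.coord k (sg B k p) = - B.coord k p := by
  have h1 := coord_eq_cl B k (B (k+1)) (sg B k p)
  have h2 := coord_eq_cl B k (B (k+1)) p
  have h3 := sg_sub B k p (B (k+1))
  rw [sg_B] at h3
  rw [h3, cl_SS, coord_ne B (k1_ne k)] at h1
  rw [coord_ne B (k1_ne k)] at h2
  linarith

lemma sg_fix (B : AffineBasis (Fin 3) ℝ E2) (k : Fin 3) {p : E2} (h : B.coord k p = 0) : sg B k p = p := by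
  have h2 := coord_eq_cl B k (B (k+1)) p
  have h3 := sg_sub B k p (B (k+1))
  rw [sg_B, SS_fix] at h3
  · exact sub_left_injective h3
  · rw [coord_ne B (k1_ne k), h] at h2; linarith

lemma sg_iso (B : AffineBasis (Fin 3) ℝ E2) (k : Fin 3) : Isometry (sg B k) := by
  apply Isometry.of_dist_eq
  intro x y
  rw [dist_eq_norm, sg_sub, LinearIsometryEquiv.norm_map, dist_eq_norm]

lemma sg_mp (B : AffineBasis (Fin 3) ℝ E2) (k : Fin 3) : MeasurePreserving (sg B k) :=
  (measurePreserving_add_right volume (sgc B k)).comp (SS B k).measurePreserving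

lemma sg_me (B : AffineBasis (Fin 3) ℝ E2) (k : Fin 3) : MeasurableEmbedding (sg B k) :=
  (measurableEmbedding_addRight (sgc B k)).comp (SS B k).toHomeomorph.measurableEmbedding

lemma sg_cd (B : AffineBasis (Fin 3) ℝ E2) (k : Fin 3) {n : WithTop ℕ∞} : ContDiff ℝ n (sg B k) :=
  ((SS B k).toContinuousLinearEquiv.contDiff).add contDiff_const

lemma sg_fd (B : AffineBasis (Fin 3) ℝ E2) (k : Fin 3) (p : E2) :
    HasFDerivAt (sg B k) ((SS B k).toContinuousLinearEquiv : E2 →L[ℝ] E2) p :=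
  ((SS B k).toContinuousLinearEquiv.hasFDerivAt).add_const _

def Om (B : AffineBasis (Fin 3) ℝ E2) (k : Fin 3) : Set E2 :=
  {p | (∀ j, j ≠ k → 0 < B.coord j p) ∧ (0 < B.coord k p ∨ ∀ j, j ≠ k → 0 < B.coord j (sg B k p))}

lemma Om_open (B : AffineBasis (Fin 3) ℝ E2) (k : Fin 3) : IsOpen (Om B k) := by
  have hs := (sg_iso B k).continuous
  have h1 : ∀ j, IsOpen {p | j ≠ k → 0 < B.coord j p} := by
    intro j
    by_cases h : j = k
    · simp [h]
    · simp only [ne_eq, h, not_false_eq_true, forall_const]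
      exact isOpen_lt continuous_const (cont_coord B j)
  have h2 : ∀ j, IsOpen {p | j ≠ k → 0 < B.coord j (sg B k p)} := by
    intro j
    by_cases h : j = k
    · simp [h]
    · simp only [ne_eq, h, not_false_eq_true, forall_const]
      exact isOpen_lt continuous_const ((cont_coord B j).comp hs)
  have e : Om B k = (⋂ j, {p | j ≠ k → 0 < B.coord j p}) ∩
     ({p | 0 < B.coord k p} ∪ ⋂ j, {p | j ≠ k → 0 < B.coord j (sg B k p)}) := by
    ext p; simp [Om]
  rw [e]
  exact (isOpen_iInter_of_finite h1).inter
    ((isOpen_lt continuous_const (cont_coord B k)).union (isOpen_iInter_of_finite h2))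

lemma int_Om (B : AffineBasis (Fin 3) ℝ E2) (k : Fin 3) : interior (TT B) ⊆ Om B k := by
  intro p hp
  rw [mem_int_TT] at hp
  exact ⟨fun j _ => hp j, Or.inl (hp k)⟩

def uT (B : AffineBasis (Fin 3) ℝ E2) (u : E2 → ℝ) : E2 → ℝ := (TT B).indicator u
def wk (B : AffineBasis (Fin 3) ℝ E2) (u : E2 → ℝ) (k : Fin 3) (y : E2) : ℝ :=
  uT B u y + uT B u (sg B k y)

lemma wk_sg (B : AffineBasis (Fin 3) ℝ E2) (u : E2 → ℝ) (k : Fin 3) (y : E2) :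
    wk B u k (sg B k y) = wk B u k y := by
  simp [wk, sg_sg, add_comm]

variable {B : AffineBasis (Fin 3) ℝ E2} {m : ℝ} {u : E2 → ℝ} {g : E2 → E2}

lemma Weak.int (h : Weak B m u g) : IntegrableOn u (TT B) := h.u2.integrable (by norm_num)
lemma Weak.intg (h : Weak B m u g) : IntegrableOn g (TT B) := h.g2.integrable (by norm_num)
lemma Weak.uTi (h : Weak B m u g) : Integrable (uT B u) := h.int.integrable_indicator (meas_TT B)
lemma Weak.uTsi (h : Weak B m u g) (k) : Integrable (fun y => uT B u (sg B k y)) :=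
  (sg_mp B k).integrable_comp_of_integrable h.uTi
lemma Weak.wki (h : Weak B m u g) (k) : Integrable (wk B u k) := h.uTi.add (h.uTsi k)

lemma wk_split (h : Weak B m u g) (k) {F : E2 → ℝ} (hF : Continuous F) (hb : HasCompactSupport F) :
    ∫ y, wk B u k y * F y = ∫ y in TT B, u y * (F y + F (sg B k y)) := by
  obtain ⟨C, hC⟩ := hb.exists_bound_of_continuous hF
  have e : ∀ y, wk B u k y * F y = uT B u y * F y + uT B u (sg B k y) * F y := fun y => by
    rw [wk]; ring
  have i1 : Integrable fun y => uT B u y * F y :=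
    h.uTi.mul_bdd hF.aestronglyMeasurable (Eventually.of_forall hC)
  have i2 : Integrable fun y => uT B u (sg B k y) * F y :=
    (h.uTsi k).mul_bdd hF.aestronglyMeasurable (Eventually.of_forall hC)
  have i3 : Integrable fun y => uT B u y * F (sg B k y) :=
    h.uTi.mul_bdd (hF.comp (sg_iso B k).continuous).aestronglyMeasurable
      (Eventually.of_forall fun y => hC _)
  simp_rw [e]
  rw [integral_add i1 i2, ← (sg_mp B k).integral_comp (sg_me B k) (fun y => uT B u (sg B k y) * F y)]
  simp only [sg_sg]
  rw [← integral_add i1 i3, ← integral_indicator (meas_TT B)]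
  congr 1; ext y
  by_cases hy : y ∈ TT B
  · simp [uT, hy]; ring
  · simp [uT, hy]

lemma dvg_trace (X : E2 → E2) (p : E2) : dvg X p = LinearMap.trace ℝ E2 (fderiv ℝ X p : E2 →ₗ[ℝ] E2) := by
  rw [trace_ee]; rfl

lemma dvg_refl {X : E2 → E2} (hX : ContDiff ℝ 1 X) (k : Fin 3) (p : E2) :
    dvg (fun q => SS B k (X (sg B k q))) p = dvg X (sg B k p) := by
  have h1 : HasFDerivAt (fun q => SS B k (X (sg B k q)))
     ((((SS B k).toContinuousLinearEquiv : E2 →L[ℝ] E2)).comp ((fderiv ℝ X (sg B k p)).comp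
       ((SS B k).toContinuousLinearEquiv : E2 →L[ℝ] E2))) p :=
    (((SS B k).toContinuousLinearEquiv : E2 →L[ℝ] E2).hasFDerivAt (x := X (sg B k p))).comp p
      (((hX.differentiable one_ne_zero) (sg B k p)).hasFDerivAt.comp p (sg_fd B k p))
  rw [dvg_trace, dvg_trace, h1.fderiv]
  have := LinearMap.trace_conj' (fderiv ℝ X (sg B k p) : E2 →ₗ[ℝ] E2) (SS B k).toLinearEquiv
  rw [← this]
  congr 1

lemma refl_wg (h : Weak B m u g) (k : Fin 3) {X : E2 → E2} (hX : ContDiff ℝ 1 X)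
    (hc : HasCompactSupport X) (hs : ∀ p, p ∉ Om B k → X p = 0) :
    ∫ y, wk B u k y * dvg X y = - ∫ y in TT B, inner ℝ (g y) (X y + SS B k (X (sg B k y))) := by
  have hcs : HasCompactSupport (dvg X) := by
    have := hc.fderiv ℝ
    refine this.mono ?_
    intro p hp
    rw [Function.mem_support] at hp ⊢
    intro h0; apply hp; unfold dvg; rw [h0]; simp
  rw [wk_split h k (dvg_cont hX) hcs]
  have hY : ContDiff ℝ 1 (fun q => SS B k (X (sg B k q))) :=
    ((SS B k).toContinuousLinearEquiv.contDiff).comp (hX.comp (sg_cd B k))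
  rw [← h.wg (fun y => X y + SS B k (X (sg B k y))) (hX.add hY)]
  · congr 1; ext y; congr 1
    rw [← dvg_refl hX k y]
    unfold dvg
    rw [fderiv_fun_add (hX.differentiable one_ne_zero y) (hY.differentiable one_ne_zero y)]
    simp; ring
  · intro i p hp h0
    by_cases hik : i = k
    · subst hik
      rw [sg_fix B i h0, map_add, cl_SS]; ring
    · rw [hs p, hs (sg B k p)]
      · simp
      · rintro ⟨h1, h2⟩
        rcases h2 with h2 | h2
        · rw [coord_sg] at h2
          have := (mem_TT B).1 hp k; linarith
        · have := h2 i hik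
          rw [sg_sg, h0] at this; exact lt_irrefl _ this
      · rintro ⟨h1, h2⟩
        have := h1 i hik
        rw [h0] at this; exact lt_irrefl _ this

lemma gr_cd {f : E2 → ℝ} (hf : ContDiff ℝ smo f) : ContDiff ℝ 1 (gr f) :=
  ((InnerProductSpace.toDual ℝ E2).symm.toContinuousLinearEquiv.contDiff).comp
    (hf.fderiv_right (m := 1) smo11)

lemma gr_apply (f : E2 → ℝ) (p : E2) (i : Fin 2) : (gr f p) i = fderiv ℝ f p (ee i) := by
  rw [← gr_inner]; simp [ee, PiLp.inner_apply]

lemma lap_dvg {f : E2 → ℝ} {p : E2} (hf : DifferentiableAt ℝ (gr f) p) : dvg (gr f) p = lap f p := by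
  have : ∀ i, (fderiv ℝ (gr f) p (ee i)) i = mixedDeriv f p (ee i) (ee i) := by
    intro i
    unfold mixedDeriv
    have h := ((EuclideanSpace.proj i : E2 →L[ℝ] ℝ).hasFDerivAt (x := gr f p)).comp p hf.hasFDerivAt
    have e : (fun y => fderiv ℝ f y (ee i)) = (EuclideanSpace.proj i : E2 →L[ℝ] ℝ) ∘ gr f :=
      funext fun y => (gr_apply f y i).symm
    rw [e, h.fderiv]; rfl
  unfold dvg lap
  rw [this, this]

lemma gr_sg {f : E2 → ℝ} (hf : Differentiable ℝ f) (k : Fin 3) (p : E2) :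
    gr (fun q => f (sg B k q)) p = SS B k (gr f (sg B k p)) := by
  apply ext_inner_right ℝ
  intro w
  rw [gr_inner, SS_adj, gr_inner]
  have := ((hf (sg B k p)).hasFDerivAt.comp p (sg_fd B k p)).fderiv
  have e : (fun q => f (sg B k q)) = f ∘ sg B k := rfl
  rw [e, this]; rfl

lemma weakOn_wk (h : Weak B m u g) (k : Fin 3) : WeakOn m (wk B u k) (Om B k) := by
  intro ψ hψ hc hs
  have hgc : ContDiff ℝ 1 (gr ψ) := gr_cd hψ
  have hd : Differentiable ℝ ψ := hψ.differentiable (by simp [smo])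
  have h0 : ∀ p, fderiv ℝ ψ p = 0 → gr ψ p = 0 := fun p hp => by simp [gr, hp]
  have hgs : HasCompactSupport (gr ψ) := by
    refine (hc.fderiv ℝ).mono ?_
    intro p hp
    rw [Function.mem_support] at hp ⊢
    exact fun h1 => hp (h0 p h1)
  have h1 := refl_wg h k hgc hgs (fun p hp => h0 p (by
    by_contra hne
    exact hp (hs (support_fderiv_subset ℝ hne))))
  have hψs : ContDiff ℝ 1 (fun q => ψ (sg B k q)) := (hψ.of_le smo1).comp (sg_cd B k)
  have h2 := h.el (ψ + fun q => ψ (sg B k q)) ((hψ.of_le smo1).add hψs)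
  rw [gr_add (hψ.of_le smo1) hψs] at h2
  have h3 := wk_split h k hψ.continuous hc
  simp only [lap_dvg (hgc.differentiable one_ne_zero _)] at h1
  simp only [Pi.add_apply, gr_sg hd] at h2
  obtain ⟨C, hC⟩ := hc.exists_bound_of_continuous hψ.continuous
  have i1 : Integrable fun y => wk B u k y * ψ y :=
    (h.wki k).mul_bdd hψ.continuous.aestronglyMeasurable (Eventually.of_forall hC)
  obtain ⟨C', hC'⟩ := (lap_cs hc).exists_bound_of_continuous (lap_cont hψ)
  have i2 : Integrable fun y => wk B u k y * lap ψ y :=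
    (h.wki k).mul_bdd (lap_cont hψ).aestronglyMeasurable (Eventually.of_forall hC')
  have e : ∀ y, wk B u k y * (lap ψ y + m * ψ y) = wk B u k y * lap ψ y + m * (wk B u k y * ψ y) :=
    fun y => by ring
  simp_rw [e]
  rw [integral_add i2 (i1.const_mul m), integral_const_mul, h1, h2, h3]
  ring

end NT

namespace NT
open MeasureTheory Filter Topology

variable {B : AffineBasis (Fin 3) ℝ E2} {m : ℝ} {u : E2 → ℝ} {g : E2 → E2}

lemma sg_closer (B : AffineBasis (Fin 3) ℝ E2) (k : Fin 3) {y z : E2} (hy : B.coord k y ≤ 0)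
    (hz : 0 ≤ B.coord k z) : ‖sg B k y - z‖ ≤ ‖y - z‖ := by
  have h0 : 0 < ‖nn B k‖ := norm_pos_iff.2 (nn_ne B k)
  set c : ℝ := 2 * (B.coord k y / ‖nn B k‖ ^ 2) with hc
  have e : sg B k y - z = (y - z) - c • nn B k := by
    have h1 := sg_sub B k y (B (k+1))
    have h2 := coord_eq_cl B k (B (k+1)) y
    rw [coord_ne B (k1_ne k), zero_add] at h2
    rw [sg_B, SS_apply, ← h2, ← hc] at h1
    have : sg B k y = y - c • nn B k := by
      have := congrArg (· + B (k+1)) h1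
      simp only [sub_add_cancel] at this
      rw [this]; abel
    rw [this]; abel
  have h3 : ‖sg B k y - z‖ ^ 2 ≤ ‖y - z‖ ^ 2 := by
    rw [e, norm_sub_sq_real, inner_smul_right, real_inner_comm, nn_inner, norm_smul, mul_pow,
      Real.norm_eq_abs, sq_abs]
    have h4 := coord_eq_cl B k z y
    have h5 : cl B k (y - z) = B.coord k y - B.coord k z := by linarith
    rw [h5]
    have : 2 * (c * (B.coord k y - B.coord k z)) = c ^ 2 * ‖nn B k‖ ^ 2 - 4 * (B.coord k y * B.coord k z / ‖nn B k‖ ^ 2) := by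
      rw [hc]; field_simp; ring
    rw [this]
    have : B.coord k y * B.coord k z / ‖nn B k‖ ^ 2 ≤ 0 :=
      div_nonpos_of_nonpos_of_nonneg (mul_nonpos_of_nonpos_of_nonneg hy hz) (by positivity)
    linarith
  exact le_of_sq_le_sq h3 (norm_nonneg _) 

lemma W_eq (B : AffineBasis (Fin 3) ℝ E2) (m : ℝ) (u : E2 → ℝ) (k : Fin 3) {z : E2}
    (hz : z ∈ interior (TT B)) : Wf m (wk B u k) z = Wf m (uT B u) z := by
  obtain ⟨r, hr, hb⟩ := Metric.isOpen_iff.1 isOpen_interior z hz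
  refine Wf_congr hr fun y hy => ?_
  have h1 := (mem_int_TT B).1 (hb hy) k
  have : sg B k y ∉ TT B := fun h => by
    have := (mem_TT B).1 h k
    rw [coord_sg] at this; linarith
  simp [wk, uT, this]

lemma exM (B : AffineBasis (Fin 3) ℝ E2) : ∃ M : ℝ, 0 < M ∧ ∀ a w, |cl B a w| ≤ M * ‖w‖ := by
  refine ⟨∑ a, ‖cl B a‖ + 1, ?_, ?_⟩
  · have : 0 ≤ ∑ a, ‖cl B a‖ := Finset.sum_nonneg fun _ _ => norm_nonneg _
    linarith
  · intro a w
    have h1 : ‖cl B a‖ ≤ ∑ a, ‖cl B a‖ :=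
      Finset.single_le_sum (f := fun a => ‖cl B a‖) (fun _ _ => norm_nonneg _) (Finset.mem_univ a)
    calc |cl B a w| ≤ ‖cl B a‖ * ‖w‖ := (cl B a).le_opNorm w
      _ ≤ _ := mul_le_mul_of_nonneg_right (by linarith) (norm_nonneg _)

lemma ball_Om {M : ℝ} (hM : ∀ a w, |cl B a w| ≤ M * ‖w‖) {i j k : Fin 3} (hij : i ≠ j)
    (hik : i ≠ k) (hjk : j ≠ k) {z : E2} (hz : z ∈ TT B) {ℓ r : ℝ} (hℓ : ℓ = 1 - B.coord i z)
    (h0 : 0 < ℓ) (h1 : ℓ ≤ 1 / 2) (hj : ℓ / 2 ≤ B.coord j z) (hM0 : 0 < M) (hr : M * r ≤ ℓ / 4) :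
    Metric.closedBall z r ⊆ Om B k := by
  have key : ∀ y, ‖y - z‖ ≤ r → ∀ a, a ≠ k → 0 < B.coord a y := by
    intro y hy a ha
    have h2 := coord_eq_cl B a z y
    have h3 := (hM a (y - z)).trans (mul_le_mul_of_nonneg_left hy hM0.le)
    have h4 := (abs_le.1 h3).1
    have : a = i ∨ a = j := by omega
    rcases this with rfl | rfl
    · linarith
    · linarith
  intro y hy
  rw [Metric.mem_closedBall, dist_eq_norm] at hy
  refine ⟨key y hy, ?_⟩
  by_cases h : 0 < B.coord k y
  · exact Or.inl h
  · exact Or.inr (key _ ((sg_closer B k (not_lt.1 h) ((mem_TT B).1 hz k)).trans hy))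

def GG (B : AffineBasis (Fin 3) ℝ E2) (i : Fin 3) (g : E2 → E2) (s : ℝ) : ℝ :=
  ∫ y in TT B, ({y | 1 - B.coord i y ≤ s} : Set E2).indicator (fun y => ‖g y‖ ^ 2) y

lemma Weak.gsq (h : Weak B m u g) : IntegrableOn (fun y => ‖g y‖ ^ 2) (TT B) :=
  h.g2.integrable_norm_pow (by norm_num)

lemma meas_K (B : AffineBasis (Fin 3) ℝ E2) (i : Fin 3) (s : ℝ) :
    MeasurableSet ({y | 1 - B.coord i y ≤ s} : Set E2) :=
  (isClosed_le (continuous_const.sub (cont_coord B i)) continuous_const).measurableSet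

lemma GG_tendsto (h : Weak B m u g) (i : Fin 3) : Tendsto (GG B i g) (𝓝[>] 0) (𝓝 0) := by
  have : (0:ℝ) = ∫ y in TT B, (0:ℝ) := by simp
  suffices hh : Tendsto (GG B i g) (𝓝[>] 0) (𝓝 (∫ y in TT B, (0:ℝ))) by rwa [← this] at hh
  unfold GG
  refine tendsto_integral_filter_of_dominated_convergence (fun y => ‖g y‖ ^ 2) ?_ ?_ h.gsq ?_
  · exact Eventually.of_forall fun s => (h.gsq.aestronglyMeasurable).indicator (meas_K B i s)
  · refine Eventually.of_forall fun s => Eventually.of_forall fun y => ?_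
    by_cases hy : y ∈ ({y | 1 - B.coord i y ≤ s} : Set E2)
    · rw [indicator_of_mem hy]; simp
    · rw [indicator_of_notMem hy]; simp
  · have h1 : ∀ᵐ y ∂(volume.restrict (TT B)), y ≠ B i := by
      apply ae_restrict_of_ae
      rw [ae_iff]; simp
    filter_upwards [h1, ae_restrict_mem (meas_TT B)] with y hy hyT
    have h2 : 0 < 1 - B.coord i y := by
      have h0 := (mem_TT B).1 hyT
      have hs := coord_sum B y
      by_contra hc
      apply hy
      apply coord_ext B
      intro a
      have := h0 0; have := h0 1; have := h0 2
      by_cases hai : a = i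
      · subst hai; rw [coord_self]
        fin_cases a <;> simp at * <;> linarith
      · rw [coord_ne B hai]
        fin_cases a <;> fin_cases i <;> simp at * <;> linarith
    apply tendsto_const_nhds.congr'
    filter_upwards [Ioo_mem_nhdsGT h2] with s hs
    rw [indicator_of_notMem]
    simp only [mem_ofPred_eq, not_le]
    exact hs.2

lemma dV_bound (h : Weak B m u g) (i k : Fin 3) {ε s τ : ℝ} (hε : 0 < ε) (hτ : 0 < τ) {z : E2}
    (hz : z ∈ TT B) (hb : Metric.closedBall z ε ⊆ Om B k)
    (hs : ∀ y ∈ TT B, ‖y - z‖ ≤ ε → 1 - B.coord i y ≤ s) (b : E2) :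
    |fderiv ℝ (Vf (wk B u k) ε) z b| ≤ ε * (GG B i g s / τ + I1 * τ) * ‖b‖ := by
  set f : E2 → ℝ := fun y => eta ε (z - y) with hf
  have hfs : ContDiff ℝ smo f := (eta_smooth ε).comp (contDiff_const.sub contDiff_id)
  have hfd : Differentiable ℝ f := hfs.differentiable (by simp [smo])
  have hfc : HasCompactSupport f := HasCompactSupport.of_support_subset_isCompact
    (isCompact_closedBall z ε) (subset_closure.trans (tsupport_eta hε z))
  have hX : ContDiff ℝ 1 (fun y => f y • b) := (hfs.of_le smo1).smul contDiff_const
  have e1 : ∀ y, dvg (fun y => f y • b) y = - fderiv ℝ (eta ε) (z - y) b := by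
    intro y
    have := dvg_smul (X := fun _ => b) (hfd y) (differentiableAt_const b)
    rw [this]
    have h2 : dvg (fun _ => b) y = 0 := by simp [dvg]
    rw [h2, mul_zero, zero_add]
    have := fderiv_aff (eta ε) (ContinuousLinearEquiv.neg ℝ) z y b
    simp only [ContinuousLinearEquiv.coe_neg, Pi.neg_apply, id] at this
    simp only [hf, sub_eq_neg_add, this, map_neg]
  have h1 := refl_wg h k hX (hfc.smul_right) (by
    intro p hp
    have : f p = 0 := by
      apply eta_zero hε
      by_contra hc
      apply hp; apply hb
      rw [Metric.mem_closedBall, dist_comm, dist_eq_norm]; linarith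
    simp [this])
  simp only [e1, mul_neg, integral_neg, neg_inj] at h1
  have h2 : fderiv ℝ (Vf (wk B u k) ε) z b =
      ∫ y in TT B, inner ℝ (g y) (f y • b + SS B k (f (sg B k y) • b)) := by
    rw [← h1, Vf, Cv_fderiv (h.wki k) ((eta_smooth ε).of_le smo1) (eta_cs hε)]
    rfl
  have hfi : Integrable f := (eta_int hε).comp_sub_left z
  have hfi2 : Integrable (fun y => f (sg B k y)) := (sg_mp B k).integrable_comp_of_integrable hfi
  have hf0 : ∀ y, 0 ≤ f y := fun y => eta_nonneg _ _
  have hf1 : ∀ y, f y ≤ 1 := fun y => eta_le_one _ _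
  have hI1 : ∫ y, f y = ε ^ 2 * I1 := by
    rw [← eta_scale hε]; exact integral_sub_left_eq_self (eta ε) volume z
  have hI2 : ∫ y, f (sg B k y) = ε ^ 2 * I1 := by
    rw [(sg_mp B k).integral_comp (sg_me B k) f, hI1]
  set t := ε / τ with ht
  have ht0 : 0 < t := div_pos hε hτ
  set K : Set E2 := {y | 1 - B.coord i y ≤ s} with hK
  have iG : IntegrableOn (K.indicator fun y => ‖g y‖ ^ 2) (TT B) := h.gsq.indicator (meas_K B i s)
  have hff : Integrable (fun y => f y + f (sg B k y)) := hfi.add hfi2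
  have iR : IntegrableOn (fun y => (t * K.indicator (fun y => ‖g y‖ ^ 2) y +
      (f y + f (sg B k y)) * (1 / (2 * t))) * ‖b‖) (TT B) :=
    ((iG.const_mul t).add ((hfi.add hfi2).integrableOn.mul_const _)).mul_const _
  rw [h2, ← Real.norm_eq_abs]
  refine (norm_integral_le_of_norm_le iR ?_).trans ?_
  · filter_upwards [ae_restrict_mem (meas_TT B)] with y hy
    have n1 : ‖f y • b + SS B k (f (sg B k y) • b)‖ ≤ (f y + f (sg B k y)) * ‖b‖ := by
      refine (norm_add_le _ _).trans ?_
      rw [LinearIsometryEquiv.norm_map, norm_smul, norm_smul, Real.norm_of_nonneg (hf0 _),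
        Real.norm_of_nonneg (hf0 _), add_mul]
    refine (norm_inner_le_norm _ _).trans ((mul_le_mul_of_nonneg_left n1 (norm_nonneg _)).trans ?_)
    rw [← mul_assoc]
    refine mul_le_mul_of_nonneg_right ?_ (norm_nonneg _)
    have amgm : ∀ x : ℝ, 0 ≤ x → x ≤ 1 → ‖g y‖ * x ≤ t * ‖g y‖ ^ 2 / 2 + x * (1 / (2 * t)) := by
      intro x hx0 hx1
      have q1 : 0 ≤ (t * ‖g y‖ - x) ^ 2 / (2 * t) := by positivity
      have q2 : (t * ‖g y‖ - x) ^ 2 / (2 * t) = t * ‖g y‖ ^ 2 / 2 - ‖g y‖ * x + x ^ 2 * (1 / (2 * t)) := by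
        field_simp; ring
      have q3 : x ^ 2 * (1 / (2 * t)) ≤ x * (1 / (2 * t)) :=
        mul_le_mul_of_nonneg_right (by nlinarith) (by positivity)
      linarith
    by_cases hyK : y ∈ K
    · rw [indicator_of_mem hyK]
      have := amgm _ (hf0 y) (hf1 y)
      have := amgm _ (hf0 (sg B k y)) (hf1 (sg B k y))
      linarith
    · have z1 : f y = 0 := by
        apply eta_zero hε
        by_contra hc
        apply hyK
        apply hs y hy
        rw [norm_sub_rev]; linarith
      have z2 : f (sg B k y) = 0 := by
        apply eta_zero hε
        by_contra hc
        apply hyK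
        apply hs y hy
        have := sg_closer B k (y := sg B k y) (z := z) (by
          rw [coord_sg]; have := (mem_TT B).1 hy k; linarith) ((mem_TT B).1 hz k)
        rw [sg_sg, norm_sub_rev (sg B k y)] at this
        linarith
      rw [indicator_of_notMem hyK, z1, z2]; simp
  · rw [integral_mul_const, integral_add (iG.const_mul t) (hff.integrableOn.mul_const _),
      integral_const_mul, integral_mul_const]
    refine mul_le_mul_of_nonneg_right ?_ (norm_nonneg _)
    have q : ∫ y in TT B, (f y + f (sg B k y)) ≤ 2 * (ε ^ 2 * I1) := by
      refine (setIntegral_le_integral hff (Eventually.of_forall fun y => ?_)).trans ?_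
      · exact add_nonneg (hf0 _) (hf0 _)
      · rw [integral_add hfi hfi2, hI1, hI2]; linarith
    have q2 := mul_le_mul_of_nonneg_right q (by positivity : 0 ≤ 1 / (2 * t))
    have q3 : 2 * (ε ^ 2 * I1) * (1 / (2 * t)) = ε * (I1 * τ) := by rw [ht]; field_simp
    have q4 : t * GG B i g s = ε * (GG B i g s / τ) := by rw [ht]; field_simp
    change t * GG B i g s + _ ≤ _
    linarith

lemma grad_bound (h : Weak B m u g) (hm : 0 < m) (i k : Fin 3) {ε s τ : ℝ} (hε : 0 < ε)
    (hse : Real.sqrt m * ε ≤ 1) (hτ : 0 < τ) {z : E2}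
    (hz : z ∈ interior (TT B)) (hb : Metric.closedBall z (3 * ε) ⊆ Om B k)
    (hs : ∀ y ∈ TT B, ‖y - z‖ ≤ ε → 1 - B.coord i y ≤ s) :
    ‖fderiv ℝ (Wf m (uT B u)) z‖ ≤ 2 / (I1 * ε) * (GG B i g s / τ + I1 * τ) := by
  have hI := I1_pos
  have hG : 0 ≤ GG B i g s := integral_nonneg fun y => indicator_nonneg (fun y _ => by positivity) y
  have e1 : Wf m (uT B u) =ᶠ[𝓝 z] fun q => (cc m ε)⁻¹ * Vf (wk B u k) ε q := by
    filter_upwards [isOpen_interior.mem_nhds hz, Metric.ball_mem_nhds z hε] with q hq hq2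
    rw [← W_eq B m u k hq, Wf_eq (h.wki k) hm hε hse (weakOn_wk h k), div_eq_inv_mul]
    refine subset_trans (Metric.closedBall_subset_closedBall' ?_) hb
    rw [Metric.mem_ball] at hq2; linarith
  have hc := cc_pos (m := m) hε hse
  have hd : DifferentiableAt ℝ (Vf (wk B u k) ε) z :=
    (Vf_smooth (h.wki k) hε).differentiable (by simp [smo]) z
  rw [e1.fderiv_eq, fderiv_const_mul hd]
  refine ContinuousLinearMap.opNorm_le_bound _ (by positivity) fun b => ?_
  have h1 := dV_bound h i k hε hτ (interior_subset hz)
    ((Metric.closedBall_subset_closedBall (by linarith)).trans hb) hs b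
  rw [_root_.smul_apply, smul_eq_mul, Real.norm_eq_abs, abs_mul, abs_of_pos (inv_pos.2 hc)]
  have h2 : (cc m ε)⁻¹ ≤ (ε ^ 2 * I1 / 2)⁻¹ := inv_anti₀ (by positivity) (cc_half hε hse)
  calc _ ≤ (ε ^ 2 * I1 / 2)⁻¹ * (ε * (GG B i g s / τ + I1 * τ) * ‖b‖) :=
        mul_le_mul h2 h1 (abs_nonneg _) (by positivity)
    _ = _ := by field_simp

lemma grad_small (h : Weak B m u g) (hm : 0 < m) (i : Fin 3) {δ : ℝ} (hδ : 0 < δ) :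
    ∃ s0 > 0, ∀ z ∈ interior (TT B), 1 - B.coord i z < s0 →
      ‖fderiv ℝ (Wf m (uT B u)) z‖ ≤ δ / (1 - B.coord i z) := by
  obtain ⟨M, hM0, hM⟩ := exM B
  have hI := I1_pos
  set κ := 1 / (12 * M) with hκ
  have hκ0 : 0 < κ := by positivity
  set τ := δ * κ / 4 with hτ
  have hτ0 : 0 < τ := by positivity
  have hgt := (GG_tendsto h i).eventually_lt_const (u := I1 * τ ^ 2) (by positivity)
  obtain ⟨r, hr0, hr⟩ := mem_nhdsGT_iff_exists_Ioo_subset.1 hgt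
  rw [mem_Ioi] at hr0
  have hsm : 0 < Real.sqrt m := Real.sqrt_pos.2 hm
  refine ⟨min (1/2) (min (r / 2) (1 / (Real.sqrt m * κ))), by positivity, ?_⟩
  intro z hz hzs
  set ℓ := 1 - B.coord i z with hℓ
  have hz' := (mem_int_TT B).1 hz
  have hsum := coord_sum B z
  have hs1 := hzs.trans_le (min_le_left _ _)
  have hs2 := hzs.trans_le ((min_le_right _ _).trans (min_le_left _ _))
  have hs3 := hzs.trans_le ((min_le_right _ _).trans (min_le_right _ _))
  have hjk : ∃ j k, i ≠ j ∧ i ≠ k ∧ j ≠ k ∧ ℓ / 2 ≤ B.coord j z := by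
    have : ∃ j k, i ≠ j ∧ i ≠ k ∧ j ≠ k ∧ B.coord i z + B.coord j z + B.coord k z = 1 := by
      fin_cases i
      · exact ⟨1, 2, by decide, by decide, by decide, by simpa using hsum⟩
      · exact ⟨0, 2, by decide, by decide, by decide, by simp; linarith⟩
      · exact ⟨0, 1, by decide, by decide, by decide, by simp; linarith⟩
    obtain ⟨j, k, h1, h2, h3, h4⟩ := this
    rcases le_total (B.coord j z) (B.coord k z) with h5 | h5
    · exact ⟨k, j, h2, h1, h3.symm, by linarith⟩
    · exact ⟨j, k, h1, h2, h3, by linarith⟩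
  obtain ⟨j, k, hij, hik, hjk, hj⟩ := hjk
  have hℓ0 : 0 < ℓ := by
    have : B.coord i z + B.coord j z ≤ 1 := by
      have h0 := hz' 0; have h1 := hz' 1; have h2 := hz' 2
      fin_cases i <;> fin_cases j <;> simp at * <;> linarith
    have := hz' j
    linarith
  have hMκ : M * (3 * (κ * ℓ)) ≤ ℓ / 4 := by rw [hκ]; apply le_of_eq; field_simp; norm_num
  have hb := ball_Om hM hij hik hjk (interior_subset hz) hℓ hℓ0 hs1.le hj hM0 hMκ
  have hse : Real.sqrt m * (κ * ℓ) ≤ 1 := by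
    rw [lt_div_iff₀ (by positivity)] at hs3; nlinarith
  have hG := hr (show 2 * ℓ ∈ Ioo 0 r from ⟨by linarith, by linarith⟩)
  simp only [mem_ofPred_eq] at hG
  have := grad_bound h hm i k (s := 2 * ℓ) (by positivity) hse hτ0 hz hb (by
    intro y _ hy
    have h2 := coord_eq_cl B i z y
    have h3 := (hM i (y - z)).trans (mul_le_mul_of_nonneg_left hy hM0.le)
    have h4 := (abs_le.1 h3).1
    have : M * (κ * ℓ) ≤ ℓ := by nlinarith
    linarith)
  refine this.trans ?_
  have h5 : GG B i g (2 * ℓ) / τ ≤ I1 * τ := by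
    rw [div_le_iff₀ hτ0]; nlinarith
  calc _ ≤ 2 / (I1 * (κ * ℓ)) * (I1 * τ + I1 * τ) :=
        mul_le_mul_of_nonneg_left (by linarith) (by positivity)
    _ = δ / ℓ := by rw [hτ]; field_simp; norm_num

end NT

namespace NT
open MeasureTheory Filter Topology

def PP (t : ℝ) : ℝ := Real.smoothTransition ((t - 1) / 3)
lemma PP_smooth : ContDiff ℝ smo PP :=
  Real.smoothTransition.contDiff.comp ((contDiff_id.sub contDiff_const).div_const _)
lemma PP_zero {t : ℝ} (h : t ≤ 1) : PP t = 0 := Real.smoothTransition.zero_of_nonpos (by linarith)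
lemma PP_one {t : ℝ} (h : 4 ≤ t) : PP t = 1 := Real.smoothTransition.one_of_one_le (by linarith)
lemma PP_mono : Monotone PP := fun a b hab => Real.smoothTransition.monotone (by linarith)
lemma PP_diff : Differentiable ℝ PP := PP_smooth.differentiable (by simp [smo])

def FF : ℝ → ℝ := deriv PP
lemma FF_cont : Continuous FF := (PP_smooth.of_le smo1).continuous_deriv le_rfl
lemma FF_nonneg (t : ℝ) : 0 ≤ FF t := PP_mono.deriv_nonneg
lemma FF_zero1 {t : ℝ} (h : t < 1) : FF t = 0 := by
  have : PP =ᶠ[𝓝 t] fun _ => 0 := by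
    filter_upwards [Iio_mem_nhds h] with x hx
    rw [mem_Iio] at hx; exact PP_zero hx.le
  rw [FF, this.deriv_eq]; simp
lemma FF_zero4 {t : ℝ} (h : 4 < t) : FF t = 0 := by
  have : PP =ᶠ[𝓝 t] fun _ => 1 := by
    filter_upwards [Ioi_mem_nhds h] with x hx
    rw [mem_Ioi] at hx; exact PP_one hx.le
  rw [FF, this.deriv_eq]; simp
lemma FF_pos : ∃ t, 1 < t ∧ 0 < FF t := by
  obtain ⟨c, hc, h⟩ := exists_deriv_eq_slope PP (by norm_num : (1:ℝ) < 4) PP_diff.continuous.continuousOn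
    PP_diff.differentiableOn
  refine ⟨c, hc.1, ?_⟩
  rw [FF, h, PP_zero le_rfl, PP_one le_rfl]; norm_num

def kk (t : ℝ) : ℝ := (PP t - PP (t / 4)) / (4 * t)
lemma kk_zero1 {t : ℝ} (h : t ≤ 1) : kk t = 0 := by
  rw [kk, PP_zero h, PP_zero (by linarith)]; simp
lemma kk_zero16 {t : ℝ} (h : 16 ≤ t) : kk t = 0 := by
  rw [kk, PP_one (by linarith), PP_one (by linarith)]; simp
lemma kk_mul (t : ℝ) : 4 * (t * kk t) = PP t - PP (t / 4) := by
  rcases le_or_gt t 1 with h | h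
  · rw [kk_zero1 h, PP_zero h, PP_zero (by linarith)]; simp
  · rw [kk]; field_simp
lemma kk_cd : ContDiff ℝ 1 kk := by
  rw [contDiff_iff_contDiffAt]
  intro t
  rcases lt_or_ge t 1 with h | h
  · have : kk =ᶠ[𝓝 t] fun _ => 0 := by
      filter_upwards [Iio_mem_nhds h] with x hx
      rw [mem_Iio] at hx; exact kk_zero1 hx.le
    exact contDiffAt_const.congr_of_eventuallyEq this
  · have hP := PP_smooth.of_le smo1
    exact (hP.sub (hP.comp (contDiff_id.div_const 4))).contDiffAt.div
      (contDiff_const.mul contDiff_id).contDiffAt (by simp; linarith)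
lemma kk_deriv (t : ℝ) : 4 * (kk t + t * deriv kk t) = FF t - FF (t / 4) / 4 := by
  have h1 : HasDerivAt (fun t => 4 * (t * kk t)) (4 * (1 * kk t + t * deriv kk t)) t :=
    ((hasDerivAt_id t).mul (kk_cd.differentiable one_ne_zero t).hasDerivAt).const_mul 4
  have h2 : HasDerivAt (fun t => PP t - PP (t / 4)) (FF t - FF (t / 4) * (1 / 4)) t :=
    (PP_diff t).hasDerivAt.sub
      (HasDerivAt.comp (h₂ := PP) (h := fun t : ℝ => t / 4) t (PP_diff (t / 4)).hasDerivAt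
        ((hasDerivAt_id t).div_const 4))
  have e : (fun t => 4 * (t * kk t)) = fun t => PP t - PP (t / 4) := funext kk_mul
  rw [e] at h1
  have := h1.unique h2
  linarith

def KK (t : ℝ) : ℝ := ∫ x in (16:ℝ)..t, kk x
lemma KK_deriv (t : ℝ) : HasDerivAt KK (kk t) t :=
  intervalIntegral.integral_hasDerivAt_right (kk_cd.continuous.intervalIntegrable _ _)
    (kk_cd.continuous.stronglyMeasurableAtFilter _ _) kk_cd.continuous.continuousAt
lemma KK_cd : ContDiff ℝ 1 KK := by
  rw [contDiff_one_iff_deriv]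
  refine ⟨fun t => (KK_deriv t).differentiableAt, ?_⟩
  have : deriv KK = kk := funext fun t => (KK_deriv t).deriv
  rw [this]; exact kk_cd.continuous
lemma KK_zero {t : ℝ} (h : 16 ≤ t) : KK t = 0 := by
  rw [KK]
  apply intervalIntegral.integral_zero_ae
  refine Eventually.of_forall fun x hx => kk_zero16 ?_
  rw [uIoc_of_le h] at hx; exact hx.1.le
lemma KK_bdd : ∃ C > 0, ∀ t, 0 ≤ t → |KK t| ≤ C := by
  obtain ⟨C, hC⟩ := (isCompact_Icc (a := (0:ℝ)) (b := 16)).exists_bound_of_continuousOn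
    KK_cd.continuous.continuousOn
  refine ⟨|C| + 1, by positivity, fun t ht => ?_⟩
  rcases le_or_gt t 16 with h | h
  · have := hC t ⟨ht, h⟩
    rw [Real.norm_eq_abs] at this
    have := le_abs_self C; linarith
  · rw [KK_zero h.le]; simp; positivity

def tt (v : E2) (s : ℝ) (x : E2) : ℝ := ‖x - v‖ ^ 2 / s ^ 2
def zet (v : E2) (s : ℝ) (x : E2) : ℝ := FF (tt v s x) / s ^ 2
def phi (v : E2) (s : ℝ) (x : E2) : ℝ := KK (tt v s x)
def XX (v : E2) (s : ℝ) (x : E2) : E2 := (2 / s ^ 2 * kk (tt v s x)) • (x - v)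

lemma tt_cd (v : E2) (s : ℝ) {n : WithTop ℕ∞} : ContDiff ℝ n (tt v s) :=
  ((contDiff_id.sub contDiff_const).norm_sq ℝ).div_const _

lemma tt_fd (v : E2) (s : ℝ) (x w : E2) : fderiv ℝ (tt v s) x w = 2 / s ^ 2 * inner ℝ (x - v) w := by
  have h1 : HasFDerivAt (fun x : E2 => ‖x - v‖ ^ 2) (2 • (innerSL ℝ (x - v)).comp (ContinuousLinearMap.id ℝ E2)) x :=
    ((hasFDerivAt_id x).sub_const v).norm_sq
  have h2 := (h1.mul_const ((s ^ 2)⁻¹)).fderiv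
  have e : tt v s = fun x => ‖x - v‖ ^ 2 * (s ^ 2)⁻¹ := by
    ext x; rw [tt, div_eq_mul_inv]
  rw [e, h2]
  simp [inner_sub_left]
  ring

lemma phi_cd (v : E2) (s : ℝ) : ContDiff ℝ 1 (phi v s) := KK_cd.comp (tt_cd v s)

lemma XX_cd (v : E2) (s : ℝ) : ContDiff ℝ 1 (XX v s) :=
  (contDiff_const.mul (kk_cd.comp (tt_cd v s))).smul (contDiff_id.sub contDiff_const)

lemma zet_cont (v : E2) (s : ℝ) : Continuous (zet v s) :=
  (FF_cont.comp (tt_cd v s (n := 0)).continuous).div_const _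

lemma zet_nonneg (v : E2) (s : ℝ) (x : E2) : 0 ≤ zet v s x := div_nonneg (FF_nonneg _) (sq_nonneg _)

lemma gr_phi (v : E2) (s : ℝ) (x : E2) : gr (phi v s) x = XX v s x := by
  apply ext_inner_right ℝ
  intro w
  rw [gr_inner]
  have h := ((KK_deriv (tt v s x)).comp_hasFDerivAt x
    ((tt_cd v s (n := 1)).differentiable one_ne_zero x).hasFDerivAt).fderiv
  have e : phi v s = KK ∘ tt v s := rfl
  rw [e, h, _root_.smul_apply, tt_fd, XX, inner_smul_left]
  simp
  ring

lemma dvg_XX (v : E2) {s : ℝ} (hs : 0 < s) (x : E2) : dvg (XX v s) x = zet v s x - zet v (2 * s) x := by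
  have ht := ((tt_cd v s (n := 1)).differentiable one_ne_zero x)
  have hk := ((kk_cd.differentiable one_ne_zero (tt v s x)).hasDerivAt.comp_hasFDerivAt x ht.hasFDerivAt)
  have hk2 := hk.const_mul (2 / s ^ 2)
  have h1 := dvg_smul (f := fun x => 2 / s ^ 2 * kk (tt v s x)) (X := fun x => x - v) (p := x)
    hk2.differentiableAt (differentiableAt_id.sub_const v)
  have h2 : dvg (fun x => x - v) x = 2 := by
    unfold dvg
    rw [fderiv_sub_const]
    simp [ee]; norm_num
  have h3 : fderiv ℝ (fun x => 2 / s ^ 2 * kk (tt v s x)) x (x - v) =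
      4 / s ^ 2 * (tt v s x * deriv kk (tt v s x)) := by
    have := hk2.fderiv
    simp only [Function.comp_apply] at this
    rw [this, _root_.smul_apply, _root_.smul_apply, tt_fd, real_inner_self_eq_norm_sq]
    simp only [smul_eq_mul, tt]
    field_simp; ring
  have e : XX v s = fun x => (2 / s ^ 2 * kk (tt v s x)) • (x - v) := rfl
  rw [e, h1, h2, h3]
  have e2 : tt v (2 * s) x = tt v s x / 4 := by simp only [tt]; field_simp; norm_num
  rw [zet, zet, e2]
  have := kk_deriv (tt v s x)
  have e3 : FF (tt v s x) = 4 * (kk (tt v s x) + tt v s x * deriv kk (tt v s x)) + FF (tt v s x / 4) / 4 := by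
    linarith
  rw [e3]; field_simp; ring

variable {B : AffineBasis (Fin 3) ℝ E2} {m : ℝ} {u : E2 → ℝ} {g : E2 → E2}

lemma XX_tan {M : ℝ} (hM : ∀ a w, |cl B a w| ≤ M * ‖w‖) (hM0 : 0 < M) (i : Fin 3) {s : ℝ} (hs : 0 < s)
    (hsM : 4 * M * s ≤ 1) (j : Fin 3) (p : E2) (h0 : B.coord j p = 0) : cl B j (XX (B i) s p) = 0 := by
  rw [XX, map_smul, smul_eq_mul]
  have h1 := coord_eq_cl B j (B i) p
  by_cases hj : j = i
  · subst hj
    rw [coord_self, h0] at h1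
    have h2 := hM j (p - B j)
    rw [show cl B j (p - B j) = -1 by linarith] at h2
    simp only [abs_neg, abs_one] at h2
    have h3 : 4 * s ≤ ‖p - B j‖ := by
      by_contra hc
      rw [not_le] at hc
      have := mul_lt_mul_of_pos_left hc hM0
      linarith
    have : 16 ≤ tt (B j) s p := by
      rw [tt, le_div_iff₀ (by positivity)]
      nlinarith
    rw [kk_zero16 this]; simp
  · rw [coord_ne B hj, h0] at h1
    rw [show cl B j (p - B i) = 0 by linarith]; simp

lemma avg_diff (h : Weak B m u g) {M : ℝ} (hM : ∀ a w, |cl B a w| ≤ M * ‖w‖) (hM0 : 0 < M) (i : Fin 3)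
    {s : ℝ} (hs : 0 < s) (hsM : 4 * M * s ≤ 1) :
    (∫ x in TT B, u x * zet (B i) s x) - ∫ x in TT B, u x * zet (B i) (2 * s) x
      = - m * ∫ x in TT B, u x * phi (B i) s x := by
  have h1 := h.wg (XX (B i) s) (XX_cd _ _) (fun j p _ h0 => XX_tan hM hM0 i hs hsM j p h0)
  have h2 := h.el (phi (B i) s) (phi_cd _ _)
  simp only [gr_phi] at h2
  rw [h2] at h1
  simp only [dvg_XX _ hs, mul_sub] at h1
  have ii : ∀ s, IntegrableOn (fun x => u x * zet (B i) s x) (TT B) := fun s => by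
    obtain ⟨C, hC⟩ := (isCompact_TT B).exists_bound_of_continuousOn (zet_cont (B i) s).continuousOn
    exact Integrable.mul_bdd (c := C) h.int (zet_cont (B i) s).aestronglyMeasurable
      (ae_restrict_of_forall_mem (meas_TT B) hC)
  rw [integral_sub (ii s) (ii (2 * s))] at h1
  linarith

lemma avg_one {M : ℝ} (hM : ∀ a w, |cl B a w| ≤ M * ‖w‖) (hM0 : 0 < M) (i : Fin 3)
    {s : ℝ} (hs : 0 < s) (hsM : 4 * M * s ≤ 1) :
    ∫ x in TT B, zet (B i) s x = ∫ x in TT B, zet (B i) (2 * s) x := by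
  have hX := XX_cd (B i) s
  have h1 := divT B hX.continuous.continuousOn
    (fun p _ => hX.differentiable one_ne_zero p)
    ((hX.continuous_fderiv one_ne_zero).continuousOn.integrableOn_compact (isCompact_TT B))
    (fun j p _ h0 => XX_tan hM hM0 i hs hsM j p h0)
  simp only [dvg_XX _ hs] at h1
  have ii : ∀ s, IntegrableOn (fun x => zet (B i) s x) (TT B) := fun s =>
    (zet_cont (B i) s).continuousOn.integrableOn_compact (isCompact_TT B)
  rw [integral_sub (ii s) (ii (2 * s))] at h1
  linarith

lemma phi_bound (h : Weak B m u g) (i : Fin 3) : ∃ C > 0, ∀ s, 0 < s →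
    |∫ x in TT B, u x * phi (B i) s x| ≤ C * s := by
  obtain ⟨C, hC0, hC⟩ := KK_bdd
  set V := volume.real (Metric.closedBall (0:E2) 1) with hV
  refine ⟨1 + C ^ 2 * 16 * V, by positivity, fun s hs => ?_⟩
  set ball := Metric.closedBall (B i) (4 * s) with hball
  have hmb : MeasurableSet ball := Metric.isClosed_closedBall.measurableSet
  have hvol : volume.real ball = 16 * s ^ 2 * V := by
    rw [hball, measureReal_def, Measure.addHaar_closedBall _ _ (by positivity), hV, measureReal_def]
    rw [ENNReal.toReal_mul, ENNReal.toReal_ofReal (by positivity)]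
    rw [Measure.addHaar_closedBall volume (0:E2) zero_le_one]
    simp; left; ring
  have i1 : IntegrableOn (fun x => u x ^ 2) (TT B) := h.u2.integrable_sq
  have i2 : Integrable (ball.indicator fun _ => C ^ 2 : E2 → ℝ) :=
    (integrable_indicator_iff hmb).2 (integrableOn_const (isCompact_closedBall _ _).measure_lt_top.ne)
  have i3 : IntegrableOn (fun x => s * u x ^ 2 + s⁻¹ * ball.indicator (fun _ => C ^ 2) x) (TT B) :=
    (i1.const_mul s).add (i2.integrableOn.const_mul _)
  rw [← Real.norm_eq_abs]
  refine (norm_integral_le_of_norm_le i3 (Eventually.of_forall fun x => ?_)).trans ?_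
  · have hp : phi (B i) s x ^ 2 ≤ ball.indicator (fun _ => C ^ 2) x := by
      by_cases hx : x ∈ ball
      · rw [indicator_of_mem hx, ← sq_abs]
        exact pow_le_pow_left₀ (abs_nonneg _) (hC _ (by rw [tt]; positivity)) 2
      · rw [indicator_of_notMem hx]
        rw [hball, Metric.mem_closedBall, dist_eq_norm, not_le] at hx
        rw [phi, KK_zero]
        · simp
        · rw [tt, le_div_iff₀ (by positivity)]; nlinarith
    have hp2 := mul_le_mul_of_nonneg_left hp (inv_nonneg.2 hs.le)
    rw [Real.norm_eq_abs, abs_mul]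
    have q1 : 0 ≤ (s * |u x| - |phi (B i) s x|) ^ 2 / (2 * s) := by positivity
    have q2 : (s * |u x| - |phi (B i) s x|) ^ 2 / (2 * s) =
        (s * |u x| ^ 2 + s⁻¹ * |phi (B i) s x| ^ 2) / 2 - |u x| * |phi (B i) s x| := by
      field_simp; ring
    rw [sq_abs, sq_abs] at q2
    have q3 : 0 ≤ s * u x ^ 2 + s⁻¹ * phi (B i) s x ^ 2 := by positivity
    linarith
  · rw [integral_add (i1.const_mul s) (i2.integrableOn.const_mul _), integral_const_mul, integral_const_mul,
      h.nrm]
    have q : ∫ x in TT B, ball.indicator (fun _ => C ^ 2) x ≤ C ^ 2 * (16 * s ^ 2 * V) := by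
      refine (setIntegral_le_integral i2 (Eventually.of_forall fun y => ?_)).trans ?_
      · exact indicator_nonneg (fun _ _ => by positivity) y
      · rw [integral_indicator hmb, setIntegral_const, hvol, smul_eq_mul, mul_comm]
    have q2 := mul_le_mul_of_nonneg_left q (inv_nonneg.2 hs.le)
    have q3 : s⁻¹ * (C ^ 2 * (16 * s ^ 2 * V)) = C ^ 2 * 16 * V * s := by field_simp
    linarith

lemma exD (B : AffineBasis (Fin 3) ℝ E2) (i : Fin 3) : ∃ D > 0, ∀ x ∈ TT B, ‖x - B i‖ ≤ D * (1 - B.coord i x) := by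
  refine ⟨∑ a, ‖B a - B i‖ + 1, by positivity, fun x hx => ?_⟩
  have h0 := (mem_TT B).1 hx
  have hs := coord_sum B x
  have hle : ∀ a, a ≠ i → B.coord a x ≤ 1 - B.coord i x := by
    have h0 := h0 0; have h1 := (mem_TT B).1 hx 1; have h2 := (mem_TT B).1 hx 2
    intro a ha
    fin_cases a <;> fin_cases i <;> simp at * <;> linarith
  have hl0 : 0 ≤ 1 - B.coord i x := (h0 (i+1)).trans (hle _ (k1_ne i).symm)
  have e : x - B i = ∑ a, B.coord a x • (B a - B i) := by
    simp only [smul_sub, Finset.sum_sub_distrib, ← Finset.sum_smul, B.sum_coord_apply_eq_one, one_smul,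
      B.linear_combination_coord_eq_self]
  have h1 : ‖x - B i‖ ≤ ∑ a, (1 - B.coord i x) * ‖B a - B i‖ := by
    rw [e]
    refine (norm_sum_le _ _).trans (Finset.sum_le_sum fun a _ => ?_)
    rw [norm_smul, Real.norm_of_nonneg (h0 a)]
    by_cases ha : a = i
    · subst ha; simp
    · exact mul_le_mul_of_nonneg_right (hle a ha) (norm_nonneg _)
  rw [← Finset.mul_sum] at h1
  linarith

end NT

namespace NT
open MeasureTheory Filter Topology

variable {B : AffineBasis (Fin 3) ℝ E2} {m : ℝ} {u : E2 → ℝ} {g : E2 → E2}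

lemma W_ev (B : AffineBasis (Fin 3) ℝ E2) (m : ℝ) (u : E2 → ℝ) (k : Fin 3) {z : E2}
    (hz : z ∈ interior (TT B)) : Wf m (uT B u) =ᶠ[𝓝 z] Wf m (wk B u k) := by
  filter_upwards [isOpen_interior.mem_nhds hz] with q hq
  exact (W_eq B m u k hq).symm

lemma U0_smooth (h : Weak B m u g) (hm : 0 < m) {z : E2} (hz : z ∈ interior (TT B)) :
    ContDiffAt ℝ smo (Wf m (uT B u)) z :=
  (Wf_smooth (h.wki 0) hm (Om_open B 0) (weakOn_wk h 0) (int_Om B 0 hz)).congr_of_eventuallyEq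
    (W_ev B m u 0 hz)

lemma osc (h : Weak B m u g) (hm : 0 < m) (i : Fin 3) {D δ s1 a b : ℝ} (hD0 : 0 < D) (hδ : 0 < δ)
    (hD : ∀ x ∈ TT B, ‖x - B i‖ ≤ D * (1 - B.coord i x))
    (hs : ∀ z ∈ interior (TT B), 1 - B.coord i z < s1 →
      ‖fderiv ℝ (Wf m (uT B u)) z‖ ≤ δ / (1 - B.coord i z)) (ha : 0 < a) (hb : b < s1) {x y : E2}
    (hx : x ∈ interior (TT B)) (hy : y ∈ interior (TT B)) (hxa : a ≤ 1 - B.coord i x)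
    (hxb : 1 - B.coord i x ≤ b) (hya : a ≤ 1 - B.coord i y) (hyb : 1 - B.coord i y ≤ b) :
    |Wf m (uT B u) x - Wf m (uT B u) y| ≤ δ / a * (D * (2 * b)) := by
  set S : Set E2 := interior (TT B) ∩ {z | B.coord i z ∈ Icc (1 - b) (1 - a)} with hS
  have hc : Convex ℝ S := (convex_TT B).interior.inter ((convex_Icc (1 - b) (1 - a)).affine_preimage (B.coord i))
  have h1 := hc.norm_image_sub_le_of_norm_fderiv_le (f := Wf m (uT B u)) (C := δ / a) (𝕜 := ℝ)
    (fun z hz => (U0_smooth h hm hz.1).differentiableAt (by simp [smo]))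
    (fun z hz => (hs z hz.1 (by have := hz.2.1; linarith)).trans
      (div_le_div_of_nonneg_left hδ.le ha (by have := hz.2.2; linarith)))
    (x := y) (y := x) ⟨hy, ⟨by linarith, by linarith⟩⟩ ⟨hx, ⟨by linarith, by linarith⟩⟩
  rw [Real.norm_eq_abs] at h1
  refine h1.trans (mul_le_mul_of_nonneg_left ?_ (by positivity))
  have h2 := hD x (interior_subset hx)
  have h3 := hD y (interior_subset hy)
  have h4 : ‖x - y‖ ≤ ‖x - B i‖ + ‖y - B i‖ := by
    have := norm_sub_le (x - B i) (y - B i)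
    simpa using this
  have h5 := mul_le_mul_of_nonneg_left hxb hD0.le
  have h6 := mul_le_mul_of_nonneg_left hyb hD0.le
  linarith

lemma zet_supp {i : Fin 3} {s : ℝ} (hs : 0 < s) {x : E2} (h : zet (B i) s x ≠ 0) :
    s ≤ ‖x - B i‖ ∧ ‖x - B i‖ ≤ 2 * s := by
  have h1 : FF (tt (B i) s x) ≠ 0 := by
    intro h0; apply h; rw [zet, h0]; simp
  have h2 : 1 ≤ tt (B i) s x := by
    by_contra hc; exact h1 (FF_zero1 (not_le.1 hc))
  have h3 : tt (B i) s x ≤ 4 := by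
    by_contra hc; exact h1 (FF_zero4 (not_le.1 hc))
  rw [tt, le_div_iff₀ (by positivity)] at h2
  rw [tt, div_le_iff₀ (by positivity)] at h3
  constructor
  · exact le_of_sq_le_sq (by linarith) (norm_nonneg _)
  · exact le_of_sq_le_sq (by linarith) (by positivity)

lemma avg_pos {M : ℝ} (hM : ∀ a w, |cl B a w| ≤ M * ‖w‖) (hM0 : 0 < M) (i : Fin 3)
    {s : ℝ} (hs : 0 < s) (hsM : 4 * M * s ≤ 1) : 0 < ∫ x in TT B, zet (B i) s x := by
  obtain ⟨t, ht1, htF⟩ := FF_pos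
  have ht4 : t ≤ 4 := by
    by_contra hc; rw [FF_zero4 (not_le.1 hc)] at htF; exact lt_irrefl _ htF
  obtain ⟨c, hc⟩ : (interior (TT B)).Nonempty := by
    unfold TT; rw [interior_convexHull_nonempty_iff_affineSpan_eq_top]; exact B.tot
  have hc' := (mem_int_TT B).1 hc
  set d := c - B i with hd
  have hcd : ∀ a, a ≠ i → 0 < cl B a d := by
    intro a ha
    have := coord_eq_cl B a (B i) c
    rw [coord_ne B ha, zero_add] at this
    rw [← this]; exact hc' a
  have hd0 : 0 < ‖d‖ := by
    rw [norm_pos_iff]; intro h0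
    have := hcd (i+1) (k1_ne i).symm
    rw [h0] at this; simp at this
  set ρ := Real.sqrt t * s / ‖d‖ with hρ
  have hst : 0 < Real.sqrt t := Real.sqrt_pos.2 (by linarith)
  have hρ0 : 0 < ρ := by positivity
  set x := B i + ρ • d with hx
  have hxd : x - B i = ρ • d := by simp [hx]
  have hxn : ‖x - B i‖ = Real.sqrt t * s := by
    rw [hxd, norm_smul, Real.norm_of_nonneg hρ0.le, hρ]; field_simp
  have hst2 : Real.sqrt t ≤ 2 := by
    rw [Real.sqrt_le_left (by norm_num)]; linarith
  have hxi : x ∈ interior (TT B) := by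
    rw [mem_int_TT]
    intro a
    by_cases ha : a = i
    · subst ha
      have h1 := coord_eq_cl B a (B a) x
      have h2 := hM a (x - B a)
      rw [hxn] at h2
      have h3 := (abs_le.1 h2).1
      rw [coord_self] at h1
      have h4 : Real.sqrt t * s ≤ 2 * s := mul_le_mul_of_nonneg_right hst2 hs.le
      have h5 := mul_le_mul_of_nonneg_left h4 hM0.le
      linarith
    · have h1 := coord_eq_cl B a (B i) x
      rw [coord_ne B ha, hxd, map_smul, smul_eq_mul] at h1
      rw [h1, zero_add]; exact mul_pos hρ0 (hcd a ha)
  have hz : 0 < zet (B i) s x := by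
    have : tt (B i) s x = t := by
      rw [tt, hxn, mul_pow, Real.sq_sqrt (by linarith)]; field_simp
    rw [zet, this]; positivity
  rw [setIntegral_pos_iff_support_of_nonneg_ae (Eventually.of_forall fun x => zet_nonneg _ _ x)
    ((zet_cont (B i) s).continuousOn.integrableOn_compact (isCompact_TT B))]
  have ho : IsOpen (Function.support (zet (B i) s) ∩ interior (TT B)) :=
    ((zet_cont (B i) s).isOpen_support).inter isOpen_interior
  exact (ho.measure_pos volume ⟨x, hz.ne', hxi⟩).trans_le
    (measure_mono (inter_subset_inter_right _ interior_subset))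

lemma uT_ae (B : AffineBasis (Fin 3) ℝ E2) (h : Weak B m u g) :
    ∀ᵐ x ∂(volume.restrict (TT B)), x ∈ interior (TT B) ∧ Wf m (uT B u) x = u x := by
  rw [← restrict_int]
  filter_upwards [ae_restrict_mem isOpen_interior.measurableSet, ae_restrict_of_ae (Wf_ae h.uTi (m := m))] with x h1 h2
  refine ⟨h1, ?_⟩
  rw [h2, uT, indicator_of_mem (interior_subset h1)]

lemma vertex_lim (h : Weak B m u g) (hm : 0 < m) (i : Fin 3) :
    ∃ L, Tendsto (Wf m (uT B u)) (𝓝[interior (TT B)] (B i)) (𝓝 L) := by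
  obtain ⟨M, hM0, hM⟩ := exM B
  obtain ⟨D, hD0, hD⟩ := exD B i
  obtain ⟨C, hC0, hC⟩ := phi_bound h i
  set s0 := 1 / (4 * M) with hs0
  have hs0p : 0 < s0 := by positivity
  set s : ℕ → ℝ := fun n => s0 * (1/2) ^ n with hsdef
  have hsp : ∀ n, 0 < s n := fun n => by positivity
  have hs2 : ∀ n, 2 * s (n+1) = s n := fun n => by simp only [hsdef, pow_succ]; ring
  have hsM : ∀ n, 4 * M * s n ≤ 1 := by
    intro n
    have h1 : (1/2 : ℝ) ^ n ≤ 1 := pow_le_one₀ (by norm_num) (by norm_num)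
    have h2 : s n ≤ s0 := by
      simp only [hsdef]; nlinarith
    have h3 : 4 * M * s0 = 1 := by rw [hs0]; field_simp
    nlinarith
  set a : ℕ → ℝ := fun n => ∫ x in TT B, u x * zet (B i) (s n) x with hadef
  set c : ℝ := ∫ x in TT B, zet (B i) (s 0) x with hcdef
  have hcn : ∀ n, ∫ x in TT B, zet (B i) (s n) x = c := by
    intro n
    induction n with
    | zero => rfl
    | succ n ih => rw [avg_one hM hM0 i (hsp (n+1)) (hsM _), hs2, ih]
  have hc0 : 0 < c := avg_pos hM hM0 i (hsp 0) (hsM 0)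
  have hcau : CauchySeq a := by
    refine cauchySeq_of_le_geometric (1/2) (m * (C * s0)) (by norm_num) fun n => ?_
    have h1 := avg_diff h hM hM0 i (hsp (n+1)) (hsM _)
    rw [hs2] at h1
    rw [dist_comm, Real.dist_eq]
    simp only [hadef]
    rw [h1, abs_mul, abs_neg, abs_of_pos hm, mul_assoc]
    refine mul_le_mul_of_nonneg_left ((hC _ (hsp _)).trans ?_) hm.le
    rw [mul_assoc]
    refine mul_le_mul_of_nonneg_left ?_ hC0.le
    have := hs2 n
    have := hsp (n+1)
    change s (n+1) ≤ s n
    linarith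
  obtain ⟨A, hA⟩ := cauchySeq_tendsto_of_complete hcau
  refine ⟨A / c, ?_⟩
  rw [Metric.tendsto_nhdsWithin_nhds]
  intro ε hε
  set Q := (D + 2) * (D * (2 * (2 * M + 1))) with hQ
  have hQ0 : 0 < Q := by positivity
  set δ := ε / (4 * Q) with hδ
  have hδ0 : 0 < δ := by positivity
  obtain ⟨s1, hs1, hgr⟩ := grad_small h hm i hδ0
  have hst : Tendsto s atTop (𝓝 0) := by
    have := half_tendsto.const_mul s0
    rw [mul_zero] at this; exact this
  have ev := (hst.eventually_lt_const (u := s1 / (2 * M + 1)) (by positivity)).and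
    ((Metric.tendsto_nhds.1 hA) (ε * c / 2) (by positivity))
  obtain ⟨N, hN⟩ := eventually_atTop.1 ev
  refine ⟨s N / M, by have := hsp N; positivity, ?_⟩
  intro z hz hzd
  have hℓ : 1 - B.coord i z < s N := by
    have h1 := coord_eq_cl B i (B i) z
    rw [coord_self] at h1
    have h2 := (abs_le.1 (hM i (z - B i))).1
    rw [dist_eq_norm, lt_div_iff₀ hM0] at hzd
    linarith
  have hℓ0 : 0 < 1 - B.coord i z := by
    have h1 := hD z (interior_subset hz)
    by_contra hc
    have h2 : ‖z - B i‖ ≤ 0 := h1.trans (mul_nonpos_of_nonneg_of_nonpos hD0.le (not_lt.1 hc))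
    have h3 : z = B i := by
      rw [← sub_eq_zero, ← norm_le_zero_iff]; exact h2
    have h4 := (mem_int_TT B).1 hz (i+1)
    rw [h3, coord_ne B (k1_ne i).symm] at h4
    exact lt_irrefl _ h4
  set ℓ := 1 - B.coord i z with hℓdef
  have hℓs : ℓ / s0 < (1/2) ^ N := by rw [div_lt_iff₀ hs0p, mul_comm]; exact hℓ
  obtain ⟨n, hn1, hn2⟩ := exists_nat_pow_near_of_lt_one (x := ℓ / s0) (y := (1/2 : ℝ)) (by positivity)
    (hℓs.le.trans (pow_le_one₀ (by norm_num) (by norm_num))) (by norm_num) (by norm_num)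
  have hnN : N ≤ n := by
    have h1 := hn1.trans hℓs
    rw [pow_lt_pow_iff_right_of_lt_one₀ (by norm_num) (by norm_num)] at h1
    omega
  have hn3 : s (n+1) < ℓ := by rw [lt_div_iff₀ hs0p, mul_comm] at hn1; exact hn1
  have hn4 : ℓ ≤ s n := by rw [div_le_iff₀ hs0p, mul_comm] at hn2; exact hn2
  obtain ⟨hN1, hN2⟩ := hN n hnN
  have hsn := hsp n
  have hs2n := hs2 n
  have hb : (2 * M + 1) * s n < s1 := by
    rw [lt_div_iff₀ (by positivity)] at hN1; linarith
  have ha : 0 < s n / (D + 2) := by positivity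
  have hMs : 0 ≤ M * s n := by positivity
  -- oscillation bound against points of the support
  have hosc : ∀ x ∈ interior (TT B), zet (B i) (s n) x ≠ 0 →
      |Wf m (uT B u) z - Wf m (uT B u) x| ≤ ε / 4 := by
    intro x hx hzx
    obtain ⟨q1, q2⟩ := zet_supp hsn hzx
    have h1 := coord_eq_cl B i (B i) x
    rw [coord_self] at h1
    have h2 := (abs_le.1 (hM i (x - B i))).1
    have h3 := hD x (interior_subset hx)
    have h4 := mul_le_mul_of_nonneg_left q2 hM0.le
    have h6 : 0 ≤ 1 - B.coord i x := by
      by_contra hc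
      have := mul_neg_of_pos_of_neg hD0 (not_le.1 hc)
      linarith
    have := osc h hm i hD0 hδ0 hD hgr (a := s n / (D + 2)) (b := (2 * M + 1) * s n) ha hb hz hx
      (by rw [div_le_iff₀ (by positivity)]; nlinarith) (by linarith)
      (by rw [div_le_iff₀ (by positivity)]; linarith) (by linarith)
    refine this.trans (le_of_eq ?_)
    rw [hδ, hQ]; field_simp
  have iz : IntegrableOn (zet (B i) (s n)) (TT B) :=
    (zet_cont (B i) (s n)).continuousOn.integrableOn_compact (isCompact_TT B)
  have iu : IntegrableOn (fun x => u x * zet (B i) (s n) x) (TT B) := by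
    obtain ⟨C, hC⟩ := (isCompact_TT B).exists_bound_of_continuousOn (zet_cont (B i) (s n)).continuousOn
    exact Integrable.mul_bdd (c := C) h.int (zet_cont (B i) (s n)).aestronglyMeasurable
      (ae_restrict_of_forall_mem (meas_TT B) hC)
  have e1 : Wf m (uT B u) z * c - a n = ∫ x in TT B, (Wf m (uT B u) z * zet (B i) (s n) x - u x * zet (B i) (s n) x) := by
    rw [integral_sub (iz.const_mul _) iu, integral_const_mul, hcn]
  have e2 : |Wf m (uT B u) z * c - a n| ≤ c * (ε / 4) := by
    rw [e1, ← Real.norm_eq_abs, ← hcn n, ← integral_mul_const]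
    refine norm_integral_le_of_norm_le (iz.mul_const _) ?_
    filter_upwards [uT_ae B h] with x hx
    rw [← hx.2, ← sub_mul, Real.norm_eq_abs, abs_mul, abs_of_nonneg (zet_nonneg _ _ _), mul_comm]
    by_cases h0 : zet (B i) (s n) x = 0
    · rw [h0]; simp
    · exact mul_le_mul_of_nonneg_left (hosc x hx.1 h0) (zet_nonneg _ _ _)
  rw [Real.dist_eq] at hN2 ⊢
  have e3 : Wf m (uT B u) z - A / c = ((Wf m (uT B u) z * c - a n) + (a n - A)) / c := by
    field_simp; ring
  rw [e3, abs_div, abs_of_pos hc0, div_lt_iff₀ hc0]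
  have := abs_add_le (Wf m (uT B u) z * c - a n) (a n - A)
  have : 0 < ε * c := by positivity
  linarith

end NT

namespace NT
open MeasureTheory Filter Topology

/-- The punctured triangle. -/
def DD (B : AffineBasis (Fin 3) ℝ E2) : Set E2 := TT B \ range B

structure Sol (B : AffineBasis (Fin 3) ℝ E2) (m : ℝ) (u : E2 → ℝ) : Prop where
  cont : ContinuousOn u (TT B)
  smooth : ContDiffOn ℝ smo u (DD B)
  eqn : ∀ p ∈ interior (TT B), negLap u p = m * u p
  neu : ∀ i, ∀ p ∈ DD B, B.coord i p = 0 → fderivWithin ℝ u (DD B) p (nn B i) = 0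

theorem int_ne (B : AffineBasis (Fin 3) ℝ E2) : (interior (TT B)).Nonempty := by
  rw [TT]; exact (interior_convexHull_nonempty_iff_affineSpan_eq_top).2 B.tot

theorem TT_cl (B : AffineBasis (Fin 3) ℝ E2) : TT B ⊆ closure (interior (TT B)) := by
  rw [(convex_TT B).closure_interior_eq_closure_of_nonempty_interior (int_ne B)]
  exact subset_closure

theorem range_closed (B : AffineBasis (Fin 3) ℝ E2) : IsClosed (range B) :=
  (finite_range B).isClosed

theorem DD_ud (B : AffineBasis (Fin 3) ℝ E2) : UniqueDiffOn ℝ (DD B) := by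
  have := (uniqueDiffOn_convex (convex_TT B) (int_ne B)).inter (range_closed B).isOpen_compl
  exact this

theorem int_DD (B : AffineBasis (Fin 3) ℝ E2) : interior (TT B) ⊆ DD B := by
  intro p hp
  refine ⟨interior_subset hp, ?_⟩
  rintro ⟨j, rfl⟩
  have := (mem_int_TT B).1 hp (j+1)
  rw [coord_ne B (k1_ne j).symm] at this
  exact lt_irrefl _ this

theorem pt_ext3 (B : AffineBasis (Fin 3) ℝ E2) {p : E2} (k : Fin 3) (h : ∀ j, j ≠ k → B.coord j p = 0) :
    p = B k := by
  apply coord_ext B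
  intro i
  by_cases hi : i = k
  · subst hi
    have h1 := coord_sum B p
    have h2 := coord_sum B (B i)
    have h3 : ∀ j, j ≠ i → B.coord j (B i) = 0 := fun j hj => coord_ne B hj
    fin_cases i
    · have a := h 1 (by decide); have b := h 2 (by decide)
      have c := h3 1 (by decide); have d := h3 2 (by decide)
      simp only [Fin.zero_eta, Fin.mk_one, Fin.reduceFinMk] at *; linarith
    · have a := h 0 (by decide); have b := h 2 (by decide)
      have c := h3 0 (by decide); have d := h3 2 (by decide)
      simp only [Fin.zero_eta, Fin.mk_one, Fin.reduceFinMk] at *; linarith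
    · have a := h 0 (by decide); have b := h 1 (by decide)
      have c := h3 0 (by decide); have d := h3 1 (by decide)
      simp only [Fin.zero_eta, Fin.mk_one, Fin.reduceFinMk] at *; linarith
  · rw [h i hi, coord_ne B hi]

theorem DD_other (B : AffineBasis (Fin 3) ℝ E2) {p : E2} (hp : p ∈ DD B) {k : Fin 3} (hk : B.coord k p = 0) :
    ∀ j, j ≠ k → 0 < B.coord j p := by
  intro j hj
  rcases ((mem_TT B).1 hp.1 j).lt_or_eq with h | h
  · exact h
  · exfalso
    apply hp.2
    obtain ⟨l, hl⟩ : ∃ l : Fin 3, ∀ i, i ≠ l → i = j ∨ i = k := by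
      clear h hk; revert j k; decide
    refine ⟨l, (pt_ext3 B l ?_).symm⟩
    intro i hi
    rcases hl i hi with rfl | rfl
    · exact h.symm
    · exact hk

theorem side_Om (B : AffineBasis (Fin 3) ℝ E2) {p : E2} (hp : p ∈ DD B) {k : Fin 3} (hk : B.coord k p = 0) :
    p ∈ Om B k := by
  refine ⟨DD_other B hp hk, Or.inr ?_⟩
  rw [sg_fix B k hk]
  exact DD_other B hp hk

theorem DD_Om (B : AffineBasis (Fin 3) ℝ E2) {p : E2} (hp : p ∈ DD B) : ∃ k, p ∈ Om B k := by
  by_cases h : ∃ k, B.coord k p = 0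
  · obtain ⟨k, hk⟩ := h
    exact ⟨k, side_Om B hp hk⟩
  · push Not at h
    exact ⟨0, int_Om B 0 ((mem_int_TT B).2 fun i => lt_of_le_of_ne ((mem_TT B).1 hp.1 i) (h i).symm)⟩

def UU (B : AffineBasis (Fin 3) ℝ E2) (m : ℝ) (u : E2 → ℝ) : E2 → ℝ :=
  extendFrom (interior (TT B)) (Wf m (uT B u))

variable {B : AffineBasis (Fin 3) ℝ E2} {m : ℝ} {u : E2 → ℝ} {g : E2 → E2}

theorem W_tend (h : Weak B m u g) (hm : 0 < m) {k : Fin 3} {p : E2} (hk : p ∈ Om B k) :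
    Tendsto (Wf m (uT B u)) (𝓝[interior (TT B)] p) (𝓝 (Wf m (wk B u k) p)) := by
  have hc : ContinuousAt (Wf m (wk B u k)) p :=
    (Wf_smooth (h.wki k) hm (Om_open B k) (weakOn_wk h k) hk).continuousAt
  refine (hc.tendsto.mono_left nhdsWithin_le_nhds).congr' ?_
  filter_upwards [self_mem_nhdsWithin] with z hz
  exact W_eq B m u k hz

theorem UU_eq (h : Weak B m u g) (hm : 0 < m) {k : Fin 3} {p : E2} (hp : p ∈ TT B) (hk : p ∈ Om B k) :
    UU B m u p = Wf m (wk B u k) p :=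
  extendFrom_eq (TT_cl B hp) (W_tend h hm hk)

theorem UU_ev (h : Weak B m u g) (hm : 0 < m) {k : Fin 3} {p : E2} (hk : p ∈ Om B k) :
    UU B m u =ᶠ[𝓝[DD B] p] Wf m (wk B u k) := by
  filter_upwards [self_mem_nhdsWithin, mem_nhdsWithin_of_mem_nhds ((Om_open B k).mem_nhds hk)] with z hz hz2
  exact UU_eq h hm hz.1 hz2

theorem UU_ev' (h : Weak B m u g) (hm : 0 < m) {p : E2} (hp : p ∈ interior (TT B)) :
    UU B m u =ᶠ[𝓝 p] Wf m (wk B u 0) := by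
  filter_upwards [isOpen_interior.mem_nhds hp] with z hz
  exact UU_eq h hm (interior_subset hz) (int_Om B 0 hz)

theorem SS_nn (B : AffineBasis (Fin 3) ℝ E2) (k : Fin 3) : SS B k (nn B k) = - nn B k := by
  rw [SS_apply, ← nn_inner, real_inner_self_eq_norm_sq]
  have h0 : ‖nn B k‖ ^ 2 ≠ 0 := by
    intro h
    have h1 : nn B k = 0 := by simpa using h
    have h2 := nn_inner B k (B k - B (k+1))
    rw [h1, inner_zero_left, cl_apply, coord_lin_B] at h2
    simp [k1_ne k] at h2
  rw [div_self h0, mul_one, two_smul]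
  abel

theorem sol_UU (h : Weak B m u g) (hm : 0 < m) : Sol B m (UU B m u) where
  cont := by
    apply continuousOn_extendFrom (TT_cl B)
    intro p hp
    by_cases hv : p ∈ range B
    · obtain ⟨i, rfl⟩ := hv
      exact vertex_lim h hm i
    · obtain ⟨k, hk⟩ := DD_Om B ⟨hp, hv⟩
      exact ⟨_, W_tend h hm hk⟩
  smooth := by
    intro p hp
    obtain ⟨k, hk⟩ := DD_Om B hp
    refine ContDiffWithinAt.congr_of_eventuallyEq ?_ (UU_ev h hm hk) (UU_eq h hm hp.1 hk)
    exact (Wf_smooth (h.wki k) hm (Om_open B k) (weakOn_wk h k) hk).contDiffWithinAt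
  eqn := by
    intro p hp
    have h1 : negLap (UU B m u) p = - lap (UU B m u) p := rfl
    rw [h1, lap_congr (UU_ev' h hm hp), (UU_ev' h hm hp).eq_of_nhds,
      Wf_lap (h.wki 0) hm (Om_open B 0) (weakOn_wk h 0) (int_Om B 0 hp)]
    ring
  neu := by
    intro k p hp hk
    have hO := side_Om B hp hk
    rw [Filter.EventuallyEq.fderivWithin_eq (UU_ev h hm hO) (UU_eq h hm hp.1 hO)]
    have hd : DifferentiableAt ℝ (Wf m (wk B u k)) p :=
      (Wf_smooth (h.wki k) hm (Om_open B k) (weakOn_wk h k) hO).differentiableAt (by simp [smo])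
    rw [hd.fderivWithin (DD_ud B p hp)]
    have hs : (fun q => Wf m (wk B u k) (sg B k q)) = Wf m (wk B u k) := by
      funext q
      exact Wf_symm (sg_iso B k) (sg_mp B k) (sg_me B k) (wk_sg B u k) q
    have hp2 : sg B k p = p := sg_fix B k hk
    have hd2 : HasFDerivAt (Wf m (wk B u k)) (fderiv ℝ (Wf m (wk B u k)) p) (sg B k p) := by
      rw [hp2]; exact hd.hasFDerivAt
    have h1 := HasFDerivAt.comp p hd2 (sg_fd B k p)
    have hs2 : Wf m (wk B u k) ∘ sg B k = Wf m (wk B u k) := hs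
    rw [hs2] at h1
    have h2 := DFunLike.congr_fun h1.fderiv (nn B k)
    have h3 : fderiv ℝ (Wf m (wk B u k)) p (nn B k) = fderiv ℝ (Wf m (wk B u k)) p (SS B k (nn B k)) := h2
    rw [SS_nn, map_neg] at h3
    linarith

theorem UU_nonconst (h : Weak B m u g) (hm : 0 < m) : ¬ ∃ c : ℝ, ∀ z ∈ TT B, UU B m u z = c := by
  rintro ⟨c, hc⟩
  have hae : ∀ᵐ x ∂volume.restrict (TT B), u x = c := by
    filter_upwards [uT_ae B h] with x hx
    rw [← hx.2, ← hc x (interior_subset hx.1), UU_eq h hm (interior_subset hx.1) (int_Om B 0 hx.1),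
      W_eq B m u 0 hx.1]
  have h1 := h.mean
  have h2 := h.nrm
  rw [integral_congr_ae hae] at h1
  rw [integral_congr_ae (g := fun _ => c * c) (by filter_upwards [hae] with x hx; simp only [hx]; ring)] at h2
  rw [integral_const, smul_eq_mul] at h1 h2
  rw [← mul_assoc, h1] at h2
  simp at h2

/-! ### bridge with the frozen definitions -/

theorem neu_bridge (B : AffineBasis (Fin 3) ℝ E2) (u : E2 → ℝ) {i j k : Fin 3} (hij : i ≠ j) (hik : i ≠ k)
    (hjk : j ≠ k) :
    NeumannOn (DD B) (B j) (B k) u ↔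
      ∀ p ∈ DD B, B.coord i p = 0 → fderivWithin ℝ u (DD B) p (nn B i) = 0 := by
  have hall : ∀ a : Fin 3, a = i ∨ a = j ∨ a = k := by
    clear * - hij hik hjk; revert i j k; decide
  have hsum : ∀ q, B.coord i q + B.coord j q + B.coord k q = 1 := by
    intro q
    have := coord_sum B q
    rw [← this]
    clear * - hij hik hjk
    fin_cases i <;> fin_cases j <;> fin_cases k <;> simp at hij hik hjk ⊢ <;> ring
  have hb : cl B i (B k - B j) = 0 := by
    rw [cl_apply, coord_lin_B]; simp [hij, hik]
  constructor
  · intro h p hp hpi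
    have hc := hsum p
    rw [hpi, zero_add] at hc
    apply h p
    · rw [segment_eq_image_lineMap]
      refine ⟨B.coord k p, ⟨(mem_TT B).1 hp.1 k, by linarith [(mem_TT B).1 hp.1 j]⟩, ?_⟩
      apply coord_ext B
      intro a
      rw [AffineMap.apply_lineMap, AffineMap.lineMap_apply]
      simp only [vsub_eq_sub, smul_eq_mul, vadd_eq_add]
      rcases hall a with rfl | rfl | rfl
      · rw [coord_ne B hij, coord_ne B hik, hpi]; ring
      · rw [coord_self B, coord_ne B hjk]; linarith
      · rw [coord_self B, coord_ne B hjk.symm]; ring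
    · rintro rfl; exact hp.2 ⟨j, rfl⟩
    · rintro rfl; exact hp.2 ⟨k, rfl⟩
    · rw [nn_inner]; exact hb
  · intro h p hp hpj hpk w hw
    rw [segment_eq_image_lineMap] at hp
    obtain ⟨t, ht, rfl⟩ := hp
    set p := AffineMap.lineMap (B j) (B k) t with hpd
    have hpi : B.coord i p = 0 := by
      rw [hpd, AffineMap.apply_lineMap, AffineMap.lineMap_apply, coord_ne B hij, coord_ne B hik]; simp
    have hpT : p ∈ TT B := by
      rw [mem_TT]
      intro a
      rw [hpd, AffineMap.apply_lineMap, AffineMap.lineMap_apply]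
      simp only [vsub_eq_sub, smul_eq_mul, vadd_eq_add]
      rcases hall a with rfl | rfl | rfl
      · rw [coord_ne B hij, coord_ne B hik]; simp
      · rw [coord_self B, coord_ne B hjk]; linarith [ht.2]
      · rw [coord_self B, coord_ne B hjk.symm]; linarith [ht.1]
    have hpD : p ∈ DD B := by
      refine ⟨hpT, ?_⟩
      rintro ⟨a, ha⟩
      rcases hall a with rfl | rfl | rfl
      · rw [← ha, coord_self B] at hpi; exact one_ne_zero hpi
      · exact hpj ha.symm
      · exact hpk ha.symm
    have hN := h p hpD hpi
    have h0 : ‖nn B i‖ ^ 2 ≠ 0 := by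
      intro h
      have h1 : nn B i = 0 := by simpa using h
      have h2 := nn_inner B i (B i - B j)
      rw [h1, inner_zero_left, cl_apply, coord_lin_B] at h2
      simp [hij] at h2
    set c := cl B i w / ‖nn B i‖ ^ 2 with hc
    set y := w - c • nn B i with hy
    have hy1 : cl B i y = 0 := by
      rw [hy, map_sub, map_smul, smul_eq_mul, ← nn_inner B i (nn B i), real_inner_self_eq_norm_sq, hc,
        div_mul_cancel₀ _ h0, sub_self]
    have hyb : y = cl B k y • (B k - B j) := by
      have hs := hsum (B j + y)
      have e : ∀ a v, B.coord a (B j + v) = B.coord a (B j) + cl B a v := by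
        intro a v; rw [coord_eq_cl B a (B j)]; simp
      have hs2 := hsum (B j)
      rw [e, e, e, hy1] at hs
      have : B j + y = B j + cl B k y • (B k - B j) := by
        apply coord_ext B
        intro a
        rw [e, e, map_smul, cl_apply B a (B k - B j), coord_lin_B, smul_eq_mul]
        rcases hall a with rfl | rfl | rfl
        · simp [hij, hik, hy1]
        · simp [hjk]; linarith
        · simp [hjk.symm]
      exact add_left_cancel this
    have hy0 : y = 0 := by
      have h1 : inner ℝ y (B k - B j) = 0 := by
        rw [hy, inner_sub_left, hw, inner_smul_left, nn_inner, hb]; simp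
      have h2 : inner ℝ y y = (0:ℝ) := by
        conv_lhs => rw [hyb]
        rw [inner_smul_left, inner_smul_right, real_inner_self_eq_norm_sq]
        rw [hyb, inner_smul_left, real_inner_self_eq_norm_sq] at h1
        simp only [RCLike.conj_to_real] at h1 ⊢
        have : cl B k y * (cl B k y * ‖B k - B j‖ ^ 2) = cl B k y * 0 := by
          rw [← h1]
        linarith
      exact inner_self_eq_zero.1 h2
    have hw2 : w = c • nn B i := sub_eq_zero.1 hy0
    rw [hw2, map_smul, hN, smul_zero]

/-- The affine basis attached to a nondegenerate triangle. -/
def Bas (v₁ v₂ v₃ : E2) (hT : AffineIndependent ℝ ![v₁, v₂, v₃]) : AffineBasis (Fin 3) ℝ E2 :=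
  ⟨![v₁, v₂, v₃], hT, by
    rw [hT.affineSpan_eq_top_iff_card_eq_finrank_add_one]; simp⟩

theorem Bas_coe (v₁ v₂ v₃ : E2) (hT : AffineIndependent ℝ ![v₁, v₂, v₃]) :
    ⇑(Bas v₁ v₂ v₃ hT) = ![v₁, v₂, v₃] := rfl

theorem Bas_range (v₁ v₂ v₃ : E2) (hT : AffineIndependent ℝ ![v₁, v₂, v₃]) :
    range (Bas v₁ v₂ v₃ hT) = {v₁, v₂, v₃} := by
  rw [Bas_coe]; ext x; simp [eq_comm]; tauto

theorem Bas_TT (v₁ v₂ v₃ : E2) (hT : AffineIndependent ℝ ![v₁, v₂, v₃]) :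
    TT (Bas v₁ v₂ v₃ hT) = Tri v₁ v₂ v₃ := by
  rw [TT, Bas_range, Tri]

theorem Bas_DD (v₁ v₂ v₃ : E2) (hT : AffineIndependent ℝ ![v₁, v₂, v₃]) :
    DD (Bas v₁ v₂ v₃ hT) = TriDom v₁ v₂ v₃ := by
  rw [DD, Bas_TT, Bas_range, TriDom, Vtx]

theorem eig_iff (v₁ v₂ v₃ : E2) (hT : AffineIndependent ℝ ![v₁, v₂, v₃]) (m : ℝ) (u : E2 → ℝ) :
    IsNeumannEigenfun v₁ v₂ v₃ m u ↔
      0 < m ∧ (¬ ∃ c : ℝ, ∀ z ∈ TT (Bas v₁ v₂ v₃ hT), u z = c) ∧ Sol (Bas v₁ v₂ v₃ hT) m u := by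
  have n0 := neu_bridge (Bas v₁ v₂ v₃ hT) u (i := 2) (j := 0) (k := 1) (by decide) (by decide) (by decide)
  have n1 := neu_bridge (Bas v₁ v₂ v₃ hT) u (i := 0) (j := 1) (k := 2) (by decide) (by decide) (by decide)
  have n2 := neu_bridge (Bas v₁ v₂ v₃ hT) u (i := 1) (j := 2) (k := 0) (by decide) (by decide) (by decide)
  have e0 : Bas v₁ v₂ v₃ hT 0 = v₁ := rfl
  have e1 : Bas v₁ v₂ v₃ hT 1 = v₂ := rfl
  have e2 : Bas v₁ v₂ v₃ hT 2 = v₃ := rfl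
  rw [e0, e1] at n0
  rw [e1, e2] at n1
  rw [e2, e0] at n2
  have t := Bas_TT v₁ v₂ v₃ hT
  have d := Bas_DD v₁ v₂ v₃ hT
  constructor
  · intro h
    refine ⟨h.pos, by rw [t]; exact h.nonconst, ⟨by rw [t]; exact h.cont, by rw [d]; exact h.smooth,
      by rw [t]; exact h.eqn, ?_⟩⟩
    intro i
    fin_cases i
    · exact n1.1 (by rw [d]; exact h.neumann₂₃)
    · exact n2.1 (by rw [d]; exact h.neumann₃₁)
    · exact n0.1 (by rw [d]; exact h.neumann₁₂)
  · rintro ⟨h1, h2, h3⟩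
    exact ⟨h1, by rw [← t]; exact h2, by rw [← t]; exact h3.cont, by rw [← d]; exact h3.smooth,
      by rw [← t]; exact h3.eqn, by rw [← d]; exact n0.2 (h3.neu 2), by rw [← d]; exact n1.2 (h3.neu 0),
      by rw [← d]; exact n2.2 (h3.neu 1)⟩

end NT

namespace NT
open MeasureTheory Filter Topology

theorem st_deriv_one {t : ℝ} (ht : 1 ≤ t) : deriv Real.smoothTransition t = 0 := by
  have : IsLocalMax Real.smoothTransition t := by
    apply Eventually.of_forall
    intro x
    show Real.smoothTransition _ ≤ Real.smoothTransition _
    rw [Real.smoothTransition.one_of_one_le ht]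
    exact Real.smoothTransition.le_one x
  exact this.deriv_eq_zero

theorem st_deriv_zero {t : ℝ} (ht : t ≤ 0) : deriv Real.smoothTransition t = 0 := by
  have : IsLocalMin Real.smoothTransition t := by
    apply Eventually.of_forall
    intro x
    show Real.smoothTransition _ ≤ Real.smoothTransition _
    rw [Real.smoothTransition.zero_of_nonpos ht]
    exact Real.smoothTransition.nonneg x
  exact this.deriv_eq_zero

theorem st_bound : ∃ K : ℝ, 0 ≤ K ∧ ∀ t, |deriv Real.smoothTransition t| ≤ K := by
  have hc : Continuous (deriv Real.smoothTransition) :=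
    (Real.smoothTransition.contDiff (n := 1)).continuous_deriv le_rfl
  obtain ⟨K, hK⟩ := (isCompact_Icc (a := (0:ℝ)) (b := 1)).exists_bound_of_continuousOn hc.continuousOn
  refine ⟨K, (norm_nonneg _).trans (hK 0 (by simp)), fun t => ?_⟩
  have hK0 := (norm_nonneg _).trans (hK 0 (by simp))
  rcases le_total t 0 with h | h
  · rw [st_deriv_zero h, abs_zero]; exact hK0
  rcases le_total 1 t with h1 | h1
  · rw [st_deriv_one h1, abs_zero]; exact hK0
  exact hK t ⟨h, h1⟩

/-- one-vertex cutoff -/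
def ct (B : AffineBasis (Fin 3) ℝ E2) (s : ℝ) (i : Fin 3) (x : E2) : ℝ :=
  Real.smoothTransition ((1 - B.coord i x) / s - 1)

theorem ct_cd (B : AffineBasis (Fin 3) ℝ E2) (s : ℝ) (i : Fin 3) : ContDiff ℝ smo (ct B s i) := by
  have h : ContDiff ℝ smo (fun x => B.coord i x) := by
    have : (fun x => B.coord i x) = fun x => B.coord i 0 + cl B i x := by
      funext x; rw [coord_eq_cl B i 0 x]; simp
    rw [this]
    exact contDiff_const.add (cl B i).contDiff
  exact Real.smoothTransition.contDiff.comp (((contDiff_const.sub h).div_const s).sub contDiff_const)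

theorem ct_fd (B : AffineBasis (Fin 3) ℝ E2) (s : ℝ) (i : Fin 3) (x : E2) :
    fderiv ℝ (ct B s i) x =
      (deriv Real.smoothTransition ((1 - B.coord i x) / s - 1) * (-1 / s)) • cl B i := by
  have h : HasFDerivAt (fun x => B.coord i x) (cl B i) x := by
    have : (fun x => B.coord i x) = fun x => B.coord i 0 + cl B i x := by
      funext x; rw [coord_eq_cl B i 0 x]; simp
    rw [this]
    exact (cl B i).hasFDerivAt.const_add _
  have h2 : HasFDerivAt (fun x => (1 - B.coord i x) / s - 1) ((-1 / s) • cl B i) x := by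
    have := ((h.const_sub 1).mul_const (1 / s)).sub_const 1
    have e1 : (fun x => (1 - B.coord i x) / s - 1) = fun x => (1 - B.coord i x) * (1 / s) - 1 := by
      funext y; ring
    have e2 : (-1 / s) • cl B i = (1 / s) • -cl B i := by
      rw [smul_neg, ← neg_smul]; congr 1; ring
    rw [e1, e2]; exact this
  have hd : DifferentiableAt ℝ Real.smoothTransition ((1 - B.coord i x) / s - 1) :=
    (Real.smoothTransition.contDiff (n := 1)).differentiable one_ne_zero _
  have h3 := hd.hasDerivAt.comp_hasFDerivAt x h2
  have h4 : fderiv ℝ (ct B s i) x = _ := h3.fderiv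
  rw [h4, smul_smul]

def Phi (B : AffineBasis (Fin 3) ℝ E2) (s : ℝ) : Set E2 := {x | ∀ i, 2 * s ≤ 1 - B.coord i x}

theorem fd_mul_bound {f g : E2 → ℝ} {x : E2} (hf : DifferentiableAt ℝ f x) (hg : DifferentiableAt ℝ g x)
    (hf1 : |f x| ≤ 1) (hg1 : |g x| ≤ 1) :
    ‖fderiv ℝ (fun y => f y * g y) x‖ ≤ ‖fderiv ℝ f x‖ + ‖fderiv ℝ g x‖ := by
  rw [fderiv_fun_mul hf hg]
  refine (norm_add_le _ _).trans ?_
  rw [norm_smul, norm_smul, Real.norm_eq_abs, Real.norm_eq_abs]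
  nlinarith [norm_nonneg (fderiv ℝ f x), norm_nonneg (fderiv ℝ g x)]

theorem exists_cut (B : AffineBasis (Fin 3) ℝ E2) : ∃ C : ℝ, 0 ≤ C ∧ ∀ s : ℝ, 0 < s →
    ∃ χ : E2 → ℝ, ∃ P : ℝ, ContDiff ℝ smo χ ∧ (∀ x, 0 ≤ χ x) ∧ (∀ x, χ x ≤ 1) ∧
      (∀ i, ∀ᶠ x in 𝓝 (B i), χ x = 0) ∧ (∀ x ∈ Phi B s, χ x = 1 ∧ fderiv ℝ χ x = 0) ∧
      0 ≤ P ∧ (∀ x, ‖fderiv ℝ χ x‖ ≤ P) ∧ P ^ 2 * volume.real (TT B \ Phi B s) ≤ C ∧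
      volume.real (TT B \ Phi B s) ≤ C * s ^ 2 := by
  obtain ⟨K, hK0, hK⟩ := st_bound
  obtain ⟨D0, hD00, hD0⟩ := exD B 0
  obtain ⟨D1, hD10, hD1⟩ := exD B 1
  obtain ⟨D2, hD20, hD2⟩ := exD B 2
  set D := D0 + D1 + D2 with hDdef
  have hD : ∀ i, ∀ x ∈ TT B, ‖x - B i‖ ≤ D * (1 - B.coord i x) := by
    intro i x hx
    have hc : B.coord i x ≤ 1 := by
      have := coord_sum B x
      have h0 := (mem_TT B).1 hx 0
      have h1 := (mem_TT B).1 hx 1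
      have h2 := (mem_TT B).1 hx 2
      fin_cases i <;> simp only [Fin.zero_eta, Fin.mk_one, Fin.reduceFinMk] <;> linarith
    have h1 : 0 ≤ 1 - B.coord i x := by linarith
    fin_cases i
    · exact (hD0 x hx).trans (mul_le_mul_of_nonneg_right (by linarith) h1)
    · exact (hD1 x hx).trans (mul_le_mul_of_nonneg_right (by linarith) h1)
    · exact (hD2 x hx).trans (mul_le_mul_of_nonneg_right (by linarith) h1)
  have hDpos : 0 < D := by positivity
  set N := ‖cl B 0‖ + ‖cl B 1‖ + ‖cl B 2‖ with hN
  set V := volume.real (Metric.ball (0:E2) 1) with hV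
  have hV0 : 0 ≤ V := measureReal_nonneg
  have hvol : ∀ s : ℝ, 0 < s → volume.real (TT B \ Phi B s) ≤ 3 * ((2 * s * D) ^ 2 * V) := by
    intro s hs
    have hb : ∀ i, volume.real (Metric.ball (B i) (2 * s * D)) = (2 * s * D) ^ 2 * V := by
      intro i
      rw [measureReal_def, Measure.addHaar_ball _ _ (by positivity), ENNReal.toReal_mul, hV, measureReal_def,
        ENNReal.toReal_ofReal (by positivity)]
      simp
    have hsub : TT B \ Phi B s ⊆ ⋃ i, Metric.ball (B i) (2 * s * D) := by
      rintro x ⟨hx, hx2⟩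
      rw [Phi, mem_ofPred_eq] at hx2
      push Not at hx2
      obtain ⟨i, hi⟩ := hx2
      refine mem_iUnion.2 ⟨i, ?_⟩
      rw [mem_ball_iff_norm]
      refine (hD i x hx).trans_lt ?_
      rw [mul_comm]
      exact mul_lt_mul_of_pos_right hi hDpos
    have hfin : volume (⋃ i, Metric.ball (B i) (2 * s * D)) ≠ ⊤ := by
      refine ((measure_iUnion_fintype_le _ _).trans_lt ?_).ne
      exact ENNReal.sum_lt_top.2 fun i _ => measure_ball_lt_top
    refine (measureReal_mono hsub hfin).trans ?_
    refine (measureReal_iUnion_fintype_le _).trans ?_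
    rw [Fin.sum_univ_three, hb, hb, hb]
    linarith
  refine ⟨(K * N) ^ 2 * (3 * ((2 * D) ^ 2 * V)) + 3 * ((2 * D) ^ 2 * V), by positivity, fun s hs => ?_⟩
  have hct0 : ∀ i x, 0 ≤ ct B s i x := fun i x => Real.smoothTransition.nonneg _
  have hct1 : ∀ i x, ct B s i x ≤ 1 := fun i x => Real.smoothTransition.le_one _
  have hcta : ∀ i x, |ct B s i x| ≤ 1 := fun i x => by rw [abs_of_nonneg (hct0 i x)]; exact hct1 i x
  have hdf : ∀ i x, DifferentiableAt ℝ (ct B s i) x := fun i x =>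
    (ct_cd B s i).differentiable (by simp [smo]) x
  have hnf : ∀ i x, ‖fderiv ℝ (ct B s i) x‖ ≤ K / s * ‖cl B i‖ := by
    intro i x
    rw [ct_fd, norm_smul, Real.norm_eq_abs, abs_mul, abs_div, abs_neg, abs_one, abs_of_pos hs]
    gcongr
    rw [mul_one_div]
    gcongr
    exact hK _
  have h01 : ∀ x, DifferentiableAt ℝ (fun y => ct B s 0 y * ct B s 1 y) x := fun x => (hdf 0 x).mul (hdf 1 x)
  have h01a : ∀ x, |ct B s 0 x * ct B s 1 x| ≤ 1 := fun x => by
    rw [abs_mul]; exact mul_le_one₀ (hcta 0 x) (abs_nonneg _) (hcta 1 x)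
  have hnorm : ∀ x, ‖fderiv ℝ (fun x => ct B s 0 x * ct B s 1 x * ct B s 2 x) x‖ ≤
      ‖fderiv ℝ (ct B s 0) x‖ + ‖fderiv ℝ (ct B s 1) x‖ + ‖fderiv ℝ (ct B s 2) x‖ := by
    intro x
    have a := fd_mul_bound (h01 x) (hdf 2 x) (h01a x) (hcta 2 x)
    have b := fd_mul_bound (hdf 0 x) (hdf 1 x) (hcta 0 x) (hcta 1 x)
    linarith
  refine ⟨fun x => ct B s 0 x * ct B s 1 x * ct B s 2 x, K / s * N,
    ((ct_cd B s 0).mul (ct_cd B s 1)).mul (ct_cd B s 2),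
    fun x => mul_nonneg (mul_nonneg (hct0 0 x) (hct0 1 x)) (hct0 2 x), ?_, ?_, ?_, by positivity, ?_, ?_, ?_⟩
  · intro x
    exact (le_abs_self _).trans (by rw [abs_mul]; exact mul_le_one₀ (h01a x) (abs_nonneg _) (hcta 2 x))
  · intro i
    have : ∀ᶠ x in 𝓝 (B i), ct B s i x = 0 := by
      have h1 : Tendsto (fun x => 1 - B.coord i x) (𝓝 (B i)) (𝓝 (1 - B.coord i (B i))) :=
        ((continuous_const.sub (cont_coord B i)).tendsto _)
      rw [coord_self B, sub_self] at h1
      filter_upwards [h1.eventually_lt_const hs] with x hx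
      apply Real.smoothTransition.zero_of_nonpos
      rw [sub_nonpos, div_le_one hs]
      exact hx.le
    filter_upwards [this] with x hx
    fin_cases i <;> simp only [Fin.zero_eta, Fin.mk_one, Fin.reduceFinMk] at hx <;> rw [hx] <;> ring
  · intro x hx
    have hx1 : ∀ i, 1 ≤ (1 - B.coord i x) / s - 1 := by
      intro i
      have := hx i
      rw [le_sub_iff_add_le, le_div_iff₀ hs]
      linarith
    have e : ∀ i, ct B s i x = 1 := fun i => Real.smoothTransition.one_of_one_le (hx1 i)
    have e2 : ∀ i, fderiv ℝ (ct B s i) x = 0 := fun i => by rw [ct_fd, st_deriv_one (hx1 i)]; simp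
    refine ⟨by simp only [e]; norm_num, ?_⟩
    have := hnorm x
    rw [e2, e2, e2, norm_zero, add_zero, add_zero] at this
    exact norm_le_zero_iff.1 this
  · intro x
    refine (hnorm x).trans ?_
    have a := hnf 0 x; have b := hnf 1 x; have c := hnf 2 x
    rw [hN]; linarith
  · have h1 := mul_le_mul_of_nonneg_left (hvol s hs) (sq_nonneg (K / s * N))
    refine h1.trans ?_
    have : (K / s * N) ^ 2 * (3 * ((2 * s * D) ^ 2 * V)) = (K * N) ^ 2 * (3 * ((2 * D) ^ 2 * V)) := by
      field_simp
    rw [this]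
    have : 0 ≤ 3 * ((2 * D) ^ 2 * V) := by positivity
    linarith
  · refine (hvol s hs).trans ?_
    have : 0 ≤ (K * N) ^ 2 * (3 * ((2 * D) ^ 2 * V)) * s ^ 2 := by positivity
    nlinarith

end NT

namespace NT
open MeasureTheory Filter Topology

variable {B : AffineBasis (Fin 3) ℝ E2} {m : ℝ} {u : E2 → ℝ}

/-- gradient relative to the punctured triangle -/
def Gw (B : AffineBasis (Fin 3) ℝ E2) (u : E2 → ℝ) (p : E2) : E2 :=
  (InnerProductSpace.toDual ℝ E2).symm (fderivWithin ℝ u (DD B) p)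

theorem DD_nhds {p : E2} (hp : p ∈ interior (TT B)) : DD B ∈ 𝓝 p :=
  mem_of_superset (isOpen_interior.mem_nhds hp) (int_DD B)

theorem Gw_int (u : E2 → ℝ) {p : E2} (hp : p ∈ interior (TT B)) : Gw B u p = gr u p := by
  rw [Gw, gr, fderivWithin_of_mem_nhds (DD_nhds hp)]

theorem Gw_cd (hu : ContDiffOn ℝ smo u (DD B)) : ContDiffOn ℝ 1 (Gw B u) (DD B) :=
  ((InnerProductSpace.toDual ℝ E2).symm.toContinuousLinearEquiv.contDiff).comp_contDiffOn
    (hu.fderivWithin (DD_ud B) (m := 1) smo11)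

theorem cut_cd {χ w : E2 → ℝ} (hχ : ContDiff ℝ smo χ) (hv : ∀ i, ∀ᶠ x in 𝓝 (B i), χ x = 0)
    (hw : ContDiffOn ℝ smo w (DD B)) (hu : ContDiffOn ℝ smo u (DD B)) :
    ContDiffOn ℝ 1 (fun p => (χ p * w p) • Gw B u p) (TT B) := by
  intro p hp
  by_cases hr : p ∈ range B
  · obtain ⟨i, rfl⟩ := hr
    have : (fun p => (χ p * w p) • Gw B u p) =ᶠ[𝓝 (B i)] fun _ => (0:E2) := by
      filter_upwards [hv i] with x hx
      rw [hx, zero_mul, zero_smul]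
    exact ((contDiffAt_const (c := (0:E2))).congr_of_eventuallyEq this).contDiffWithinAt
  · have h1 : ContDiffWithinAt ℝ 1 (fun p => (χ p * w p) • Gw B u p) (DD B) p :=
      (((hχ.of_le smo1).contDiffWithinAt).mul ((hw p ⟨hp, hr⟩).of_le smo1)).smul (Gw_cd hu p ⟨hp, hr⟩)
    refine h1.mono_of_mem_nhdsWithin ?_
    filter_upwards [self_mem_nhdsWithin,
      mem_nhdsWithin_of_mem_nhds ((range_closed B).isOpen_compl.mem_nhds hr)] with x hx hx2
    exact ⟨hx, hx2⟩

theorem divT2 (B : AffineBasis (Fin 3) ℝ E2) {X : E2 → E2} (hX : ContDiffOn ℝ 1 X (TT B))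
    (hb : ∀ i, ∀ p ∈ TT B, B.coord i p = 0 → cl B i (X p) = 0) :
    IntegrableOn (dvg X) (TT B) ∧ ∫ p in TT B, dvg X p = 0 := by
  have hc : ContinuousOn (fderivWithin ℝ X (TT B)) (TT B) :=
    hX.continuousOn_fderivWithin (uniqueDiffOn_convex (convex_TT B) (int_ne B)) le_rfl
  have hi : IntegrableOn (fderivWithin ℝ X (TT B)) (TT B) := hc.integrableOn_compact (isCompact_TT B)
  have hi2 : IntegrableOn (fun p => fderiv ℝ X p) (TT B) := by
    rw [IntegrableOn, ← restrict_int] at hi ⊢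
    refine hi.congr ?_
    filter_upwards [ae_restrict_mem isOpen_interior.measurableSet] with x hx
    exact fderivWithin_of_mem_nhds (mem_interior_iff_mem_nhds.1 hx)
  refine ⟨?_, divT B hX.continuousOn ?_ hi2 hb⟩
  · have L : ∀ i : Fin 2, IntegrableOn (fun p => (fderiv ℝ X p (ee i)) i) (TT B) := by
      intro i
      exact ((EuclideanSpace.proj i : E2 →L[ℝ] ℝ).comp
        (ContinuousLinearMap.apply ℝ E2 (ee i))).integrable_comp hi2
    exact (L 0).add (L 1)
  · intro p hp
    exact ((hX p (interior_subset hp)).contDiffAt (mem_interior_iff_mem_nhds.1 hp)).differentiableAt one_ne_zero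

theorem sol_div (h : Sol B m u) {χ w : E2 → ℝ} (hχ : ContDiff ℝ smo χ)
    (hv : ∀ i, ∀ᶠ x in 𝓝 (B i), χ x = 0) (hw : ContDiffOn ℝ smo w (DD B)) :
    ∃ d : E2 → ℝ, IntegrableOn d (TT B) ∧ ∫ p in TT B, d p = 0 ∧
      ∀ p ∈ interior (TT B), d p = χ p ^ 2 * fderiv ℝ w p (gr u p) +
        2 * χ p * w p * fderiv ℝ χ p (gr u p) - m * χ p ^ 2 * w p * u p := by
  have hχ2 : ContDiff ℝ smo (fun p => χ p * χ p) := hχ.mul hχ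
  have hv2 : ∀ i, ∀ᶠ x in 𝓝 (B i), (fun p => χ p * χ p) x = 0 := fun i => by
    filter_upwards [hv i] with x hx
    simp [hx]
  have hX := cut_cd hχ2 hv2 hw h.smooth
  obtain ⟨h1, h2⟩ := divT2 B hX (by
    intro i p hp hpi
    rw [map_smul, smul_eq_mul]
    by_cases hr : p ∈ range B
    · obtain ⟨j, rfl⟩ := hr
      rw [(hv j).self_of_nhds]; simp
    · have := h.neu i p ⟨hp, hr⟩ hpi
      rw [← nn_inner, real_inner_comm, Gw, InnerProductSpace.toDual_symm_apply, this, mul_zero])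
  refine ⟨_, h1, h2, ?_⟩
  intro p hp
  have hev : (fun p => (χ p * χ p * w p) • Gw B u p) =ᶠ[𝓝 p] fun p => (χ p * χ p * w p) • gr u p := by
    filter_upwards [isOpen_interior.mem_nhds hp] with x hx
    rw [Gw_int u hx]
  have hev2 : Gw B u =ᶠ[𝓝 p] gr u := by
    filter_upwards [isOpen_interior.mem_nhds hp] with x hx
    rw [Gw_int u hx]
  have hgd : DifferentiableAt ℝ (gr u) p := by
    have := ((Gw_cd h.smooth) p (int_DD B hp)).contDiffAt (DD_nhds hp)
    exact (this.congr_of_eventuallyEq hev2.symm).differentiableAt one_ne_zero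
  have hwd : DifferentiableAt ℝ w p :=
    ((hw p (int_DD B hp)).contDiffAt (DD_nhds hp)).differentiableAt (by simp [smo])
  have hcd : DifferentiableAt ℝ χ p := hχ.differentiable (by simp [smo]) p
  have hccd : DifferentiableAt ℝ (fun p => χ p * χ p) p := hcd.mul hcd
  have hcwd : DifferentiableAt ℝ (fun p => χ p * χ p * w p) p := hccd.mul hwd
  have e1 : dvg (fun p => (χ p * χ p * w p) • Gw B u p) p = dvg (fun p => (χ p * χ p * w p) • gr u p) p := by
    unfold dvg; rw [hev.fderiv_eq]
  rw [e1, dvg_smul hcwd hgd, lap_dvg hgd]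
  have e2 : lap u p = - (m * u p) := by
    rw [← h.eqn p hp]; exact (neg_neg _).symm
  rw [e2, fderiv_fun_mul hccd hwd, fderiv_fun_mul hcd hcd]
  simp only [_root_.add_apply, _root_.smul_apply, smul_eq_mul]
  ring

theorem chi_int (h : Sol B m u) {χ : E2 → ℝ} (hχ : ContDiff ℝ smo χ)
    (hv : ∀ i, ∀ᶠ x in 𝓝 (B i), χ x = 0) :
    Integrable (fun p => χ p ^ 2 * ‖fderiv ℝ u p‖ ^ 2) (μT B) := by
  have hX := (cut_cd (w := fun _ => 1) hχ hv contDiffOn_const h.smooth).continuousOn.norm.pow 2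
  have hi := hX.integrableOn_compact (isCompact_TT B) (μ := volume)
  rw [IntegrableOn, ← restrict_int] at hi
  rw [μT, ← restrict_int]
  refine hi.congr ?_
  filter_upwards [ae_restrict_mem isOpen_interior.measurableSet] with x hx
  show ‖(χ x * 1) • Gw B u x‖ ^ 2 = _
  rw [Gw_int u hx, norm_smul, gr_norm, mul_pow, mul_one, Real.norm_eq_abs, sq_abs]

theorem Phi_meas (B : AffineBasis (Fin 3) ℝ E2) (s : ℝ) : MeasurableSet (Phi B s) := by
  have : Phi B s = ⋂ i, {x | 2 * s ≤ 1 - B.coord i x} := by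
    ext x; simp [Phi]
  rw [this]
  exact MeasurableSet.iInter fun i =>
    (isClosed_le continuous_const (continuous_const.sub (cont_coord B i))).measurableSet

theorem Phi_cover (B : AffineBasis (Fin 3) ℝ E2) : AECover (μT B) (𝓝[>] (0:ℝ)) (Phi B) where
  measurableSet := Phi_meas B
  ae_eventually_mem := by
    rw [μT, ← restrict_int]
    filter_upwards [ae_restrict_mem isOpen_interior.measurableSet] with x hx
    have hx' := (mem_int_TT B).1 hx
    have hsum := coord_sum B x
    have h1 : ∀ i, B.coord i x < 1 := by
      intro i
      have h0 := hx' 0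
      have h1 := hx' 1
      have h2 := hx' 2
      fin_cases i <;> simp only [Fin.zero_eta, Fin.mk_one, Fin.reduceFinMk] <;> linarith
    have : ∀ i, ∀ᶠ s in 𝓝[>] (0:ℝ), 2 * s ≤ 1 - B.coord i x := by
      intro i
      have ht : Tendsto (fun s : ℝ => 2 * s) (𝓝[>] 0) (𝓝 (2 * 0)) :=
        ((continuous_const.mul continuous_id).tendsto 0).mono_left nhdsWithin_le_nhds
      rw [mul_zero] at ht
      exact (ht.eventually_lt_const (by linarith [h1 i] : (0:ℝ) < 1 - B.coord i x)).mono fun _ => le_of_lt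
    exact eventually_all.2 this

theorem muPhi (B : AffineBasis (Fin 3) ℝ E2) (s : ℝ) :
    (μT B).real (Phi B s)ᶜ = volume.real (TT B \ Phi B s) := by
  rw [measureReal_def, μT, Measure.restrict_apply (Phi_meas B s).compl, measureReal_def, inter_comm, sdiff_eq]

theorem cross {δ a b c : ℝ} (hδ : 0 < δ) : |2 * a * b * c| ≤ δ * (b * c) ^ 2 + δ⁻¹ * a ^ 2 := by
  have h1 : 0 ≤ δ⁻¹ * (a - δ * (b * c)) ^ 2 := by positivity
  have h2 : 0 ≤ δ⁻¹ * (a + δ * (b * c)) ^ 2 := by positivity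
  have e1 : δ⁻¹ * (a - δ * (b * c)) ^ 2 = δ * (b * c) ^ 2 + δ⁻¹ * a ^ 2 - 2 * a * b * c := by
    field_simp; ring
  have e2 : δ⁻¹ * (a + δ * (b * c)) ^ 2 = δ * (b * c) ^ 2 + δ⁻¹ * a ^ 2 + 2 * a * b * c := by
    field_simp; ring
  rw [abs_le]; constructor <;> linarith

theorem cross2 {χ : E2 → ℝ} {x : E2} {P M δ w : ℝ} (hP : ‖fderiv ℝ χ x‖ ≤ P) (hδ : 0 < δ) (hw : |w| ≤ M) :
    |2 * χ x * w * fderiv ℝ χ x (gr u x)| ≤ δ * (M ^ 2 * P ^ 2) + δ⁻¹ * (χ x ^ 2 * ‖fderiv ℝ u x‖ ^ 2) := by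
  have h1 : |fderiv ℝ χ x (gr u x)| ≤ P * ‖fderiv ℝ u x‖ := by
    have := (fderiv ℝ χ x).le_opNorm (gr u x)
    rw [gr_norm] at this
    exact this.trans (mul_le_mul_of_nonneg_right hP (norm_nonneg _))
  have hP0 : 0 ≤ P := (norm_nonneg _).trans hP
  have hM0 : 0 ≤ M := (abs_nonneg _).trans hw
  have h2 : |2 * χ x * w * fderiv ℝ χ x (gr u x)| ≤ |2 * (|χ x| * ‖fderiv ℝ u x‖) * M * P| := by
    rw [abs_mul, abs_mul, abs_mul, abs_mul, abs_mul, abs_mul, abs_mul, abs_abs, abs_norm, abs_of_nonneg hP0,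
      abs_of_nonneg hM0]
    have : |(2:ℝ)| * |χ x| * |w| * |fderiv ℝ χ x (gr u x)| ≤ |(2:ℝ)| * |χ x| * M * (P * ‖fderiv ℝ u x‖) := by
      gcongr
    linarith
  refine h2.trans ((cross hδ).trans (le_of_eq ?_))
  rw [mul_pow, mul_pow, sq_abs]

theorem est_energy (h : Sol B m u) (hm : 0 ≤ m) {M : ℝ} (hM : ∀ x ∈ TT B, |u x| ≤ M) {χ : E2 → ℝ} {s P C δ : ℝ}
    (hδ : 0 < δ)
    (hχ : ContDiff ℝ smo χ) (h0 : ∀ x, 0 ≤ χ x) (h1 : ∀ x, χ x ≤ 1) (hv : ∀ i, ∀ᶠ x in 𝓝 (B i), χ x = 0)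
    (hΦ : ∀ x ∈ Phi B s, χ x = 1 ∧ fderiv ℝ χ x = 0) (hP : ∀ x, ‖fderiv ℝ χ x‖ ≤ P)
    (hC : P ^ 2 * volume.real (TT B \ Phi B s) ≤ C) :
    ∫ x, χ x ^ 2 * ‖fderiv ℝ u x‖ ^ 2 ∂μT B ≤ m * ∫ x, u x ^ 2 ∂μT B + δ * (M ^ 2 * C) +
      δ⁻¹ * ∫ x in (Phi B s)ᶜ, χ x ^ 2 * ‖fderiv ℝ u x‖ ^ 2 ∂μT B := by
  obtain ⟨d, hd1, hd2, hd3⟩ := sol_div h hχ hv h.smooth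
  have hF := chi_int h hχ hv
  have hu2 : Integrable (fun x => u x ^ 2) (μT B) := (h.cont.pow 2).integrableOn_compact (isCompact_TT B)
  set F := fun x => χ x ^ 2 * ‖fderiv ℝ u x‖ ^ 2 with hFd
  have hR : Integrable ((Phi B s)ᶜ.indicator fun x => δ * (M ^ 2 * P ^ 2) + δ⁻¹ * F x) (μT B) :=
    (((integrable_const _).add (hF.const_mul _))).indicator (Phi_meas B s).compl
  have hle : ∫ x, F x ∂μT B ≤ ∫ x, (d x + m * u x ^ 2 +
      (Phi B s)ᶜ.indicator (fun x => δ * (M ^ 2 * P ^ 2) + δ⁻¹ * F x) x) ∂μT B := by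
    refine integral_mono_ae hF ((Integrable.add hd1 (hu2.const_mul m)).add hR) ?_
    rw [μT, ← restrict_int]
    filter_upwards [ae_restrict_mem isOpen_interior.measurableSet] with x hx
    have e := hd3 x hx
    have e2 : fderiv ℝ u x (gr u x) = ‖fderiv ℝ u x‖ ^ 2 := by
      rw [← gr_inner, real_inner_self_eq_norm_sq, gr_norm]
    rw [e2] at e
    have hcc : χ x ^ 2 * u x ^ 2 ≤ u x ^ 2 := by
      have : χ x ^ 2 ≤ 1 := pow_le_one₀ (h0 x) (h1 x)
      nlinarith [sq_nonneg (u x)]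
    have hmc := mul_le_mul_of_nonneg_left hcc hm
    by_cases hp : x ∈ Phi B s
    · rw [indicator_of_notMem (by simpa using hp), (e)]
      rw [(hΦ x hp).2]
      simp only [hFd, _root_.zero_apply]
      nlinarith
    · rw [indicator_of_mem (by simpa using hp), e]
      have := (abs_le.1 (cross2 (u := u) (hP x) hδ (hM x (interior_subset hx)))).1
      simp only [hFd]
      nlinarith
  refine hle.trans ?_
  have hdm : Integrable (fun x => d x + m * u x ^ 2) (μT B) := Integrable.add hd1 (hu2.const_mul m)
  rw [integral_add hdm hR, integral_add hd1 (hu2.const_mul m), hd2,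
    integral_indicator (Phi_meas B s).compl, integral_const_mul,
    integral_add (integrable_const _) (hF.const_mul _).integrableOn, integral_const_mul δ⁻¹,
    integral_const, measureReal_restrict_apply_univ, muPhi, smul_eq_mul]
  have : volume.real (TT B \ Phi B s) * (δ * (M ^ 2 * P ^ 2)) ≤ δ * (M ^ 2 * C) := by
    have := mul_le_mul_of_nonneg_left hC (by positivity : 0 ≤ δ * M ^ 2)
    linarith
  linarith

theorem est_mean (h : Sol B m u) (hm : 0 ≤ m) {M : ℝ} (hM : ∀ x ∈ TT B, |u x| ≤ M) {χ : E2 → ℝ} {s P C δ : ℝ}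
    (hδ : 0 < δ) (hM0 : 0 ≤ M)
    (hχ : ContDiff ℝ smo χ) (h0 : ∀ x, 0 ≤ χ x) (h1 : ∀ x, χ x ≤ 1) (hv : ∀ i, ∀ᶠ x in 𝓝 (B i), χ x = 0)
    (hΦ : ∀ x ∈ Phi B s, χ x = 1 ∧ fderiv ℝ χ x = 0) (hP : ∀ x, ‖fderiv ℝ χ x‖ ≤ P)
    (hC : P ^ 2 * volume.real (TT B \ Phi B s) ≤ C) (hCs : volume.real (TT B \ Phi B s) ≤ C * s ^ 2) :
    |m * ∫ x, u x ∂μT B| ≤ m * M * (C * s ^ 2) + δ * C +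
      δ⁻¹ * ∫ x in (Phi B s)ᶜ, χ x ^ 2 * ‖fderiv ℝ u x‖ ^ 2 ∂μT B := by
  obtain ⟨d, hd1, hd2, hd3⟩ := sol_div (w := fun _ => 1) h hχ hv contDiffOn_const
  have hF := chi_int h hχ hv
  have hu : Integrable u (μT B) := h.cont.integrableOn_compact (isCompact_TT B)
  set F := fun x => χ x ^ 2 * ‖fderiv ℝ u x‖ ^ 2 with hFd
  have hR : Integrable ((Phi B s)ᶜ.indicator fun x => (m * M + δ * P ^ 2) + δ⁻¹ * F x) (μT B) :=
    (((integrable_const _).add (hF.const_mul _))).indicator (Phi_meas B s).compl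
  have e0 : m * ∫ x, u x ∂μT B = ∫ x, (m * u x + d x) ∂μT B := by
    rw [integral_add (hu.const_mul m) hd1, hd2, integral_const_mul, add_zero]
  rw [e0]
  have hle := norm_integral_le_of_norm_le (f := fun x => m * u x + d x) hR (by
    rw [μT, ← restrict_int]
    filter_upwards [ae_restrict_mem isOpen_interior.measurableSet] with x hx
    have e := hd3 x hx
    rw [Real.norm_eq_abs]
    by_cases hp : x ∈ Phi B s
    · rw [indicator_of_notMem (by simpa using hp), e, (hΦ x hp).2, (hΦ x hp).1]
      simp
    · rw [indicator_of_mem (by simpa using hp), e]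
      have hc := cross2 (u := u) (w := 1) (M := 1) (hP x) hδ (by simp)
      have hz : fderiv ℝ (fun _ : E2 => (1:ℝ)) x (gr u x) = 0 := by simp
      rw [hz]
      have hx1 : χ x ^ 2 ≤ 1 := pow_le_one₀ (h0 x) (h1 x)
      have hb : |m * (1 - χ x ^ 2) * u x| ≤ m * M := by
        rw [abs_mul, abs_mul, abs_of_nonneg hm, abs_of_nonneg (by linarith : 0 ≤ 1 - χ x ^ 2)]
        have a1 := hM x (interior_subset hx)
        have a2 : (1 - χ x ^ 2) * |u x| ≤ 1 * M :=
          mul_le_mul (by nlinarith [sq_nonneg (χ x)]) a1 (abs_nonneg _) zero_le_one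
        nlinarith
      have e3 : m * u x + (χ x ^ 2 * 0 + 2 * χ x * 1 * fderiv ℝ χ x (gr u x) - m * χ x ^ 2 * 1 * u x) =
        m * (1 - χ x ^ 2) * u x + 2 * χ x * 1 * fderiv ℝ χ x (gr u x) := by ring
      rw [e3]
      refine (abs_add_le _ _).trans ?_
      simp only [hFd]
      linarith)
  rw [Real.norm_eq_abs] at hle
  refine hle.trans ?_
  rw [integral_indicator (Phi_meas B s).compl,
    integral_add (integrable_const _) (hF.const_mul _).integrableOn, integral_const_mul δ⁻¹,
    integral_const, measureReal_restrict_apply_univ, muPhi, smul_eq_mul]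
  have a := mul_le_mul_of_nonneg_left hC hδ.le
  have b := mul_le_mul_of_nonneg_left hCs (by positivity : 0 ≤ m * M)
  linarith

theorem sol_main (h : Sol B m u) (hm : 0 < m) :
    IntegrableOn (fun p => ‖fderiv ℝ u p‖ ^ 2) (TT B) ∧
    ∫ p in TT B, ‖fderiv ℝ u p‖ ^ 2 ≤ m * ∫ p in TT B, u p ^ 2 ∧ ∫ p in TT B, u p = 0 := by
  obtain ⟨C, hC0, hcut⟩ := exists_cut B
  obtain ⟨M, hM⟩ := (isCompact_TT B).exists_bound_of_continuousOn h.cont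
  simp only [Real.norm_eq_abs] at hM
  have hM0 : 0 ≤ M := by
    obtain ⟨x, hx⟩ := int_ne B
    exact (abs_nonneg _).trans (hM x (interior_subset hx))
  set f := fun p => ‖fderiv ℝ u p‖ ^ 2 with hf
  have hcov := Phi_cover B
  have key : ∀ s : ℝ, 0 < s → IntegrableOn f (Phi B s) (μT B) ∧ ∃ E EA : ℝ, 0 ≤ EA ∧
      ∫ x in Phi B s, f x ∂μT B = E - EA ∧
      (∀ δ, 0 < δ → E ≤ m * ∫ x, u x ^ 2 ∂μT B + δ * (M ^ 2 * C) + δ⁻¹ * EA) ∧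
      (∀ δ, 0 < δ → |m * ∫ x, u x ∂μT B| ≤ m * M * (C * s ^ 2) + δ * C + δ⁻¹ * EA) ∧
      (Integrable f (μT B) → EA ≤ ∫ x, f x ∂μT B - ∫ x in Phi B s, f x ∂μT B) := by
    intro s hs
    obtain ⟨χ, P, hχ, h0, h1, hv, hΦ, hP0, hP, hC, hCs⟩ := hcut s hs
    have hF := chi_int h hχ hv
    have hcongr : EqOn (fun x => χ x ^ 2 * ‖fderiv ℝ u x‖ ^ 2) f (Phi B s) := by
      intro x hx
      simp only [(hΦ x hx).1, hf]; ring
    refine ⟨hF.integrableOn.congr_fun hcongr (Phi_meas B s), _, _, ?_, ?_,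
      fun δ hδ => est_energy h hm.le hM hδ hχ h0 h1 hv hΦ hP hC,
      fun δ hδ => est_mean h hm.le hM hδ hM0 hχ h0 h1 hv hΦ hP hC hCs, ?_⟩
    · exact integral_nonneg fun x => by positivity
    · rw [← integral_add_compl (Phi_meas B s) hF, add_sub_cancel_right]
      exact (setIntegral_congr_fun (Phi_meas B s) hcongr).symm
    · intro hfi
      rw [← integral_add_compl (Phi_meas B s) hfi, add_sub_cancel_left]
      refine setIntegral_mono hF.integrableOn hfi.integrableOn ?_
      intro x
      have : χ x ^ 2 ≤ 1 := pow_le_one₀ (h0 x) (h1 x)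
      simp only [hf]
      nlinarith [sq_nonneg ‖fderiv ℝ u x‖]
  have hpos : ∀ᶠ s in 𝓝[>] (0:ℝ), 0 < s := self_mem_nhdsWithin
  have hfi : Integrable f (μT B) := by
    have hst : Tendsto (fun n : ℕ => 1 / ((n:ℝ) + 1)) atTop (𝓝[>] 0) := by
      refine tendsto_nhdsWithin_iff.2 ⟨tendsto_one_div_add_atTop_nhds_zero_nat, ?_⟩
      exact Eventually.of_forall fun n => by rw [mem_Ioi]; positivity
    refine (hcov.comp_tendsto hst).integrable_of_integral_norm_bounded (2 * (m * ∫ x, u x ^ 2 ∂μT B + 2 * (M ^ 2 * C)))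
      (fun n => (key _ (by positivity)).1) ?_
    · refine Eventually.of_forall fun n => ?_
      have hs : (0:ℝ) < 1 / ((n:ℝ) + 1) := by positivity
      show ∫ x in Phi B (1 / ((n:ℝ) + 1)), ‖f x‖ ∂μT B ≤ _
      set s := 1 / ((n:ℝ) + 1)
      obtain ⟨-, E, EA, k1, k2, k3, k4, k5⟩ := key s hs
      have e : ∫ x in Phi B s, ‖f x‖ ∂μT B = ∫ x in Phi B s, f x ∂μT B := by
        congr 1
        funext x
        exact Real.norm_of_nonneg (sq_nonneg _)
      have a := k3 2 two_pos
      have b : 0 ≤ ∫ x in Phi B s, f x ∂μT B := integral_nonneg fun x => sq_nonneg _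
      rw [e]
      linarith
  have hlim := hcov.integral_tendsto_of_countably_generated hfi
  have hq : ∀ δ, 0 < δ → ∫ x, f x ∂μT B ≤ m * ∫ x, u x ^ 2 ∂μT B + δ * (M ^ 2 * C) := by
    intro δ hδ
    have hlim2 : Tendsto (fun s => m * ∫ x, u x ^ 2 ∂μT B + δ * (M ^ 2 * C) +
        δ⁻¹ * (∫ x, f x ∂μT B - ∫ x in Phi B s, f x ∂μT B)) (𝓝[>] 0)
        (𝓝 (m * ∫ x, u x ^ 2 ∂μT B + δ * (M ^ 2 * C) + δ⁻¹ * (∫ x, f x ∂μT B - ∫ x, f x ∂μT B))) :=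
      ((hlim.const_sub _).const_mul _).const_add _
    rw [sub_self, mul_zero, add_zero] at hlim2
    refine le_of_tendsto_of_tendsto hlim hlim2 ?_
    filter_upwards [hpos] with s hs
    obtain ⟨-, E, EA, k1, k2, k3, k4, k5⟩ := key s hs
    have a := k3 δ hδ
    have b := mul_le_mul_of_nonneg_left (k5 hfi) (inv_pos.2 hδ).le
    linarith
  have hq2 : ∀ δ, 0 < δ → |m * ∫ x, u x ∂μT B| ≤ δ * C := by
    intro δ hδ
    have hs2 : Tendsto (fun s : ℝ => m * M * (C * s ^ 2)) (𝓝[>] 0) (𝓝 (m * M * (C * 0 ^ 2))) :=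
      (Continuous.tendsto (by fun_prop) 0).mono_left nhdsWithin_le_nhds
    have hlim2 : Tendsto (fun s => m * M * (C * s ^ 2) + δ * C +
        δ⁻¹ * (∫ x, f x ∂μT B - ∫ x in Phi B s, f x ∂μT B)) (𝓝[>] 0)
        (𝓝 (m * M * (C * 0 ^ 2) + δ * C + δ⁻¹ * (∫ x, f x ∂μT B - ∫ x, f x ∂μT B))) :=
      (hs2.add_const _).add ((hlim.const_sub _).const_mul _)
    have ez : m * M * (C * 0 ^ 2) + δ * C + δ⁻¹ * (∫ x, f x ∂μT B - ∫ x, f x ∂μT B) = δ * C := by ring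
    rw [ez] at hlim2
    refine ge_of_tendsto hlim2 ?_
    filter_upwards [hpos] with s hs
    obtain ⟨-, E, EA, k1, k2, k3, k4, k5⟩ := key s hs
    have a := k4 δ hδ
    have b := mul_le_mul_of_nonneg_left (k5 hfi) (inv_pos.2 hδ).le
    linarith
  refine ⟨hfi, ?_, ?_⟩
  · have hl : Tendsto (fun δ : ℝ => m * ∫ x, u x ^ 2 ∂μT B + δ * (M ^ 2 * C)) (𝓝[>] 0)
        (𝓝 (m * ∫ x, u x ^ 2 ∂μT B + 0 * (M ^ 2 * C))) :=
      (Continuous.tendsto (by fun_prop) 0).mono_left nhdsWithin_le_nhds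
    rw [zero_mul, add_zero] at hl
    exact ge_of_tendsto hl (hpos.mono hq)
  · have hl : Tendsto (fun δ : ℝ => δ * C) (𝓝[>] 0) (𝓝 (0 * C)) :=
      (Continuous.tendsto (by fun_prop) 0).mono_left nhdsWithin_le_nhds
    rw [zero_mul] at hl
    have := ge_of_tendsto hl (hpos.mono hq2)
    have h3 := abs_nonpos_iff.1 this
    exact (mul_eq_zero.1 h3).resolve_left hm.ne'

end NT

namespace NT
open MeasureTheory Filter Topology

variable {B : AffineBasis (Fin 3) ℝ E2} {m : ℝ} {u v : E2 → ℝ}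

theorem Sol.cda (h : Sol B m u) {p : E2} (hp : p ∈ interior (TT B)) : ContDiffAt ℝ smo u p :=
  (h.smooth p (int_DD B hp)).contDiffAt (DD_nhds hp)

theorem Sol.fdd (h : Sol B m u) {p : E2} (hp : p ∈ interior (TT B)) (a : E2) :
    DifferentiableAt ℝ (fun y => fderiv ℝ u y a) p := by
  have : ContDiffAt ℝ 1 (fderiv ℝ u) p := (h.cda hp).fderiv_right smo11
  exact (this.differentiableAt one_ne_zero).clm_apply (differentiableAt_const a)

theorem mixed_lin (h : Sol B m u) (k : Sol B m v) (a b : ℝ) {p : E2} (hp : p ∈ interior (TT B)) (x y : E2) :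
    mixedDeriv (fun z => a * u z + b * v z) p x y = a * mixedDeriv u p x y + b * mixedDeriv v p x y := by
  unfold mixedDeriv
  have e : (fun z => fderiv ℝ (fun z => a * u z + b * v z) z x) =ᶠ[𝓝 p]
      fun z => a * fderiv ℝ u z x + b * fderiv ℝ v z x := by
    filter_upwards [isOpen_interior.mem_nhds hp] with z hz
    have d1 : DifferentiableAt ℝ u z := (h.cda hz).differentiableAt (by simp [smo])
    have d2 : DifferentiableAt ℝ v z := (k.cda hz).differentiableAt (by simp [smo])
    rw [fderiv_fun_add (d1.const_mul a) (d2.const_mul b), fderiv_const_mul d1, fderiv_const_mul d2]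
    simp
  rw [e.fderiv_eq, fderiv_fun_add ((h.fdd hp x).const_mul a) ((k.fdd hp x).const_mul b),
    fderiv_const_mul (h.fdd hp x), fderiv_const_mul (k.fdd hp x)]
  simp

theorem Sol.lin (h : Sol B m u) (k : Sol B m v) (a b : ℝ) : Sol B m (fun z => a * u z + b * v z) where
  cont := (continuousOn_const.mul h.cont).add (continuousOn_const.mul k.cont)
  smooth := (contDiffOn_const.mul h.smooth).add (contDiffOn_const.mul k.smooth)
  eqn := by
    intro p hp
    have h1 := h.eqn p hp
    have h2 := k.eqn p hp
    unfold negLap at h1 h2 ⊢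
    rw [mixed_lin h k a b hp, mixed_lin h k a b hp]
    linear_combination a * h1 + b * h2
  neu := by
    intro i p hp hi
    have d1 : DifferentiableWithinAt ℝ u (DD B) p := (h.smooth p hp).differentiableWithinAt (by simp [smo])
    have d2 : DifferentiableWithinAt ℝ v (DD B) p := (k.smooth p hp).differentiableWithinAt (by simp [smo])
    have ud := DD_ud B p hp
    rw [fderivWithin_fun_add ud (d1.const_mul a) (d2.const_mul b), fderivWithin_const_mul ud d1,
      fderivWithin_const_mul ud d2]
    simp [h.neu i p hp hi, k.neu i p hp hi]

theorem exists_abc (p q : Fin 3 → ℝ) : ∃ c : Fin 3 → ℝ, c ≠ 0 ∧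
    c 0 * p 0 + c 1 * p 1 + c 2 * p 2 = 0 ∧ c 0 * q 0 + c 1 * q 1 + c 2 * q 2 = 0 := by
  let A : Matrix (Fin 2) (Fin 3) ℝ := ![p, q]
  have hk := LinearMap.ker_ne_bot_of_finrank_lt (f := Matrix.toLin' A) (by simp)
  obtain ⟨c, hc, hc0⟩ := Submodule.exists_mem_ne_zero_of_ne_bot hk
  refine ⟨c, hc0, ?_, ?_⟩
  · have := congrFun (LinearMap.mem_ker.1 hc) 0
    rw [Matrix.toLin'_apply, Matrix.mulVec, dotProduct, Fin.sum_univ_three] at this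
    simp only [A, Matrix.cons_val_zero, Pi.zero_apply] at this
    linarith
  · have := congrFun (LinearMap.mem_ker.1 hc) 1
    rw [Matrix.toLin'_apply, Matrix.mulVec, dotProduct, Fin.sum_univ_three] at this
    have e : A 1 = q := rfl
    rw [e, Pi.zero_apply] at this
    linarith

theorem zero_of_sq (B : AffineBasis (Fin 3) ℝ E2) (hu : ContinuousOn u (TT B))
    (h : ∫ p in TT B, u p ^ 2 ≤ 0) : ∀ z ∈ TT B, u z = 0 := by
  have hi : IntegrableOn (fun p => u p ^ 2) (TT B) := (hu.pow 2).integrableOn_compact (isCompact_TT B)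
  have h0 : ∫ p in TT B, u p ^ 2 = 0 := le_antisymm h (integral_nonneg fun x => sq_nonneg _)
  have hae := (integral_eq_zero_iff_of_nonneg (fun x => sq_nonneg (u x)) hi).1 h0
  rw [← restrict_int] at hae
  have hz : EqOn (fun p => u p ^ 2) 0 (interior (TT B)) := by
    refine Measure.eqOn_open_of_ae_eq hae isOpen_interior ?_ continuousOn_const
    exact (hu.pow 2).mono interior_subset
  have hz2 : EqOn u 0 (interior (TT B)) := fun x hx => by simpa using hz hx
  intro z hz3
  exact (hz2.of_subset_closure hu continuousOn_const interior_subset (TT_cl B)) hz3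

theorem final (v₁ v₂ v₃ : E2) (hT : AffineIndependent ℝ ![v₁, v₂, v₃])
    (u₁ u₂ u₃ : E2 → ℝ)
    (h₁ : IsSecondNeumannEigenfun v₁ v₂ v₃ u₁)
    (h₂ : IsSecondNeumannEigenfun v₁ v₂ v₃ u₂)
    (h₃ : IsSecondNeumannEigenfun v₁ v₂ v₃ u₃) :
    ∃ a b c : ℝ, ¬ (a = 0 ∧ b = 0 ∧ c = 0) ∧
      ∀ z ∈ Tri v₁ v₂ v₃, a * u₁ z + b * u₂ z + c * u₃ z = 0 := by
  obtain ⟨μ, e1, m1⟩ := h₁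
  obtain ⟨μ2, e2, m2⟩ := h₂
  obtain ⟨μ3, e3, m3⟩ := h₃
  obtain rfl : μ = μ2 := le_antisymm (m1 _ _ e2) (m2 _ _ e1)
  obtain rfl : μ = μ3 := le_antisymm (m1 _ _ e3) (m3 _ _ e1)
  rw [eig_iff v₁ v₂ v₃ hT] at e1 e2 e3
  set B := Bas v₁ v₂ v₃ hT with hB
  obtain ⟨hμ, -, s1⟩ := e1
  obtain ⟨-, -, s2⟩ := e2
  obtain ⟨-, -, s3⟩ := e3
  obtain ⟨Λ, hΛ0, hΛ, hL⟩ := exLam B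
  obtain ⟨m, w, g, hm, hmΛ, hW⟩ := exists_weak B hΛ0 hΛ hL
  have hμm : μ ≤ m := m1 m (UU B m w)
    ((eig_iff v₁ v₂ v₃ hT m _).2 ⟨hm, UU_nonconst hW hm, sol_UU hW hm⟩)
  obtain ⟨c, hc0, hp, hq⟩ := exists_abc ![ell B 2 (0,0) u₁, ell B 2 (0,0) u₂, ell B 2 (0,0) u₃]
    ![ell B 2 (1,1) u₁, ell B 2 (1,1) u₂, ell B 2 (1,1) u₃]
  have s12 := s1.lin s2 (c 0) (c 1)
  have s := s12.lin s3 1 (c 2)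
  have hell : ∀ i ∈ idx 2, ell B 2 i (fun z => 1 * (c 0 * u₁ z + c 1 * u₂ z) + c 2 * u₃ z) =
      c 0 * ell B 2 i u₁ + c 1 * ell B 2 i u₂ + c 2 * ell B 2 i u₃ := by
    intro i hi
    rw [ell_add B hi (u := fun z => 1 * (c 0 * u₁ z + c 1 * u₂ z)) (v := fun z => c 2 * u₃ z)
      (continuousOn_const.mul s12.cont) (continuousOn_const.mul s3.cont), ell_smul, ell_smul,
      ell_add B hi (u := fun z => c 0 * u₁ z) (v := fun z => c 1 * u₂ z)
      (continuousOn_const.mul s1.cont) (continuousOn_const.mul s2.cont), ell_smul, ell_smul, one_mul]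
  obtain ⟨f1, f2, f3⟩ := sol_main s hμ
  set F := fun z => 1 * (c 0 * u₁ z + c 1 * u₂ z) + c 2 * u₃ z with hF
  have hP := poinc2 B hΛ s.cont (fun p hp => (s.cda hp).differentiableAt (by simp [smo])) f1 f3
    (by rw [hell _ (by simp [idx])]; simpa using hp) (by rw [hell _ (by simp [idx])]; simpa using hq)
  have hS0 : 0 ≤ ∫ p in TT B, F p ^ 2 := integral_nonneg fun x => sq_nonneg _
  have hΛμ : Λ * μ ≤ 36 := by
    have := hμm.trans hmΛ
    rw [le_div_iff₀ hΛ0] at this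
    linarith
  have h5 := mul_le_mul_of_nonneg_left f2 hΛ0.le
  have h6 := mul_le_mul_of_nonneg_right hΛμ hS0
  have hz := zero_of_sq B s.cont (by nlinarith)
  refine ⟨c 0, c 1, c 2, ?_, ?_⟩
  · rintro ⟨a, b, d⟩
    apply hc0
    funext i
    fin_cases i
    · exact a
    · exact b
    · exact d
  · intro z hz2
    rw [← Bas_TT v₁ v₂ v₃ hT] at hz2
    have := hz z hz2
    simp only [hF] at this
    linarith

end NT

/-- The space of second Neumann eigenfunctions of a triangle has dimension at most two:
any three of them are linearly dependent on the triangle. -/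
theorem second_eigenspace_dim_le_two
    (v₁ v₂ v₃ : E2) (hT : AffineIndependent ℝ ![v₁, v₂, v₃])
    (u₁ u₂ u₃ : E2 → ℝ)
    (h₁ : IsSecondNeumannEigenfun v₁ v₂ v₃ u₁)
    (h₂ : IsSecondNeumannEigenfun v₁ v₂ v₃ u₂)
    (h₃ : IsSecondNeumannEigenfun v₁ v₂ v₃ u₃) :
    ∃ a b c : ℝ, ¬ (a = 0 ∧ b = 0 ∧ c = 0) ∧
      ∀ z ∈ Tri v₁ v₂ v₃, a * u₁ z + b * u₂ z + c * u₃ z = 0 :=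
  NT.final v₁ v₂ v₃ hT u₁ u₂ u₃ h₁ h₂ h₃

end
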